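/- Let I ⊆ {1,…,n−1}, also regarded as a subset of {1,…,n}. Applying the operator Ext summand-by-summand to the decompositions R_{n,I} = ⊕_{λ⊢n} ⊕_{S ∈ SYT(λ), Dsi^c(S) ⊆ I} V^S_{h^S_I} and R^hom_{n,I} = ⊕_{λ⊢n} ⊕_{S ∈ SYT(λ), Dsi^c(S) ⊆ I} V^S_{h(I,S)}, one has R_{n+1,I} = Ext R_{n,I} and R^hom_{n+1,I} = Ext R^hom_{n,I} (as subspaces of Q[x_1,…,x_{n+1}]). -/

import Mathlib

open MvPolynomial

noncomputable section

namespace HigherSpecht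

open scoped Classical

/-- A tableau: a filling of the plane (row, column), `0`-indexed, with `0` outside the diagram. -/
abbrev Tab := ℕ × ℕ → ℕ

/-- A permutation of `ℕ` represents an element of `Sₙ` (acting on `{1, …, n}`)
when it fixes `0` and everything above `n`. -/
def SuppIn (n : ℕ) (w : Equiv.Perm ℕ) : Prop := ∀ i, i = 0 ∨ n < i → w i = i

/-- Descending locations of a permutation (one-line notation `w 1, …, w n`). -/
def DslSet (n : ℕ) (w : Equiv.Perm ℕ) : Finset ℕ :=
  (Finset.Ioo 0 n).filter fun i => w (i + 1) < w i

/-- Ascending locations of a permutation. -/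
def AslSet (n : ℕ) (w : Equiv.Perm ℕ) : Finset ℕ :=
  (Finset.Ioo 0 n).filter fun i => w i < w (i + 1)

/-- The row in which the entry `i` shows up in a tableau. -/
def rowIdx (T : Tab) (i : ℕ) : ℕ := sInf {r | ∃ c, T (r, c) = i}

/-- The column in which the entry `i` shows up in a tableau. -/
def colIdx (T : Tab) (i : ℕ) : ℕ := sInf {c | T (rowIdx T i, c) = i}

/-- The box containing the entry `i`. -/
def posOf (T : Tab) (i : ℕ) : ℕ × ℕ := (rowIdx T i, colIdx T i)

/-- Descending indices of a (standard) tableau: `i` with the row of `i+1` strictly below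
the row of `i`. -/
def DsiSet (n : ℕ) (T : Tab) : Finset ℕ :=
  (Finset.Ioo 0 n).filter fun i => rowIdx T i < rowIdx T (i + 1)

/-- `Dsi^c`, the complemented descent set `{n - i | i ∈ Dsi}`. -/
def Dsic (n : ℕ) (T : Tab) : Finset ℕ := (DsiSet n T).image fun i => n - i

/-- The entry of `ct_J(S)` at a box `c`: the number of elements of `J` smaller than the
entry of `S` at `c`. -/
def ctEntry (T : Tab) (J : Finset ℕ) (c : ℕ × ℕ) : ℕ := (J.filter fun j => j < T c).card

/-- The cocharge tableau `ct(S)` of a standard tableau. -/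
def ctTab (n : ℕ) (T : Tab) : Tab := fun c => ctEntry T (DsiSet n T) c

/-- The (total) cocharge `cc(S)`: the sum of the entries of `ct(S)`. -/
def ccStat (n : ℕ) (T : Tab) : ℕ :=
  ∑ i ∈ Finset.Icc 1 n, ctEntry T (DsiSet n T) (posOf T i)

/-- `T` is a bijective filling of the given set of cells by `1, …, n` (`n` the number of
cells), with `0` outside. -/
def IsFillingF (cells : Finset (ℕ × ℕ)) (T : Tab) : Prop :=
  (∀ c, c ∉ cells → T c = 0) ∧ Set.BijOn T ↑cells (Set.Icc 1 cells.card)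

/-- A bijective filling of a Young diagram. -/
def IsFilling (μ : YoungDiagram) (T : Tab) : Prop := IsFillingF μ.cells T

/-- A standard Young tableau of shape `μ`: entries strictly increase along rows and columns. -/
def IsStandard (μ : YoungDiagram) (T : Tab) : Prop :=
  IsFilling μ T ∧ ∀ c₁ ∈ μ.cells, ∀ c₂ ∈ μ.cells,
    c₁ ≠ c₂ → c₁.1 ≤ c₂.1 → c₁.2 ≤ c₂.2 → T c₁ < T c₂

/-! ### Robinson–Schensted -/

/-- Row insertion: insert `x` into a row, returning the new row and the bumped entry. -/
def rowInsert : ℕ → List ℕ → List ℕ × Option ℕ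
  | x, [] => ([x], none)
  | x, y :: ys =>
    if x < y then (x :: ys, some y)
    else
      let p := rowInsert x ys
      (y :: p.1, p.2)

/-- Insertion of an entry into a tableau, given as a list of rows. -/
def tabInsert : List (List ℕ) → ℕ → List (List ℕ)
  | [], x => [[x]]
  | r :: rs, x =>
    match rowInsert x r with
    | (r', none) => r' :: rs
    | (r', some y) => r' :: tabInsert rs y

/-- One-line notation of `w ∈ Sₙ`. -/
def oneLine (n : ℕ) (w : Equiv.Perm ℕ) : List ℕ := (List.range n).map fun i => w (i + 1)

/-- The insertion tableau of the first `m` letters of `w`, as a list of rows. -/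
def PtabListPart (n : ℕ) (w : Equiv.Perm ℕ) (m : ℕ) : List (List ℕ) :=
  ((oneLine n w).take m).foldl tabInsert []

/-- Entry of a list-of-rows tableau at a (0-indexed) cell. -/
def listEntry (t : List (List ℕ)) (c : ℕ × ℕ) : ℕ := (t.getD c.1 []).getD c.2 0

/-- The Robinson–Schensted insertion tableau `P(w)`. -/
def Ptab (n : ℕ) (w : Equiv.Perm ℕ) : Tab := fun c => listEntry (PtabListPart n w n) c

/-- The Robinson–Schensted recording tableau `Q(w)`: the entry of a cell is the step at
which the cell is added to the shape. -/
def Qtab (n : ℕ) (w : Equiv.Perm ℕ) : Tab := fun c =>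
  sInf {m | listEntry (PtabListPart n w m) c ≠ 0}

/-! ### Schützenberger evacuation -/

/-- One step of a jeu de taquin slide into the hole at `c`. -/
def slideOnce (T : Tab) (c : ℕ × ℕ) : Tab × (ℕ × ℕ) :=
  let rc : ℕ × ℕ := (c.1, c.2 + 1)
  let dc : ℕ × ℕ := (c.1 + 1, c.2)
  if T rc = 0 ∧ T dc = 0 then (T, c)
  else if T dc = 0 ∨ (T rc ≠ 0 ∧ T rc < T dc) then
    (Function.update (Function.update T c (T rc)) rc 0, rc)
  else
    (Function.update (Function.update T c (T dc)) dc 0, dc)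

/-- Jeu de taquin slide (with fuel). -/
def slide : ℕ → Tab → ℕ × ℕ → Tab × (ℕ × ℕ)
  | 0, T, c => (T, c)
  | k + 1, T, c =>
    let p := slideOnce T c
    if p.2 = c then (T, c) else slide k p.1 p.2

/-- The Schützenberger evacuation: repeatedly delete the minimal entry, slide into the hole,
decrement the remaining entries, and record the vacated cell. -/
def evacAux : ℕ → Tab → Tab
  | 0, _ => fun _ => 0
  | m + 1, T =>
    let c0 := posOf T 1
    let p := slide (m + 1) (Function.update T c0 0) c0
    Function.update (evacAux m fun c => p.1 c - 1) p.2 (m + 1)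

/-- The evacuation tableau `ev S` of a standard tableau with `n` boxes. -/
def evac (n : ℕ) (T : Tab) : Tab := evacAux n T

/-- `Q̃(w) := ev (Q w)`. -/
def Qt (n : ℕ) (w : Equiv.Perm ℕ) : Tab := evac n (Qtab n w)

/-! ### Row and column groups, higher Specht polynomials -/

/-- The identification of `Fin n` with `{1, …, n} ⊆ ℕ`. -/
def finShift (n : ℕ) : Fin n ≃ {i : ℕ // 1 ≤ i ∧ i ≤ n} where
  toFun j := ⟨(j : ℕ) + 1, by have := j.isLt; omega⟩
  invFun i := ⟨(i : ℕ) - 1, by have := i.2; omega⟩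
  left_inv j := by apply Fin.ext; simp
  right_inv i := by apply Subtype.ext; have := i.2; simp; omega

/-- Embedding of the permutations of `Fin n` into permutations of `ℕ` (acting on `{1, …, n}`). -/
def embedPerm (n : ℕ) (σ : Equiv.Perm (Fin n)) : Equiv.Perm ℕ :=
  σ.extendDomain (finShift n)

/-- The row group `R(T)` of a filling, as a finset of permutations of `Fin n`. -/
def rowFinset (n : ℕ) (T : Tab) : Finset (Equiv.Perm (Fin n)) :=
  Finset.univ.filter fun τ => ∀ i ∈ Finset.Icc 1 n, rowIdx T (embedPerm n τ i) = rowIdx T i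

/-- The column group `C(T)` of a filling, as a finset of permutations of `Fin n`. -/
def colFinset (n : ℕ) (T : Tab) : Finset (Equiv.Perm (Fin n)) :=
  Finset.univ.filter fun σ => ∀ i ∈ Finset.Icc 1 n, colIdx T (embedPerm n σ i) = colIdx T i

/-- The row group `R(T)` as a set of permutations of `ℕ`. -/
def rowGroupSet (n : ℕ) (T : Tab) : Set (Equiv.Perm ℕ) :=
  {w | SuppIn n w ∧ ∀ i ∈ Finset.Icc 1 n, rowIdx T (w i) = rowIdx T i}

/-- The column group `C(T)` as a set of permutations of `ℕ`. -/
def colGroupSet (n : ℕ) (T : Tab) : Set (Equiv.Perm ℕ) :=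
  {w | SuppIn n w ∧ ∀ i ∈ Finset.Icc 1 n, colIdx T (w i) = colIdx T i}

/-- The Young symmetrizer `ε_T = Σ_{σ ∈ C(T)} Σ_{τ ∈ R(T)} sgn(σ) σ τ` acting on polynomials
(permutations acting by permuting the variables). -/
def epsAct (n : ℕ) (T : Tab) (p : MvPolynomial ℕ ℚ) : MvPolynomial ℕ ℚ :=
  ∑ σ ∈ colFinset n T, ∑ τ ∈ rowFinset n T,
    (Equiv.Perm.sign σ : ℤ) • rename (⇑(embedPerm n σ * embedPerm n τ)) p

/-- The monomial `p_T^S = Π_i x_i^{h_i}`, where `h_i` is the entry of `ct S` in the box of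
`T` containing `i`. -/
def pTS (n : ℕ) (T S : Tab) : MvPolynomial ℕ ℚ :=
  ∏ i ∈ Finset.Icc 1 n, X i ^ ctEntry S (DsiSet n S) (posOf T i)

/-- `s_T^S`: the order of the stabilizer of `p_T^S` in `R(T)`. -/
def sTS (n : ℕ) (T S : Tab) : ℕ :=
  ((rowFinset n T).filter fun τ =>
    rename (⇑(embedPerm n τ)) (pTS n T S) = pTS n T S).card

/-- The higher Specht polynomial `F_T^S := ε_T p_T^S / s_T^S`. -/
def FTS (n : ℕ) (T S : Tab) : MvPolynomial ℕ ℚ :=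
  ((sTS n T S : ℚ)⁻¹) • epsAct n T (pTS n T S)

/-- The higher Specht polynomial `F_w := F_{P(w)}^{Q̃(w)}` of a permutation. -/
def Fw (n : ℕ) (w : Equiv.Perm ℕ) : MvPolynomial ℕ ℚ := FTS n (Ptab n w) (Qt n w)

/-- The elementary symmetric polynomial `e_r` in the variables `x_1, …, x_n`. -/
def esym (n r : ℕ) : MvPolynomial ℕ ℚ :=
  ∑ s ∈ (Finset.Icc 1 n).powersetCard r, ∏ i ∈ s, X i

/-- The representation `V^S`: the span of the higher Specht polynomials `F_T^S` over all
bijective fillings `T` of the given cells. -/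
def VS (n : ℕ) (cells : Finset (ℕ × ℕ)) (S : Tab) : Submodule ℚ (MvPolynomial ℕ ℚ) :=
  Submodule.span ℚ {p | ∃ T : Tab, IsFillingF cells T ∧ p = FTS n T S}

/-- Multiplication of a subspace of polynomials by a fixed polynomial. -/
def polyMul (q : MvPolynomial ℕ ℚ) (V : Submodule ℚ (MvPolynomial ℕ ℚ)) :
    Submodule ℚ (MvPolynomial ℕ ℚ) :=
  Submodule.map (LinearMap.mulLeft ℚ q) V

/-- The symmetric multiplier `Π_r e_r^{h_r}`. -/
def eProd (n : ℕ) (h : ℕ → ℕ) : MvPolynomial ℕ ℚ := ∏ r ∈ Finset.Icc 1 n, esym n r ^ h r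

/-- `V^S_h := (Π_r e_r^{h_r}) V^S`. -/
def VSh (n : ℕ) (cells : Finset (ℕ × ℕ)) (S : Tab) (h : ℕ → ℕ) :
    Submodule ℚ (MvPolynomial ℕ ℚ) :=
  polyMul (eProd n h) (VS n cells S)

/-! ### The representations `R_{n,I}` -/

/-- For `i ∈ I`, `r_i := #{j ∈ {1,…,n-1} \ I : j < i}`. -/
def rIdxI (n : ℕ) (I : Finset ℕ) (i : ℕ) : ℕ :=
  ((Finset.Ioo 0 n \ I).filter fun j => j < i).card

/-- The vector `h^S_I`, whose `r`-th entry (for `r ≥ 1`) is `#{i ∈ I \ Dsi^c(S) : r_i = r}`. -/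
def hSI (n : ℕ) (I : Finset ℕ) (S : Tab) : ℕ → ℕ := fun r =>
  if 1 ≤ r then ((I \ Dsic n S).filter fun i => rIdxI n I i = r).card else 0

/-- The indicator vector `h(I,S)` of the set `I \ Dsi^c(S)`. -/
def hInd (n : ℕ) (I : Finset ℕ) (S : Tab) : ℕ → ℕ := fun r =>
  if r ∈ I \ Dsic n S then 1 else 0

/-- `F_{w,I} := F_w · Π_{i ∈ I \ Dsl(w)} e_{r_i}`. -/
def FwI (n : ℕ) (I : Finset ℕ) (w : Equiv.Perm ℕ) : MvPolynomial ℕ ℚ :=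
  Fw n w * ∏ i ∈ I \ DslSet n w, esym n (rIdxI n I i)

/-- The homogeneous version `F^hom_{w,I} := F_w · Π_{i ∈ I \ Dsl(w)} e_i`. -/
def FwIhom (n : ℕ) (I : Finset ℕ) (w : Equiv.Perm ℕ) : MvPolynomial ℕ ℚ :=
  Fw n w * ∏ i ∈ I \ DslSet n w, esym n i

/-- The representation `R_{n,I}`: span of the `F_{w,I}` over `w` with `Dsl(w) ⊆ I`. -/
def RnI (n : ℕ) (I : Finset ℕ) : Submodule ℚ (MvPolynomial ℕ ℚ) :=
  Submodule.span ℚ {p | ∃ w : Equiv.Perm ℕ, SuppIn n w ∧ DslSet n w ⊆ I ∧ p = FwI n I w}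

/-- The homogeneous representation `R^hom_{n,I}`. -/
def RnIhom (n : ℕ) (I : Finset ℕ) : Submodule ℚ (MvPolynomial ℕ ℚ) :=
  Submodule.span ℚ {p | ∃ w : Equiv.Perm ℕ, SuppIn n w ∧ DslSet n w ⊆ I ∧ p = FwIhom n I w}

/-- The index type for the decomposition of `R_{n,I}`: pairs of a partition `λ ⊢ n` and a
standard Young tableau `S` of shape `λ` with `Dsi^c(S) ⊆ I`. -/
def SIdx (n : ℕ) (I : Finset ℕ) : Type :=
  {q : YoungDiagram × Tab // q.1.cells.card = n ∧ IsStandard q.1 q.2 ∧ Dsic n q.2 ⊆ I}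

/-! ### Ordered set partitions -/

/-- The cumulative values `j_h` attached to a subset `I ⊆ {1,…,n-1}` (`j_0 = 0`,
`j_h` the `h`-th smallest element, `j_{|I|+1} = n`). -/
def jval (n : ℕ) (I : Finset ℕ) (h : ℕ) : ℕ :=
  if h = 0 then 0 else if h ≤ I.card then (I.sort (· ≤ ·)).getD (h - 1) 0 else n

/-- The composition `comp_n I`, as a function of the index `0 ≤ h ≤ |I|`. -/
def compFun (n : ℕ) (I : Finset ℕ) (h : ℕ) : ℕ := jval n I (h + 1) - jval n I h

/-- The set `OP_{n,I}` of ordered set partitions of `{1,…,n}` into `|I| + 1` blocks whose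
sizes are given by `comp_n I` (blocks indexed by `ℕ`, empty from index `|I| + 1` on). -/
def OPset (n : ℕ) (I : Finset ℕ) : Set (ℕ → Finset ℕ) :=
  {B | (∀ h, I.card + 1 ≤ h → B h = ∅) ∧
       (∀ h₁ h₂, h₁ ≠ h₂ → Disjoint (B h₁) (B h₂)) ∧
       (∀ h ≤ I.card, (B h).card = compFun n I h) ∧
       Finset.Icc 1 n = (Finset.range (I.card + 1)).biUnion B}

/-- The natural action of a permutation on an ordered set partition. -/
def permOP (w : Equiv.Perm ℕ) (B : ℕ → Finset ℕ) : ℕ → Finset ℕ := fun h => (B h).image w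

/-! ### The quotient `R_{n,k}` -/

/-- Elementary symmetric polynomials in `Fin n` variables. -/
def esymFin (n r : ℕ) : MvPolynomial (Fin n) ℚ :=
  ∑ s ∈ (Finset.univ : Finset (Fin n)).powersetCard r, ∏ i ∈ s, X i

/-- The ideal defining `R_{n,k}`: generated by `x_i^k` and `e_r`, `n-k+1 ≤ r ≤ n`. -/
def Jnk (n k : ℕ) : Ideal (MvPolynomial (Fin n) ℚ) :=
  Ideal.span ((Set.range fun i : Fin n => (X i : MvPolynomial (Fin n) ℚ) ^ k) ∪
    {p | ∃ r, n - k + 1 ≤ r ∧ r ≤ n ∧ p = esymFin n r})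

/-- The map sending `x_i` (for `1 ≤ i ≤ n`) to the corresponding variable of
`ℚ[x_1, …, x_n]`, and all other variables to `0`. -/
def toFin (n : ℕ) : MvPolynomial ℕ ℚ →ₐ[ℚ] MvPolynomial (Fin n) ℚ :=
  aeval fun i => if h : 1 ≤ i ∧ i ≤ n then X (⟨i - 1, by omega⟩ : Fin n) else 0

/-- The quotient projection onto `R_{n,k}`. -/
def projNK (n k : ℕ) : MvPolynomial ℕ ℚ →ₐ[ℚ] (MvPolynomial (Fin n) ℚ ⧸ Jnk n k) :=
  (Ideal.Quotient.mkₐ ℚ (Jnk n k)).comp (toFin n)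

/-! ### Corners, insertions and the induction/extension operators -/

/-- `v` is an external corner of `μ`. -/
def IsCorner (μ : YoungDiagram) (v : ℕ × ℕ) : Prop :=
  v ∉ μ.cells ∧ ∃ ν : YoungDiagram, ν.cells = insert v μ.cells

/-- `S +̃ v := ev (ev S + v)`, where `+ v` places the entry `n + 1` in the box `v`. -/
def Sadd (n : ℕ) (S : Tab) (v : ℕ × ℕ) : Tab :=
  evac (n + 1) (Function.update (evac n S) v (n + 1))

/-- `δ^{S,v}`: `0` if `v` lies strictly below the row of `n` in `ev S`, and `1` otherwise. -/
def deltaSV (n : ℕ) (S : Tab) (v : ℕ × ℕ) : ℕ :=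
  if rowIdx (evac n S) n < v.1 then 0 else 1

/-- `h + δ·1_t`: add `δ` to the coordinate `t` of `h` when `t ≥ 1`; do nothing for `t = 0`. -/
def addAt (h : ℕ → ℕ) (t δ : ℕ) : ℕ → ℕ := fun r =>
  if r = t ∧ 1 ≤ t then h r + δ else h r

/-- The induction operator on a single summand:
`Ind_t V^S_h := ⊕_{v ∈ EC(λ)} V^{S +̃ v}_{h + δ^{S,v}·1_t}`. -/
def IndVSh (t n : ℕ) (μ : YoungDiagram) (S : Tab) (h : ℕ → ℕ) :
    Submodule ℚ (MvPolynomial ℕ ℚ) :=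
  ⨆ v : ℕ × ℕ, ⨆ _ : IsCorner μ v,
    VSh (n + 1) (insert v μ.cells) (Sadd n S v) (addAt h t (deltaSV n S v))

/-- The extension operator on a single summand:
`Ext V^S_h := ⊕_{v ∈ EC(λ), δ^{S,v} = 1} V^{S +̃ v}_h`. -/
def ExtVSh (n : ℕ) (μ : YoungDiagram) (S : Tab) (h : ℕ → ℕ) :
    Submodule ℚ (MvPolynomial ℕ ℚ) :=
  ⨆ v : ℕ × ℕ, ⨆ _ : IsCorner μ v ∧ deltaSV n S v = 1,
    VSh (n + 1) (insert v μ.cells) (Sadd n S v) h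

/-- `Ind_t R_{n,I}`, applied summand-by-summand to the decomposition of `R_{n,I}`. -/
def IndR (t n : ℕ) (I : Finset ℕ) : Submodule ℚ (MvPolynomial ℕ ℚ) :=
  ⨆ q : SIdx n I, IndVSh t n q.1.1 q.1.2 (hSI n I q.1.2)

/-- `Ext R_{n,I}`, applied summand-by-summand. -/
def ExtR (n : ℕ) (I : Finset ℕ) : Submodule ℚ (MvPolynomial ℕ ℚ) :=
  ⨆ q : SIdx n I, ExtVSh n q.1.1 q.1.2 (hSI n I q.1.2)

/-- `Ind_t R^hom_{n,I}`, applied summand-by-summand. -/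
def IndRhom (t n : ℕ) (I : Finset ℕ) : Submodule ℚ (MvPolynomial ℕ ℚ) :=
  ⨆ q : SIdx n I, IndVSh t n q.1.1 q.1.2 (hInd n I q.1.2)

/-- `Ext R^hom_{n,I}`, applied summand-by-summand. -/
def ExtRhom (n : ℕ) (I : Finset ℕ) : Submodule ℚ (MvPolynomial ℕ ℚ) :=
  ⨆ q : SIdx n I, ExtVSh n q.1.1 q.1.2 (hInd n I q.1.2)

/-- The lift `R̃_{n,k} = ⊕_{|I| = k-1} R_{n,I}` of the quotient `R_{n,k}`. -/
def Rtil (n k : ℕ) : Submodule ℚ (MvPolynomial ℕ ℚ) :=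
  ⨆ I : Finset ℕ, ⨆ _ : I ⊆ Finset.Ioo 0 n ∧ I.card + 1 = k, RnI n I

/-! ### The extended column group -/

/-- The length of column `c` of a tableau. -/
def colLenT (n : ℕ) (T : Tab) (c : ℕ) : ℕ :=
  ((Finset.range (n + 1)).filter fun r => T (r, c) ≠ 0).card

/-- `q_a`: the number of columns of length `> a` (columns of length `a` occupy the
`0`-indexed columns `q_a, …, q_a + t_a - 1`). -/
def qaT (n : ℕ) (T : Tab) (a : ℕ) : ℕ :=
  ((Finset.range (n + 1)).filter fun c => a < colLenT n T c).card

/-- `t_a`: the number of columns of length `a`. -/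
def taT (n : ℕ) (T : Tab) (a : ℕ) : ℕ :=
  ((Finset.range (n + 1)).filter fun c => colLenT n T c = a).card

/-- The function underlying the permutation `η_T`: the entry in row `j` of column `q_a + i`
is sent to the entry in row `j` of column `q_a + η(i)`; everything else is fixed. -/
def etaFun (n : ℕ) (T : Tab) (a : ℕ) (η : Equiv.Perm ℕ) : ℕ → ℕ := fun m =>
  let c := colIdx T m
  if 1 ≤ m ∧ m ≤ n ∧ qaT n T a ≤ c ∧ c < qaT n T a + taT n T a then
    T (rowIdx T m, qaT n T a + η (c - qaT n T a))
  else m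

/-- The set of the permutations `η_T` (over all `a ≥ 1` and all `η ∈ S_{t_a}`). -/
def etaSet (n : ℕ) (T : Tab) : Set (Equiv.Perm ℕ) :=
  {w | ∃ a, 1 ≤ a ∧ ∃ η : Equiv.Perm ℕ, (∀ i, taT n T a ≤ i → η i = i) ∧
    ⇑w = etaFun n T a η}

/-- The subgroup generated by the permutations `η_T` (a copy of `Π_a S_{t_a}`). -/
def etaSubgroup (n : ℕ) (T : Tab) : Subgroup (Equiv.Perm ℕ) :=
  Subgroup.closure (etaSet n T)

/-- The column group `C(T)` as a subgroup. -/
def colSubgroup (n : ℕ) (T : Tab) : Subgroup (Equiv.Perm ℕ) :=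
  Subgroup.closure (colGroupSet n T)

/-- The extended column group `C̃(T)`, generated by `C(T)` and the `η_T`. -/
def extColSubgroup (n : ℕ) (T : Tab) : Subgroup (Equiv.Perm ℕ) :=
  Subgroup.closure (colGroupSet n T ∪ etaSet n T)

/-- The sign of a permutation of `ℕ` supported on `{1, …, n}`. -/
def signOn (n : ℕ) (σ : Equiv.Perm ℕ) : ℤ :=
  if h : ∃ τ : Equiv.Perm (Fin n), embedPerm n τ = σ then
    (Equiv.Perm.sign h.choose : ℤ) else 0

/-! ### Semistandard tableaux, (generalized) cocharge tableaux -/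

/-- A semistandard filling of the given cells: rows weakly increase, columns strictly
increase (entries outside the cells are normalized to `0`). -/
def IsSSYTOn (cells : Finset (ℕ × ℕ)) (C : Tab) : Prop :=
  (∀ c ∉ cells, C c = 0) ∧
  (∀ c₁ ∈ cells, ∀ c₂ ∈ cells, c₁.1 = c₂.1 → c₁.2 ≤ c₂.2 → C c₁ ≤ C c₂) ∧
  (∀ c₁ ∈ cells, ∀ c₂ ∈ cells, c₁.2 = c₂.2 → c₁.1 < c₂.1 → C c₁ < C c₂)

/-- A generalized cocharge tableau with entries exactly `{0, …, k-1}`. -/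
def IsGCT (cells : Finset (ℕ × ℕ)) (C : Tab) (k : ℕ) : Prop :=
  IsSSYTOn cells C ∧ (∀ c ∈ cells, C c < k) ∧ ∀ h < k, ∃ c ∈ cells, C c = h

/-- The type of a generalized cocharge tableau: the set of cumulative multiplicities
`#{c : C c < h}` for `1 ≤ h ≤ k - 1`. -/
def gctType (cells : Finset (ℕ × ℕ)) (C : Tab) (k : ℕ) : Finset ℕ :=
  (Finset.Ico 1 k).image fun h => (cells.filter fun c => C c < h).card

/-- The standardization of a semistandard tableau: entries are replaced by `1, …, n`,
processing the values in increasing order and, for equal values, from left to right. -/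
def stdz (cells : Finset (ℕ × ℕ)) (C : Tab) : Tab := fun c =>
  if c ∈ cells then
    (cells.filter fun c' => C c' < C c ∨
      (C c' = C c ∧ (c'.2 < c.2 ∨ (c'.2 = c.2 ∧ c'.1 ≤ c.1)))).card
  else 0

/-- A cocharge tableau of shape `μ`: one of the form `ct S` for a standard `S`. -/
def IsCCT (μ : YoungDiagram) (C : Tab) : Prop :=
  ∃ S : Tab, IsStandard μ S ∧ ctTab μ.cells.card S = C

/-- `k` for a tableau: one more than the maximal entry. -/
def kOf (cells : Finset (ℕ × ℕ)) (C : Tab) : ℕ := cells.sup C + 1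

/-- `Dsp^c(C) := {n - i : i ∈ J}`, `J` the type of the cocharge tableau `C`. -/
def Dspc (n : ℕ) (cells : Finset (ℕ × ℕ)) (C : Tab) : Finset ℕ :=
  (gctType cells C (kOf cells C)).image fun i => n - i

/-- The entry sum `Σ(C)`. -/
def entrySum (cells : Finset (ℕ × ℕ)) (C : Tab) : ℕ := ∑ c ∈ cells, C c

/-- `C +̂ v := ct (ct⁻¹(C) +̃ v)`, where `ct⁻¹` is the standardization. -/
def Cadd (n : ℕ) (μ : YoungDiagram) (C : Tab) (v : ℕ × ℕ) : Tab :=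
  ctTab (n + 1) (Sadd n (stdz μ.cells C) v)

/-- The standard Young tableau `S⁰` of shape `μ` filling the rows consecutively. -/
def rowWordTab (μ : YoungDiagram) : Tab := fun c =>
  if c ∈ μ.cells then (∑ r ∈ Finset.range c.1, μ.rowLen r) + c.2 + 1 else 0

/-- The word of an ordered set partition: the blocks listed in order, each sorted
increasingly. -/
def opWord (k : ℕ) (B : ℕ → Finset ℕ) : List ℕ :=
  (List.range k).foldr (fun h acc => (B h).sort (· ≤ ·) ++ acc) []

/-- Renaming the variables of a power series along a permutation. -/
def permSeries (g : Equiv.Perm ℕ) (F : MvPowerSeries ℕ ℚ) : MvPowerSeries ℕ ℚ :=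
  fun m => F (Finsupp.mapDomain ⇑g⁻¹ m)



/-- Working form of standardness. -/
structure Std (n : ℕ) (T : Tab) : Prop where
  mono : ∀ a b : ℕ × ℕ, a ≤ b → a ≠ b → T b ≠ 0 → T a ≠ 0 ∧ T a < T b
  inj : ∀ a b, T a = T b → T a ≠ 0 → a = b
  le : ∀ a, T a ≤ n
  surj : ∀ m, 1 ≤ m → m ≤ n → ∃ a, T a = m

theorem rowIdx_eq {T : Tab} (hinj : ∀ a b, T a = T b → T a ≠ 0 → a = b) {a : ℕ × ℕ}
    (ha : T a ≠ 0) : rowIdx T (T a) = a.1 := by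
  have : {r | ∃ c, T (r, c) = T a} = {a.1} := by
    ext r
    constructor
    · rintro ⟨c, hc⟩
      have := hinj _ _ hc (by rw [hc]; exact ha)
      rw [← this]; rfl
    · rintro rfl
      exact ⟨a.2, rfl⟩
  rw [rowIdx, this, csInf_singleton]

theorem colIdx_eq {T : Tab} (hinj : ∀ a b, T a = T b → T a ≠ 0 → a = b) {a : ℕ × ℕ}
    (ha : T a ≠ 0) : colIdx T (T a) = a.2 := by
  have : {c | T (rowIdx T (T a), c) = T a} = {a.2} := by
    ext c
    rw [rowIdx_eq hinj ha]
    constructor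
    · intro hc
      have := hinj _ _ hc (by rw [hc]; exact ha)
      rw [← this]; rfl
    · rintro rfl
      rfl
  rw [colIdx, this, csInf_singleton]

theorem posOf_eq {T : Tab} (hinj : ∀ a b, T a = T b → T a ≠ 0 → a = b) {a : ℕ × ℕ}
    (ha : T a ≠ 0) : posOf T (T a) = a := by
  rw [posOf, rowIdx_eq hinj ha, colIdx_eq hinj ha]

theorem Std.of_isStandard {n : ℕ} {μ : YoungDiagram} {T : Tab} (h : IsStandard μ T)
    (hn : μ.cells.card = n) : Std n T ∧ ∀ a, T a ≠ 0 ↔ a ∈ μ.cells := by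
  obtain ⟨⟨h0, hb⟩, hm⟩ := h
  have hs : ∀ a, T a ≠ 0 ↔ a ∈ μ.cells := by
    intro a
    constructor
    · intro ha; by_contra hc; exact ha (h0 a hc)
    · intro ha
      have := hb.mapsTo (Finset.mem_coe.2 ha)
      have := this.1
      omega
  refine ⟨⟨?_, ?_, ?_, ?_⟩, hs⟩
  · intro a b hab hne hTb
    have hbm := (hs b).1 hTb
    have ham : a ∈ μ.cells := μ.isLowerSet hab hbm
    exact ⟨(hs a).2 ham, hm a ham b hbm hne hab.1 hab.2⟩
  · intro a b hab ha
    exact hb.injOn ((hs a).1 ha) ((hs b).1 (hab ▸ ha)) hab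
  · intro a
    by_cases ha : a ∈ μ.cells
    · have := (hb.mapsTo (Finset.mem_coe.2 ha)).2; omega
    · rw [h0 a ha]; omega
  · intro m h1 h2
    obtain ⟨a, _, ha⟩ := hb.surjOn (show m ∈ Set.Icc 1 μ.cells.card from ⟨h1, by omega⟩)
    exact ⟨a, ha⟩

theorem Std.card {n : ℕ} {T : Tab} (h : Std n T) (s : Finset (ℕ × ℕ))
    (hs : ∀ a, T a ≠ 0 ↔ a ∈ s) : s.card = n := by
  have : s.image T = Finset.Icc 1 n := by
    ext m
    simp only [Finset.mem_image, Finset.mem_Icc]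
    constructor
    · rintro ⟨a, ha, rfl⟩
      have := (hs a).2 ha
      exact ⟨by omega, h.le a⟩
    · rintro ⟨h1, h2⟩
      obtain ⟨a, rfl⟩ := h.surj m h1 h2
      exact ⟨a, (hs a).1 (by omega), rfl⟩
  rw [← Finset.card_image_of_injOn (f := T) (s := s), this]
  · simp
  · intro a ha b hb hab
    exact h.inj a b hab ((hs a).2 ha)

theorem Std.isStandard {n : ℕ} {μ : YoungDiagram} {T : Tab} (h : Std n T)
    (hs : ∀ a, T a ≠ 0 ↔ a ∈ μ.cells) : IsStandard μ T := by
  have hc := h.card _ hs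
  refine ⟨⟨?_, ?_, ?_, ?_⟩, ?_⟩
  · intro c hc
    by_contra h'
    exact hc ((hs c).1 h')
  · intro a ha
    have := (hs a).2 ha
    have := h.le a
    exact ⟨by omega, by omega⟩
  · intro a ha b hb hab
    exact h.inj a b hab ((hs a).2 ha)
  · intro m hm
    obtain ⟨a, rfl⟩ := h.surj m hm.1 (by have := hm.2; omega)
    exact ⟨a, (hs a).1 (by have := hm.1; omega), rfl⟩
  · intro a ha b hb hne h1 h2
    exact (h.mono a b ⟨h1, h2⟩ hne ((hs b).2 hb)).2

theorem Std.exists_diagram {n : ℕ} {T : Tab} (h : Std n T) :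
    ∃ μ : YoungDiagram, ∀ a, T a ≠ 0 ↔ a ∈ μ.cells := by
  have hf : {a | T a ≠ 0}.Finite := by
    apply Set.Finite.of_finite_image (f := T)
    · exact (Set.finite_Icc 0 n).subset (by rintro _ ⟨a, _, rfl⟩; exact ⟨by omega, h.le a⟩)
    · intro a ha b hb hab
      exact h.inj a b hab ha
  refine ⟨⟨hf.toFinset, ?_⟩, ?_⟩
  · intro b a hab hb
    simp only [Finset.mem_coe, Set.Finite.mem_toFinset, Set.mem_setOf_eq] at *
    by_cases hne : a = b
    · rwa [hne]
    · exact (h.mono a b hab hne hb).1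
  · intro a
    simp

theorem Std.row {n : ℕ} {T : Tab} (h : Std n T) {a : ℕ × ℕ} (ha : T a ≠ 0) :
    rowIdx T (T a) = a.1 := rowIdx_eq h.inj ha

/-- Membership in the descent set through positions. -/
theorem Std.mem_Dsi {n : ℕ} {T : Tab} (h : Std n T) {a b : ℕ × ℕ} (ha : T a ≠ 0)
    (hb : T b = T a + 1) : T a ∈ DsiSet n T ↔ a.1 < b.1 := by
  have h1 := h.row ha
  have h2 := h.row (a := b) (by omega)
  have h3 := h.le b
  rw [hb] at h2
  simp only [DsiSet, Finset.mem_filter, Finset.mem_Ioo, h1, h2]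
  constructor
  · exact fun h => h.2
  · exact fun h => ⟨⟨by omega, by omega⟩, h⟩


/-! ### Jeu de taquin slides -/

/-- A standard-like filling with a hole at `h`. -/
structure Hole (T : Tab) (h : ℕ × ℕ) : Prop where
  hole : T h = 0
  mono : ∀ a b : ℕ × ℕ, a ≤ b → a ≠ b → a ≠ h → T b ≠ 0 → T a ≠ 0 ∧ T a < T b
  inj : ∀ a b, T a = T b → T a ≠ 0 → a = b

/-- The next position of the hole. -/
def nxt (T : Tab) (c : ℕ × ℕ) : ℕ × ℕ :=
  if T (c.1, c.2 + 1) = 0 ∧ T (c.1 + 1, c.2) = 0 then c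
  else if T (c.1 + 1, c.2) = 0 ∨ (T (c.1, c.2 + 1) ≠ 0 ∧ T (c.1, c.2 + 1) < T (c.1 + 1, c.2)) then
    (c.1, c.2 + 1)
  else (c.1 + 1, c.2)

/-- The filling after one elementary slide. -/
def stepT (T : Tab) (c : ℕ × ℕ) : Tab :=
  Function.update (Function.update T c (T (nxt T c))) (nxt T c) 0

theorem slide_succ (k : ℕ) (T : Tab) (c : ℕ × ℕ) :
    slide (k + 1) T c = if nxt T c = c then (T, c) else slide k (stepT T c) (nxt T c) := by
  have h : slide (k + 1) T c = if (slideOnce T c).2 = c then (T, c)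
      else slide k (slideOnce T c).1 (slideOnce T c).2 := rfl
  rw [h]
  unfold slideOnce stepT nxt
  dsimp only
  split_ifs <;> simp_all

theorem slide_zero (T : Tab) (c : ℕ × ℕ) : slide 0 T c = (T, c) := rfl

theorem nxt_cases (T : Tab) (c : ℕ × ℕ) :
    (nxt T c = c ∧ T (c.1, c.2 + 1) = 0 ∧ T (c.1 + 1, c.2) = 0) ∨
    (nxt T c = (c.1, c.2 + 1) ∧ T (c.1, c.2 + 1) ≠ 0 ∧
      (T (c.1 + 1, c.2) = 0 ∨ T (c.1, c.2 + 1) < T (c.1 + 1, c.2))) ∨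
    (nxt T c = (c.1 + 1, c.2) ∧ T (c.1 + 1, c.2) ≠ 0 ∧
      (T (c.1, c.2 + 1) = 0 ∨ T (c.1 + 1, c.2) ≤ T (c.1, c.2 + 1))) := by
  unfold nxt
  split_ifs with h1 h2
  · left; exact ⟨rfl, h1⟩
  · right; left
    refine ⟨rfl, ?_, ?_⟩ <;> tauto
  · right; right
    refine ⟨rfl, ?_, ?_⟩
    · tauto
    · by_cases h : T (c.1, c.2 + 1) = 0
      · left; exact h
      · right
        by_contra h'
        exact h2 (Or.inr ⟨h, by omega⟩)

theorem le_succ_of {h b : ℕ × ℕ} (hb : h ≤ b) (hne : h ≠ b) :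
    (h.1, h.2 + 1) ≤ b ∨ (h.1 + 1, h.2) ≤ b := by
  obtain ⟨h1, h2⟩ := h
  obtain ⟨b1, b2⟩ := b
  simp only [Prod.mk_le_mk, ne_eq, Prod.mk.injEq, not_and] at *
  by_cases h : h1 = b1
  · have := hne h; left; omega
  · right; omega

theorem Hole.nxt_eq_self {T : Tab} {h : ℕ × ℕ} (H : Hole T h) (hn : nxt T h = h) :
    ∀ b, h ≤ b → b ≠ h → T b = 0 := by
  intro b hb hne
  have h0 : T (h.1, h.2 + 1) = 0 ∧ T (h.1 + 1, h.2) = 0 := by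
    rcases nxt_cases T h with h' | h' | h'
    · exact h'.2
    · have := h'.1.symm.trans hn
      simp [Prod.ext_iff] at this
    · have := h'.1.symm.trans hn
      simp [Prod.ext_iff] at this
  by_contra hTb
  rcases le_succ_of hb (Ne.symm hne) with hl | hl
  · by_cases he : (h.1, h.2 + 1) = b
    · rw [← he] at hTb; exact hTb h0.1
    · exact (H.mono _ b hl he (by simp [Prod.ext_iff]) hTb).1 h0.1
  · by_cases he : (h.1 + 1, h.2) = b
    · rw [← he] at hTb; exact hTb h0.2
    · exact (H.mono _ b hl he (by simp [Prod.ext_iff]) hTb).1 h0.2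

theorem nxt_sum (T : Tab) (c : ℕ × ℕ) (hn : nxt T c ≠ c) :
    (nxt T c).1 + (nxt T c).2 = c.1 + c.2 + 1 := by
  rcases nxt_cases T c with h' | h' | h'
  · exact absurd h'.1 hn
  · rw [h'.1]; simp; omega
  · rw [h'.1]; simp; omega

theorem le_nxt (T : Tab) (c : ℕ × ℕ) : c ≤ nxt T c := by
  rcases nxt_cases T c with h' | h' | h'
  · rw [h'.1]
  · rw [h'.1]; exact ⟨le_refl _, by simp⟩
  · rw [h'.1]; exact ⟨by simp, le_refl _⟩

theorem nxt_ne_zero (T : Tab) (c : ℕ × ℕ) (hn : nxt T c ≠ c) : T (nxt T c) ≠ 0 := by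
  rcases nxt_cases T c with h' | h' | h'
  · exact absurd h'.1 hn
  · rw [h'.1]; exact h'.2.1
  · rw [h'.1]; exact h'.2.1

theorem Hole.nxt_min {T : Tab} {h : ℕ × ℕ} (H : Hole T h) :
    ∀ b, h ≤ b → b ≠ h → T b ≠ 0 → T (nxt T h) ≤ T b := by
  intro b hb hne hTb
  have key : ∀ x, x ≤ b → x ≠ h → T x ≠ 0 ∧ T x ≤ T b := by
    intro x hx hxh
    by_cases he : x = b
    · rw [he]; exact ⟨hTb, le_refl _⟩
    · exact ⟨(H.mono x b hx he hxh hTb).1, (H.mono x b hx he hxh hTb).2.le⟩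
  have n1 : (h.1, h.2 + 1) ≠ h := by simp [Prod.ext_iff]
  have n2 : (h.1 + 1, h.2) ≠ h := by simp [Prod.ext_iff]
  rcases nxt_cases T h with h' | h' | h' <;> rw [h'.1] <;>
    rcases le_succ_of hb (Ne.symm hne) with hl | hl
  · exact absurd h'.2.1 (key _ hl n1).1
  · exact absurd h'.2.2 (key _ hl n2).1
  · exact (key _ hl n1).2
  · have := key _ hl n2
    omega
  · have := key _ hl n1
    omega
  · exact (key _ hl n2).2

theorem stepT_hole {T : Tab} {h : ℕ × ℕ} : stepT T h (nxt T h) = 0 := by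
  simp [stepT]

theorem stepT_old {T : Tab} {h : ℕ × ℕ} (hn : nxt T h ≠ h) : stepT T h h = T (nxt T h) := by
  rw [stepT, Function.update_of_ne (Ne.symm hn), Function.update_self]

theorem stepT_other {T : Tab} {h c : ℕ × ℕ} (h1 : c ≠ h) (h2 : c ≠ nxt T h) :
    stepT T h c = T c := by
  rw [stepT, Function.update_of_ne h2, Function.update_of_ne h1]

theorem Hole.step {T : Tab} {h : ℕ × ℕ} (H : Hole T h) (hn : nxt T h ≠ h) :
    Hole (stepT T h) (nxt T h) := by
  have hd0 := nxt_ne_zero T h hn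
  have hle := le_nxt T h
  refine ⟨stepT_hole, ?_, ?_⟩
  · intro a b hab hne had hb
    have hbd : b ≠ nxt T h := by rintro rfl; exact hb stepT_hole
    by_cases hbh : b = h
    · subst hbh
      rw [stepT_other hne had, stepT_old hn]
      refine H.mono a _ (hab.trans hle) had hne hd0
    · rw [stepT_other hbh hbd] at hb ⊢
      by_cases hah : a = h
      · subst hah
        rw [stepT_old hn]
        refine ⟨hd0, lt_of_le_of_ne (H.nxt_min b hab hbh hb) ?_⟩
        intro he
        exact hbd (H.inj _ _ he hd0).symm
      · rw [stepT_other hah had]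
        exact H.mono a b hab hne hah hb
  · intro a b hab ha
    have had : a ≠ nxt T h := by rintro rfl; exact ha stepT_hole
    have hbd : b ≠ nxt T h := by rintro rfl; rw [hab] at ha; exact ha stepT_hole
    by_cases hah : a = h <;> by_cases hbh : b = h
    · rw [hah, hbh]
    · subst hah
      rw [stepT_old hn, stepT_other hbh hbd] at hab
      exact absurd (H.inj _ _ hab hd0).symm hbd
    · subst hbh
      rw [stepT_old hn, stepT_other hah had] at hab
      exact absurd (H.inj _ _ hab.symm hd0).symm had
    · rw [stepT_other hah had] at hab ha
      rw [stepT_other hbh hbd] at hab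
      exact H.inj a b hab ha

theorem step_values {T : Tab} {h : ℕ × ℕ} (H : Hole T h) (hn : nxt T h ≠ h) (m : ℕ) (hm : m ≠ 0) :
    (∃ a, stepT T h a = m) ↔ ∃ a, T a = m := by
  constructor
  · rintro ⟨a, ha⟩
    have had : a ≠ nxt T h := by rintro rfl; rw [stepT_hole] at ha; exact hm ha.symm
    by_cases hah : a = h
    · subst hah; rw [stepT_old hn] at ha; exact ⟨_, ha⟩
    · rw [stepT_other hah had] at ha; exact ⟨_, ha⟩
  · rintro ⟨a, ha⟩
    by_cases had : a = nxt T h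
    · subst had; exact ⟨h, by rw [stepT_old hn, ha]⟩
    · have hah : a ≠ h := by rintro rfl; rw [H.hole] at ha; exact hm ha.symm
      exact ⟨a, by rw [stepT_other hah had, ha]⟩

theorem step_support {T : Tab} {h : ℕ × ℕ} (hn : nxt T h ≠ h) (c : ℕ × ℕ) :
    (stepT T h c ≠ 0 ∨ c = nxt T h) ↔ (T c ≠ 0 ∨ c = h) := by
  have hd0 := nxt_ne_zero T h hn
  by_cases h1 : c = nxt T h
  · subst h1; simp [hd0]
  · by_cases h2 : c = h
    · subst h2; simp [stepT_old hn, hd0]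
    · rw [stepT_other h2 h1]; simp [h1, h2]

/-- The position of an entry after one elementary slide. -/
theorem step_pos {T : Tab} {h : ℕ × ℕ} (H : Hole T h) (hn : nxt T h ≠ h) {a a' : ℕ × ℕ}
    (ha : T a ≠ 0) (haa : stepT T h a' = T a) :
    (a = nxt T h ∧ a' = h) ∨ (a ≠ nxt T h ∧ a' = a ∧ a ≠ h) := by
  have H' := H.step hn
  have hah : a ≠ h := by rintro rfl; exact ha H.hole
  by_cases had : a = nxt T h
  · left
    refine ⟨had, ?_⟩
    apply H'.inj _ _ _ (by rw [haa]; exact ha)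
    rw [haa, stepT_old hn, had]
  · right
    refine ⟨had, ?_, hah⟩
    apply H'.inj _ _ _ (by rw [haa]; exact ha)
    rw [haa, stepT_other hah had]

theorem step_desc {T : Tab} {h : ℕ × ℕ} (H : Hole T h) (hn : nxt T h ≠ h) {a b a' b' : ℕ × ℕ}
    (ha : T a ≠ 0) (hb : T b = T a + 1) (ha' : stepT T h a' = T a) (hb' : stepT T h b' = T b) :
    a.1 < b.1 ↔ a'.1 < b'.1 := by
  have hb0 : T b ≠ 0 := by omega
  have key : ∀ x, T a < T x → T x < T a + 1 → False := fun x h1 h2 => by omega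
  rcases step_pos H hn ha ha' with ⟨h1, h2⟩ | ⟨h1, h2, h3⟩ <;>
    rcases step_pos H hn hb0 hb' with ⟨h4, h5⟩ | ⟨h4, h5, h6⟩
  · exfalso; rw [h1, h4] at hb; omega
  · subst h2 h5
    rcases nxt_cases T a' with h' | h' | h'
    · exact absurd h'.1 hn
    · rw [h1, h'.1]
    · -- a moved up from (a'.1+1, a'.2)
      rw [h'.1] at h1
      subst h1
      simp only
      constructor
      · omega
      · intro hlt
        by_contra hcon
        have hrow : b'.1 = a'.1 + 1 := by omega
        have hcol : a'.2 < b'.2 := by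
          by_contra hc
          by_cases he : b' = (a'.1 + 1, a'.2)
          · rw [he] at hb; omega
          · have := (H.mono b' (a'.1 + 1, a'.2) ⟨by simp; omega, by simp; omega⟩ he h6 ha).2
            omega
        have h7 := H.mono (a'.1, a'.2 + 1) b' ⟨by simp; omega, by simp; omega⟩
          (by intro he; rw [← he] at hrow; simp at hrow) (by simp [Prod.ext_iff]) hb0
        have h8 : T (a'.1 + 1, a'.2) ≤ T (a'.1, a'.2 + 1) := by
          rcases h'.2.2 with h9 | h9
          · exact absurd h9 h7.1
          · exact h9
        have h9 := H.inj (a'.1 + 1, a'.2) (a'.1, a'.2 + 1) (by omega) ha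
        simp [Prod.ext_iff] at h9
  · subst h2 h5
    rcases nxt_cases T b' with h' | h' | h'
    · exact absurd h'.1 hn
    · rw [h4, h'.1]
    · rw [h'.1] at h4
      subst h4
      simp only
      constructor
      · intro hlt
        by_contra hcon
        have hrow : a'.1 = b'.1 := by omega
        rcases lt_trichotomy a'.2 b'.2 with hc | hc | hc
        · have h7 := (H.mono (b'.1 + 1, a'.2) (b'.1 + 1, b'.2) ⟨by simp, by simp; omega⟩
            (by simp; omega) (by simp [Prod.ext_iff]) hb0)
          have h8 := (H.mono a' (b'.1 + 1, a'.2) ⟨by simp; omega, by simp⟩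
            (by rw [ne_eq, Prod.ext_iff]; simp; omega) h3 h7.1)
          omega
        · exact h3 (Prod.ext hrow hc)
        · have h7 : T (b'.1, b'.2 + 1) ≠ 0 ∧ T (b'.1, b'.2 + 1) ≤ T a' := by
            by_cases he : (b'.1, b'.2 + 1) = a'
            · rw [he]; exact ⟨ha, le_refl _⟩
            · have := H.mono (b'.1, b'.2 + 1) a' ⟨by simp; omega, by simp; omega⟩ he
                (by simp [Prod.ext_iff]) ha
              exact ⟨this.1, this.2.le⟩
          rcases h'.2.2 with h9 | h9
          · exact h7.1 h9
          · omega
      · omega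
  · rw [h2, h5]

/-- Summary of a complete slide. -/
structure SlideSpec (T : Tab) (h : ℕ × ℕ) (T' : Tab) (e : ℕ × ℕ) : Prop where
  hole : Hole T' e
  last : ∀ b, e ≤ b → b ≠ e → T' b = 0
  supp : ∀ c, (T' c ≠ 0 ∨ c = e) ↔ (T c ≠ 0 ∨ c = h)
  vals : ∀ m, m ≠ 0 → ((∃ a, T' a = m) ↔ ∃ a, T a = m)
  desc : ∀ a b a' b', T a ≠ 0 → T b = T a + 1 → T' a' = T a → T' b' = T b →
    (a.1 < b.1 ↔ a'.1 < b'.1)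

theorem slide_spec (N k : ℕ) : ∀ (T : Tab) (h : ℕ × ℕ), Hole T h → (∀ a, T a ≤ N) →
    (∀ b, h ≤ b → b ≠ h → T b ≠ 0 → N < T b + k) →
    SlideSpec T h (slide k T h).1 (slide k T h).2 := by
  have base : ∀ (T : Tab) (h : ℕ × ℕ), Hole T h → (∀ b, h ≤ b → b ≠ h → T b = 0) →
      SlideSpec T h T h := by
    intro T h H hl
    refine ⟨H, hl, fun c => Iff.rfl, fun m _ => Iff.rfl, ?_⟩
    intro a b a' b' ha hb ha' hb'
    have h1 := H.inj a' a ha' (by omega)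
    have h2 := H.inj b' b hb' (by omega)
    rw [h1, h2]
  induction k with
  | zero =>
    intro T h H hN hb
    rw [slide_zero]
    apply base T h H
    intro b h1 h2
    by_contra h3
    have := hb b h1 h2 h3
    have := hN b
    omega
  | succ k ih =>
    intro T h H hN hb
    rw [slide_succ]
    split_ifs with hn
    · exact base T h H (H.nxt_eq_self hn)
    · have hN' : ∀ a, stepT T h a ≤ N := by
        intro a
        by_cases h0 : stepT T h a = 0
        · omega
        · obtain ⟨a', ha'⟩ := (step_values H hn _ h0).1 ⟨a, rfl⟩
          rw [← ha']; exact hN a'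
      have S := ih (stepT T h) (nxt T h) (H.step hn) hN' (by
        intro b h1 h2 h3
        have hle := le_nxt T h
        have hbh : b ≠ h := by
          rintro rfl
          exact hn (le_antisymm h1 hle)
        rw [stepT_other hbh h2] at h3 ⊢
        have h4 := H.nxt_min b (hle.trans h1) hbh h3
        have h5 : T (nxt T h) ≠ T b := fun he => h2 (H.inj _ _ he (nxt_ne_zero T h hn)).symm
        have := hb (nxt T h) hle hn (nxt_ne_zero T h hn)
        omega)
      refine ⟨S.hole, S.last, ?_, ?_, ?_⟩
      · intro c; rw [S.supp, step_support hn]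
      · intro m hm; rw [S.vals m hm, step_values H hn m hm]
      · intro a b a' b' ha hb2 ha' hb'
        obtain ⟨a1, h1⟩ := (step_values H hn (T a) ha).2 ⟨a, rfl⟩
        obtain ⟨b1, h2⟩ := (step_values H hn (T b) (by omega)).2 ⟨b, rfl⟩
        rw [step_desc H hn ha hb2 h1 h2]
        exact S.desc a1 b1 a' b' (by omega) (by omega) (by omega) (by omega)

/-- One elementary slide can be undone. -/
theorem step_inj {T₁ T₂ : Tab} {h₁ h₂ : ℕ × ℕ} (H₁ : Hole T₁ h₁) (H₂ : Hole T₂ h₂)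
    (n₁ : nxt T₁ h₁ ≠ h₁) (n₂ : nxt T₂ h₂ ≠ h₂) (hs : stepT T₁ h₁ = stepT T₂ h₂)
    (hd : nxt T₁ h₁ = nxt T₂ h₂) : T₁ = T₂ ∧ h₁ = h₂ := by
  -- the old hole is recovered as the neighbour with the larger entry
  have key : ∀ {S₁ S₂ : Tab} {g₁ g₂ : ℕ × ℕ}, Hole S₁ g₁ → nxt S₁ g₁ ≠ g₁ →
      nxt S₂ g₂ ≠ g₂ → stepT S₁ g₁ = stepT S₂ g₂ → nxt S₁ g₁ = nxt S₂ g₂ → g₁ ≠ g₂ →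
      stepT S₁ g₁ g₂ < stepT S₁ g₁ g₁ := by
    intro S₁ S₂ g₁ g₂ G m₁ m₂ hs hd hne
    have hg : g₂ ≠ nxt S₁ g₁ := by rw [hd]; exact Ne.symm m₂
    rw [stepT_old m₁, stepT_other (Ne.symm hne) hg]
    refine (G.mono g₂ _ ?_ hg (Ne.symm hne) (nxt_ne_zero _ _ m₁)).2
    rw [hd]; exact le_nxt _ _
  have hh : h₁ = h₂ := by
    by_contra hne
    have k1 := key H₁ n₁ n₂ hs hd hne
    have k2 := key H₂ n₂ n₁ hs.symm hd.symm (Ne.symm hne)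
    rw [← hs] at k2
    omega
  subst hh
  refine ⟨?_, rfl⟩
  funext c
  by_cases h1 : c = h₁
  · rw [h1, H₁.hole, H₂.hole]
  · by_cases h2 : c = nxt T₁ h₁
    · rw [h2, ← stepT_old n₁, hs, stepT_old n₂, hd]
    · rw [← stepT_other h1 h2, hs, stepT_other h1 (by rw [← hd]; exact h2)]

theorem slide_sum (k : ℕ) : ∀ (T : Tab) (h : ℕ × ℕ), h.1 + h.2 ≤ (slide k T h).2.1 + (slide k T h).2.2 := by
  induction k with
  | zero => intro T h; rw [slide_zero]
  | succ k ih =>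
    intro T h
    rw [slide_succ]
    split_ifs with hn
    · exact le_refl _
    · have := ih (stepT T h) (nxt T h)
      have := nxt_sum T h hn
      omega

theorem slide_inj (k : ℕ) : ∀ (T₁ T₂ : Tab) (h₁ h₂ : ℕ × ℕ), Hole T₁ h₁ → Hole T₂ h₂ →
    h₁.1 + h₁.2 = h₂.1 + h₂.2 → slide k T₁ h₁ = slide k T₂ h₂ → T₁ = T₂ ∧ h₁ = h₂ := by
  induction k with
  | zero =>
    intro T₁ T₂ h₁ h₂ _ _ _ hs
    simpa [slide_zero] using hs
  | succ k ih =>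
    intro T₁ T₂ h₁ h₂ H₁ H₂ hsum hs
    rw [slide_succ, slide_succ] at hs
    split_ifs at hs with n₁ n₂ n₂
    · simpa using hs
    · exfalso
      have a1 := slide_sum k (stepT T₂ h₂) (nxt T₂ h₂)
      have a2 := nxt_sum T₂ h₂ n₂
      rw [← hs] at a1
      simp only at a1
      omega
    · exfalso
      have a1 := slide_sum k (stepT T₁ h₁) (nxt T₁ h₁)
      have a2 := nxt_sum T₁ h₁ n₁
      rw [hs] at a1
      simp only at a1
      omega
    · have := ih _ _ _ _ (H₁.step n₁) (H₂.step n₂)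
        (by rw [nxt_sum _ _ n₁, nxt_sum _ _ n₂, hsum]) hs
      exact step_inj H₁ H₂ n₁ n₂ this.1 this.2


/-! ### Slide paths -/

theorem nxt_congr {T T' : Tab} {c : ℕ × ℕ} (h : ∀ x : ℕ × ℕ, c.1 + c.2 < x.1 + x.2 → T x = T' x) :
    nxt T c = nxt T' c := by
  unfold nxt
  rw [h (c.1, c.2 + 1) (by dsimp only; omega), h (c.1 + 1, c.2) (by dsimp only; omega)]

theorem nxt_sum_le (T : Tab) (c : ℕ × ℕ) : c.1 + c.2 ≤ (nxt T c).1 + (nxt T c).2 := by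
  have := le_nxt T c
  have h1 := this.1
  have h2 := this.2
  omega

theorem iter_congr {T T' : Tab} (k : ℕ) : ∀ c : ℕ × ℕ,
    (∀ x : ℕ × ℕ, c.1 + c.2 < x.1 + x.2 → T x = T' x) → (nxt T)^[k] c = (nxt T')^[k] c := by
  induction k with
  | zero => intro c _; rfl
  | succ k ih =>
    intro c h
    rw [Function.iterate_succ_apply, Function.iterate_succ_apply, ← nxt_congr h]
    apply ih
    intro x hx
    apply h
    have := nxt_sum_le T c
    omega

theorem le_iter (T : Tab) (k : ℕ) (c : ℕ × ℕ) : c ≤ (nxt T)^[k] c := by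
  induction k with
  | zero => exact le_refl _
  | succ k ih =>
    rw [Function.iterate_succ_apply']
    exact ih.trans (le_nxt T _)

theorem stepT_above {T : Tab} {h x : ℕ × ℕ}
    (hx : (nxt T h).1 + (nxt T h).2 < x.1 + x.2) : stepT T h x = T x := by
  apply stepT_other
  · rintro rfl
    have := nxt_sum_le T x
    omega
  · rintro rfl
    omega

theorem slide_end (k : ℕ) : ∀ (T : Tab) (h : ℕ × ℕ), (slide k T h).2 = (nxt T)^[k] h := by
  induction k with
  | zero => intro T h; rfl
  | succ k ih =>
    intro T h
    rw [slide_succ]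
    split_ifs with hn
    · rw [Function.iterate_fixed hn]
    · rw [ih, Function.iterate_succ_apply]
      apply iter_congr
      intro x hx
      exact stepT_above hx

theorem slide_val_off (k : ℕ) : ∀ (T : Tab) (h x : ℕ × ℕ), (∀ t ≤ k, x ≠ (nxt T)^[t] h) →
    (slide k T h).1 x = T x := by
  induction k with
  | zero => intro T h x _; rfl
  | succ k ih =>
    intro T h x hx
    rw [slide_succ]
    split_ifs with hn
    · rfl
    · rw [ih]
      · apply stepT_other
        · exact hx 0 (by omega)
        · exact hx 1 (by omega)
      · intro t ht
        rw [iter_congr (T' := T) t (nxt T h) (fun x hx => stepT_above hx),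
          ← Function.iterate_succ_apply]
        exact hx (t + 1) (by omega)

theorem slide_val_on (k : ℕ) : ∀ (T : Tab) (h : ℕ × ℕ) (t : ℕ), t < k →
    (nxt T)^[t + 1] h ≠ (nxt T)^[t] h →
    (slide k T h).1 ((nxt T)^[t] h) = T ((nxt T)^[t + 1] h) := by
  induction k with
  | zero => intro T h t ht; omega
  | succ k ih =>
    intro T h t ht hne
    rw [slide_succ]
    split_ifs with hn
    · rw [Function.iterate_fixed hn, Function.iterate_fixed hn] at hne
      exact absurd rfl hne
    · cases t with
      | zero =>
        rw [slide_val_off]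
        · exact stepT_old hn
        · intro t _ he
          have h1 := le_iter (stepT T h) t (nxt T h)
          have h2 := nxt_sum T h hn
          rw [← he] at h1
          have h3 := h1.1
          have h4 := h1.2
          simp only [Function.iterate_zero, id_eq] at h3 h4
          omega
      | succ t =>
        have cong : ∀ s, (nxt (stepT T h))^[s] (nxt T h) = (nxt T)^[s + 1] h := by
          intro s
          rw [iter_congr (T' := T) s (nxt T h) (fun x hx => stepT_above hx),
            ← Function.iterate_succ_apply]
        rw [← cong t, ih _ _ t (by omega) (by rw [cong, cong]; exact hne), cong]
        apply stepT_above
        rw [Function.iterate_succ_apply' _ (t + 1)] at hne ⊢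
        rw [nxt_sum T _ hne]
        have h1 := le_iter T t (nxt T h)
        rw [← Function.iterate_succ_apply, Nat.succ_eq_add_one] at h1
        have h3 := h1.1
        have h4 := h1.2
        omega

theorem path_sum (T : Tab) (t : ℕ) :
    (nxt T)^[((nxt T)^[t] (0, 0)).1 + ((nxt T)^[t] (0, 0)).2] (0, 0) = (nxt T)^[t] (0, 0) := by
  induction t with
  | zero => rfl
  | succ t ih =>
    rw [Function.iterate_succ_apply']
    by_cases hn : nxt T ((nxt T)^[t] (0, 0)) = (nxt T)^[t] (0, 0)
    · rw [hn, ih]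
    · rw [nxt_sum T _ hn, Function.iterate_succ_apply', ih]

/-- If the sum of the coordinates at time `t` is `t`, the path has not stopped before. -/
theorem path_sum_le (T : Tab) (t : ℕ) :
    ((nxt T)^[t] (0, 0)).1 + ((nxt T)^[t] (0, 0)).2 ≤ t := by
  induction t with
  | zero => simp
  | succ t ih =>
    rw [Function.iterate_succ_apply']
    by_cases hn : nxt T ((nxt T)^[t] (0, 0)) = (nxt T)^[t] (0, 0)
    · rw [hn]; omega
    · rw [nxt_sum T _ hn]; omega

theorem path_sum_pred (T : Tab) (t : ℕ)
    (h : ((nxt T)^[t + 1] (0, 0)).1 + ((nxt T)^[t + 1] (0, 0)).2 = t + 1) :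
    ((nxt T)^[t] (0, 0)).1 + ((nxt T)^[t] (0, 0)).2 = t ∧
      nxt T ((nxt T)^[t] (0, 0)) ≠ (nxt T)^[t] (0, 0) := by
  have h1 := path_sum_le T t
  rw [Function.iterate_succ_apply'] at h
  by_cases hn : nxt T ((nxt T)^[t] (0, 0)) = (nxt T)^[t] (0, 0)
  · rw [hn] at h; omega
  · rw [nxt_sum T _ hn] at h; exact ⟨by omega, hn⟩

theorem iter_mono (T : Tab) {s t : ℕ} (h : s ≤ t) (c : ℕ × ℕ) :
    (nxt T)^[s] c ≤ (nxt T)^[t] c := by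
  obtain ⟨u, rfl⟩ := Nat.exists_eq_add_of_le h
  rw [Nat.add_comm, Function.iterate_add_apply]
  exact le_iter T u _

/-- Data of two consecutive slides. -/
structure TwoSlides (T T' : Tab) (e : ℕ × ℕ) : Prop where
  hole : Hole T (0, 0)
  off : ∀ x : ℕ × ℕ, x ≠ (nxt T)^[x.1 + x.2] (0, 0) → T' x = T x
  on : ∀ t, (nxt T)^[t + 1] (0, 0) ≠ (nxt T)^[t] (0, 0) →
    T' ((nxt T)^[t] (0, 0)) = T ((nxt T)^[t + 1] (0, 0))
  last : nxt T e = e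
  isEnd : e = (nxt T)^[e.1 + e.2] (0, 0)
  supp : ∀ c, T c ≠ 0 → c ≠ e → T' c ≠ 0

theorem TwoSlides.couple_row {T T' : Tab} {e : ℕ × ℕ} (H : TwoSlides T T' e)
    (h1 : nxt T (0, 0) = (0, 1)) (t : ℕ) :
    ((nxt T')^[t] (0, 0)).1 + ((nxt T')^[t] (0, 0)).2 = t →
    ((nxt T)^[t + 1] (0, 0)).1 + ((nxt T)^[t + 1] (0, 0)).2 = t + 1 →
    ((nxt T)^[t + 1] (0, 0)).1 ≤ ((nxt T')^[t] (0, 0)).1 := by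
  induction t with
  | zero =>
    intro _ _
    simp [h1]
  | succ t ih =>
    intro hq hp
    obtain ⟨hq', nq⟩ := path_sum_pred T' t hq
    obtain ⟨hp', np⟩ := path_sum_pred T (t + 1) hp
    have IH := ih hq' hp'
    have hon := H.on (t + 1) (by rw [Function.iterate_succ_apply' _ (t + 1)]; exact np)
    rw [Function.iterate_succ_apply' _ (t + 1)] at hon ⊢
    rw [Function.iterate_succ_apply' (nxt T') t]
    have hoff := H.off
    generalize hP : (nxt T)^[t + 1] (0, 0) = p at *
    generalize hQ : (nxt T')^[t] (0, 0) = q at *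
    have hq2 := (le_nxt T' q).1
    rcases nxt_cases T p with h' | h' | h'
    · exact absurd h'.1 np
    · rw [h'.1]; simp only; omega
    · rw [h'.1] at hon ⊢
      simp only
      by_cases hlt : p.1 < q.1
      · omega
      · obtain ⟨r, c⟩ := q
        have hp2 : p = (r, c + 1) := by
          apply Prod.ext <;> simp only at * <;> omega
        subst hp2
        have hne : (r + 1, c) ≠ (nxt T)^[r + 1 + c] (0, 0) := by
          have : r + 1 + c = t + 1 := by simp only at hq'; omega
          rw [this, hP]; simp
        have hv := hoff (r + 1, c) hne
        have hm := H.hole.mono (r + 1, c) (r + 1, c + 1) ⟨by simp, by simp⟩ (by simp) (by simp)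
          h'.2.1
        simp only at hon
        rcases nxt_cases T' (r, c) with g | g | g
        · exact absurd g.1 nq
        · exfalso
          simp only at g
          rw [hon, hv] at g
          have := g.2.2
          omega
        · rw [g.1]

theorem TwoSlides.couple_col {T T' : Tab} {e : ℕ × ℕ} (H : TwoSlides T T' e)
    (h1 : nxt T (0, 0) = (1, 0)) (t : ℕ) :
    ((nxt T')^[t] (0, 0)).1 + ((nxt T')^[t] (0, 0)).2 = t →
    ((nxt T)^[t + 1] (0, 0)).1 + ((nxt T)^[t + 1] (0, 0)).2 = t + 1 →
    ((nxt T)^[t + 1] (0, 0)).2 ≤ ((nxt T')^[t] (0, 0)).2 := by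
  induction t with
  | zero =>
    intro _ _
    simp [h1]
  | succ t ih =>
    intro hq hp
    obtain ⟨hq', nq⟩ := path_sum_pred T' t hq
    obtain ⟨hp', np⟩ := path_sum_pred T (t + 1) hp
    have IH := ih hq' hp'
    have hon := H.on (t + 1) (by rw [Function.iterate_succ_apply' _ (t + 1)]; exact np)
    rw [Function.iterate_succ_apply' _ (t + 1)] at hon ⊢
    rw [Function.iterate_succ_apply' (nxt T') t]
    have hoff := H.off
    generalize hP : (nxt T)^[t + 1] (0, 0) = p at *
    generalize hQ : (nxt T')^[t] (0, 0) = q at *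
    have hq2 := (le_nxt T' q).2
    rcases nxt_cases T p with h' | h' | h'
    · exact absurd h'.1 np
    · rw [h'.1] at hon ⊢
      simp only
      by_cases hlt : p.2 < q.2
      · omega
      · obtain ⟨r, c⟩ := q
        have hp2 : p = (r + 1, c) := by
          apply Prod.ext <;> simp only at * <;> omega
        subst hp2
        have hne : (r, c + 1) ≠ (nxt T)^[r + (c + 1)] (0, 0) := by
          have : r + (c + 1) = t + 1 := by simp only at hq'; omega
          rw [this, hP]; simp
        have hv := hoff (r, c + 1) hne
        have hm := H.hole.mono (r, c + 1) (r + 1, c + 1) ⟨by simp, by simp⟩ (by simp) (by simp)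
          h'.2.1
        simp only at hon
        rcases nxt_cases T' (r, c) with g | g | g
        · exact absurd g.1 nq
        · rw [g.1]
        · exfalso
          simp only at g
          rw [hon, hv] at g
          have := g.2.2
          omega
    · rw [h'.1]; simp only; omega

theorem TwoSlides.end_ne_zero {T T' : Tab} {e : ℕ × ℕ} (H : TwoSlides T T' e)
    (h1 : nxt T (0, 0) ≠ (0, 0)) : ∃ s, e.1 + e.2 = s + 1 ∧ T e ≠ 0 := by
  have he : e ≠ (0, 0) := by
    intro h; have := H.last; rw [h] at this; exact h1 this
  obtain ⟨s, hs⟩ : ∃ s, e.1 + e.2 = s + 1 := by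
    refine ⟨e.1 + e.2 - 1, ?_⟩
    have : ¬ (e.1 = 0 ∧ e.2 = 0) := fun h => he (Prod.ext h.1 h.2)
    omega
  refine ⟨s, hs, ?_⟩
  have h2 := H.isEnd
  rw [hs] at h2
  obtain ⟨h3, h4⟩ := path_sum_pred T s (by rw [← h2]; exact hs)
  rw [h2, Function.iterate_succ_apply']
  exact nxt_ne_zero T _ h4

theorem TwoSlides.row_le {T T' : Tab} {e f : ℕ × ℕ} (H : TwoSlides T T' e)
    (h1 : nxt T (0, 0) = (0, 1)) (hf : f = (nxt T')^[f.1 + f.2] (0, 0)) (hl : nxt T' f = f) :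
    e.1 ≤ f.1 := by
  obtain ⟨s, hs, hTe⟩ := H.end_ne_zero (by rw [h1]; simp)
  have hend := H.isEnd
  rw [hs] at hend
  by_cases hus : s ≤ f.1 + f.2
  · have hq : ((nxt T')^[s] (0, 0)).1 + ((nxt T')^[s] (0, 0)).2 = s := by
      obtain ⟨u, hu⟩ := Nat.exists_eq_add_of_le hus
      rw [hu] at hf
      have key : ∀ u, ((nxt T')^[s + u] (0, 0)).1 + ((nxt T')^[s + u] (0, 0)).2 = s + u →
          ((nxt T')^[s] (0, 0)).1 + ((nxt T')^[s] (0, 0)).2 = s := by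
        intro u
        induction u with
        | zero => exact fun h => h
        | succ u ih => exact fun h => ih (path_sum_pred T' (s + u) h).1
      exact key u (by rw [← hf]; exact hu)
    have h2 := H.couple_row h1 s hq (by rw [← hend]; exact hs)
    rw [← hend] at h2
    have h3 := (iter_mono T' hus (0, 0)).1
    rw [← hf] at h3
    omega
  · have hp : ∀ u, ((nxt T)^[f.1 + f.2 + 1 + u] (0, 0)).1 + ((nxt T)^[f.1 + f.2 + 1 + u] (0, 0)).2
        = f.1 + f.2 + 1 + u → ((nxt T)^[f.1 + f.2 + 1] (0, 0)).1 + ((nxt T)^[f.1 + f.2 + 1] (0, 0)).2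
        = f.1 + f.2 + 1 := by
      intro u
      induction u with
      | zero => exact fun h => h
      | succ u ih => exact fun h => ih (path_sum_pred T (f.1 + f.2 + 1 + u) h).1
    have hp' := hp (s - (f.1 + f.2)) (by
      have : f.1 + f.2 + 1 + (s - (f.1 + f.2)) = s + 1 := by omega
      rw [this, ← hend]; exact hs)
    have h2 := H.couple_row h1 (f.1 + f.2) (by rw [← hf]) hp'
    have h3 := iter_mono T (show f.1 + f.2 + 1 ≤ s + 1 by omega) (0, 0)
    rw [← hend] at h3
    rw [← hf] at h2
    have h4 := h3.1
    have h5 := h3.2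
    by_contra hcon
    have h6 := H.hole.mono (f.1 + 1, f.2) e ⟨by simp; omega, by simp; omega⟩
      (by rw [ne_eq, Prod.ext_iff]; simp; omega) (by simp) hTe
    have h7 := H.supp _ h6.1 (by rw [ne_eq, Prod.ext_iff]; simp; omega)
    rcases nxt_cases T' f with g | g | g
    · exact h7 g.2.2
    · rw [g.1] at hl; simp [Prod.ext_iff] at hl
    · rw [g.1] at hl; simp [Prod.ext_iff] at hl

theorem TwoSlides.col_le {T T' : Tab} {e f : ℕ × ℕ} (H : TwoSlides T T' e)
    (h1 : nxt T (0, 0) = (1, 0)) (hf : f = (nxt T')^[f.1 + f.2] (0, 0)) (hl : nxt T' f = f) :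
    e.2 ≤ f.2 := by
  obtain ⟨s, hs, hTe⟩ := H.end_ne_zero (by rw [h1]; simp)
  have hend := H.isEnd
  rw [hs] at hend
  by_cases hus : s ≤ f.1 + f.2
  · have hq : ((nxt T')^[s] (0, 0)).1 + ((nxt T')^[s] (0, 0)).2 = s := by
      obtain ⟨u, hu⟩ := Nat.exists_eq_add_of_le hus
      rw [hu] at hf
      have key : ∀ u, ((nxt T')^[s + u] (0, 0)).1 + ((nxt T')^[s + u] (0, 0)).2 = s + u →
          ((nxt T')^[s] (0, 0)).1 + ((nxt T')^[s] (0, 0)).2 = s := by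
        intro u
        induction u with
        | zero => exact fun h => h
        | succ u ih => exact fun h => ih (path_sum_pred T' (s + u) h).1
      exact key u (by rw [← hf]; exact hu)
    have h2 := H.couple_col h1 s hq (by rw [← hend]; exact hs)
    rw [← hend] at h2
    have h3 := (iter_mono T' hus (0, 0)).2
    rw [← hf] at h3
    omega
  · have hp : ∀ u, ((nxt T)^[f.1 + f.2 + 1 + u] (0, 0)).1 + ((nxt T)^[f.1 + f.2 + 1 + u] (0, 0)).2
        = f.1 + f.2 + 1 + u → ((nxt T)^[f.1 + f.2 + 1] (0, 0)).1 + ((nxt T)^[f.1 + f.2 + 1] (0, 0)).2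
        = f.1 + f.2 + 1 := by
      intro u
      induction u with
      | zero => exact fun h => h
      | succ u ih => exact fun h => ih (path_sum_pred T (f.1 + f.2 + 1 + u) h).1
    have hp' := hp (s - (f.1 + f.2)) (by
      have : f.1 + f.2 + 1 + (s - (f.1 + f.2)) = s + 1 := by omega
      rw [this, ← hend]; exact hs)
    have h2 := H.couple_col h1 (f.1 + f.2) (by rw [← hf]) hp'
    have h3 := iter_mono T (show f.1 + f.2 + 1 ≤ s + 1 by omega) (0, 0)
    rw [← hend] at h3
    rw [← hf] at h2
    have h4 := h3.1
    have h5 := h3.2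
    by_contra hcon
    have h6 := H.hole.mono (f.1, f.2 + 1) e ⟨by simp; omega, by simp; omega⟩
      (by rw [ne_eq, Prod.ext_iff]; simp; omega) (by simp) hTe
    have h7 := H.supp _ h6.1 (by rw [ne_eq, Prod.ext_iff]; simp; omega)
    rcases nxt_cases T' f with g | g | g
    · exact h7 g.2.1
    · rw [g.1] at hl; simp [Prod.ext_iff] at hl
    · rw [g.1] at hl; simp [Prod.ext_iff] at hl


/-! ### Adding and removing the largest entry -/

theorem Std.add {m : ℕ} {Q : Tab} (h : Std m Q) {v : ℕ × ℕ} (hv : Q v = 0)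
    (hlow : ∀ a, a ≤ v → a ≠ v → Q a ≠ 0) : Std (m + 1) (Function.update Q v (m + 1)) := by
  refine ⟨?_, ?_, ?_, ?_⟩
  · intro a b hab hne hb
    by_cases hbv : b = v
    · subst hbv
      rw [Function.update_self, Function.update_of_ne hne]
      have := h.le a
      exact ⟨hlow a hab hne, by omega⟩
    · rw [Function.update_of_ne hbv] at hb ⊢
      have := h.mono a b hab hne hb
      have hav : a ≠ v := by rintro rfl; exact this.1 hv
      rw [Function.update_of_ne hav]
      exact this
  · intro a b hab ha
    have h1 := h.le a
    have h2 := h.le b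
    by_cases hav : a = v <;> by_cases hbv : b = v
    · rw [hav, hbv]
    · subst hav
      rw [Function.update_self, Function.update_of_ne hbv] at hab; omega
    · subst hbv
      rw [Function.update_self, Function.update_of_ne hav] at hab; omega
    · rw [Function.update_of_ne hav] at hab ha
      rw [Function.update_of_ne hbv] at hab
      exact h.inj a b hab ha
  · intro a
    have h1 := h.le a
    by_cases hav : a = v
    · subst hav; rw [Function.update_self]
    · rw [Function.update_of_ne hav]; omega
  · intro x h1 h2
    by_cases hx : x = m + 1
    · exact ⟨v, by rw [Function.update_self, hx]⟩
    · obtain ⟨a, ha⟩ := h.surj x h1 (by omega)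
      refine ⟨a, ?_⟩
      rw [Function.update_of_ne, ha]
      rintro rfl; omega

theorem Std.remove {m : ℕ} {Q : Tab} (h : Std (m + 1) Q) {v : ℕ × ℕ} (hv : Q v = m + 1) :
    Std m (Function.update Q v 0) ∧ ∀ a, Function.update Q v 0 a ≠ 0 ↔ Q a ≠ 0 ∧ a ≠ v := by
  have hs : ∀ a, Function.update Q v 0 a ≠ 0 ↔ Q a ≠ 0 ∧ a ≠ v := by
    intro a
    by_cases hav : a = v
    · subst hav; simp
    · rw [Function.update_of_ne hav]; simp [hav]
  have hval : ∀ a, a ≠ v → Function.update Q v 0 a = Q a := fun a ha => Function.update_of_ne ha _ _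
  refine ⟨⟨?_, ?_, ?_, ?_⟩, hs⟩
  · intro a b hab hne hb
    obtain ⟨h1, h2⟩ := (hs b).1 hb
    have h3 := h.mono a b hab hne h1
    have hav : a ≠ v := by
      rintro rfl
      have := h.le b
      omega
    rw [hval a hav, hval b h2]
    exact h3
  · intro a b hab ha
    obtain ⟨h1, h2⟩ := (hs a).1 ha
    obtain ⟨h3, h4⟩ := (hs b).1 (hab ▸ ha)
    rw [hval a h2, hval b h4] at hab
    exact h.inj a b hab h1
  · intro a
    by_cases hav : a = v
    · subst hav; simp
    · rw [hval a hav]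
      have h1 := h.le a
      have : Q a ≠ m + 1 := fun he => hav (h.inj a v (by omega) (by omega))
      omega
  · intro x h1 h2
    obtain ⟨a, ha⟩ := h.surj x h1 (by omega)
    refine ⟨a, ?_⟩
    rw [hval, ha]
    rintro rfl; omega

theorem Dsi_add_lt {m : ℕ} {Q : Tab} (h : Std m Q) {v : ℕ × ℕ} (hv : Q v = 0)
    (hlow : ∀ a, a ≤ v → a ≠ v → Q a ≠ 0) {i : ℕ} (hi : i < m) :
    i ∈ DsiSet (m + 1) (Function.update Q v (m + 1)) ↔ i ∈ DsiSet m Q := by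
  have h' := h.add hv hlow
  by_cases hi0 : i = 0
  · subst hi0; simp [DsiSet]
  obtain ⟨a, ha⟩ := h.surj i (by omega) (by omega)
  obtain ⟨b, hb⟩ := h.surj (i + 1) (by omega) (by omega)
  have hav : a ≠ v := by rintro rfl; omega
  have hbv : b ≠ v := by rintro rfl; omega
  have ha' : Function.update Q v (m + 1) a = i := by rw [Function.update_of_ne hav, ha]
  have hb' : Function.update Q v (m + 1) b = i + 1 := by rw [Function.update_of_ne hbv, hb]
  have e1 := h.mem_Dsi (a := a) (b := b) (by omega) (by omega)
  have e2 := h'.mem_Dsi (a := a) (b := b) (by omega) (by omega)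
  rw [ha] at e1
  rw [ha'] at e2
  rw [e1, e2]

theorem Dsi_add_eq {m : ℕ} {Q : Tab} (h : Std m Q) {v : ℕ × ℕ} (hv : Q v = 0)
    (hlow : ∀ a, a ≤ v → a ≠ v → Q a ≠ 0) (hm : m ≠ 0) :
    m ∈ DsiSet (m + 1) (Function.update Q v (m + 1)) ↔ rowIdx Q m < v.1 := by
  have h' := h.add hv hlow
  obtain ⟨a, ha⟩ := h.surj m (by omega) (by omega)
  have hav : a ≠ v := by rintro rfl; omega
  have ha' : Function.update Q v (m + 1) a = m := by rw [Function.update_of_ne hav, ha]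
  have e1 := h.row (a := a) (by omega)
  have e2 := h'.mem_Dsi (a := a) (b := v) (by omega) (by rw [Function.update_self]; omega)
  rw [ha] at e1
  rw [ha'] at e2
  rw [e1, e2]

/-! ### Evacuation -/

/-- The vacated cell of the first slide. -/
def delE (m : ℕ) (T : Tab) : ℕ × ℕ := (slide (m + 1) (Function.update T (0, 0) 0) (0, 0)).2

/-- The filling after the first slide (not yet decremented). -/
def delR (m : ℕ) (T : Tab) : Tab := (slide (m + 1) (Function.update T (0, 0) 0) (0, 0)).1

/-- The filling after the first slide. -/
def delT (m : ℕ) (T : Tab) : Tab := fun c => delR m T c - 1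

theorem Std.origin {m : ℕ} {T : Tab} (h : Std (m + 1) T) : T (0, 0) = 1 := by
  obtain ⟨a, ha⟩ := h.surj 1 (le_refl _) (by omega)
  by_cases h0 : (0, 0) = a
  · rw [h0, ha]
  · have := h.mono (0, 0) a ⟨by simp, by simp⟩ h0 (by omega)
    omega

theorem Std.evacAux_succ {m : ℕ} {T : Tab} (h : Std (m + 1) T) :
    evacAux (m + 1) T = Function.update (evacAux m (delT m T)) (delE m T) (m + 1) := by
  have h0 := h.origin
  have hp : posOf T 1 = (0, 0) := by
    have := posOf_eq h.inj (a := (0, 0)) (by omega)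
    rwa [h0] at this
  have : evacAux (m + 1) T = Function.update
    (evacAux m fun c => (slide (m + 1) (Function.update T (posOf T 1) 0) (posOf T 1)).1 c - 1)
    (slide (m + 1) (Function.update T (posOf T 1) 0) (posOf T 1)).2 (m + 1) := rfl
  rw [this, hp]
  rfl

theorem Std.hole {m : ℕ} {T : Tab} (h : Std (m + 1) T) :
    Hole (Function.update T (0, 0) 0) (0, 0) ∧
    (∀ a, Function.update T (0, 0) 0 a ≠ 0 → 2 ≤ Function.update T (0, 0) 0 a) := by
  have h0 := h.origin
  have hs : ∀ a, Function.update T (0, 0) 0 a ≠ 0 → a ≠ (0, 0) := by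
    rintro a ha rfl; simp at ha
  have hval : ∀ a, a ≠ (0, 0) → Function.update T (0, 0) 0 a = T a :=
    fun a ha => Function.update_of_ne ha _ _
  refine ⟨⟨by simp, ?_, ?_⟩, ?_⟩
  · intro a b hab hne ha hb
    have hb' := hs b hb
    rw [hval b hb'] at hb ⊢
    rw [hval a ha]
    exact h.mono a b hab hne hb
  · intro a b hab ha
    have h1 := hs a ha
    have h2 := hs b (hab ▸ ha)
    rw [hval a h1] at hab ha
    rw [hval b h2] at hab
    exact h.inj a b hab ha
  · intro a ha
    have h1 := hs a ha
    rw [hval a h1] at ha ⊢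
    have : T a ≠ 1 := fun he => h1 (h.inj a (0, 0) (by omega) ha)
    omega

theorem Std.slideSpec {m : ℕ} {T : Tab} (h : Std (m + 1) T) :
    SlideSpec (Function.update T (0, 0) 0) (0, 0) (delR m T) (delE m T) := by
  obtain ⟨H, h2⟩ := h.hole
  refine slide_spec (m + 1) (m + 1) _ _ H ?_ ?_
  · intro a
    by_cases ha : a = (0, 0)
    · subst ha; simp
    · rw [Function.update_of_ne ha]; exact h.le a
  · intro b _ _ hb
    omega

theorem Std.delR_ge {m : ℕ} {T : Tab} (h : Std (m + 1) T) (a : ℕ × ℕ) (ha : delR m T a ≠ 0) :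
    2 ≤ delR m T a ∧ delR m T a ≤ m + 1 := by
  obtain ⟨b, hb⟩ := (h.slideSpec.vals _ ha).1 ⟨a, rfl⟩
  have h1 := h.hole.2 b (by omega)
  have hb0 : b ≠ (0, 0) := by rintro rfl; simp at hb; omega
  rw [Function.update_of_ne hb0] at hb
  have h3 := h.le b
  rw [Function.update_of_ne hb0] at h1
  omega

theorem Std.del_supp {m : ℕ} {T : Tab} (h : Std (m + 1) T) (c : ℕ × ℕ) :
    delT m T c ≠ 0 ↔ T c ≠ 0 ∧ c ≠ delE m T := by
  have hd : delT m T c ≠ 0 ↔ delR m T c ≠ 0 := by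
    have := h.delR_ge c
    unfold delT
    omega
  have h1 := h.slideSpec.supp c
  have h2 := h.slideSpec.hole.hole
  have h3 : (Function.update T (0, 0) 0 c ≠ 0 ∨ c = (0, 0)) ↔ T c ≠ 0 := by
    by_cases hc : c = (0, 0)
    · subst hc; simp [h.origin]
    · rw [Function.update_of_ne hc]; simp [hc]
  rw [h3] at h1
  rw [hd, ← h1]
  constructor
  · intro hc
    exact ⟨Or.inl hc, by rintro rfl; exact hc h2⟩
  · rintro ⟨hc | hc, hne⟩
    · exact hc
    · exact absurd hc hne

theorem Std.delE_ne {m : ℕ} {T : Tab} (h : Std (m + 1) T) : T (delE m T) ≠ 0 := by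
  have h1 := (h.slideSpec.supp (delE m T)).1 (Or.inr rfl)
  by_cases hc : delE m T = (0, 0)
  · rw [hc, h.origin]; omega
  · rw [Function.update_of_ne hc] at h1; tauto

theorem Std.delE_max {m : ℕ} {T : Tab} (h : Std (m + 1) T) (b : ℕ × ℕ) (hb : delE m T ≤ b)
    (hne : b ≠ delE m T) : T b = 0 := by
  by_contra h0
  have h1 := (h.del_supp b).2 ⟨h0, hne⟩
  have h2 := h.slideSpec.last b hb hne
  simp [delT, h2] at h1

theorem Std.del {m : ℕ} {T : Tab} (h : Std (m + 1) T) : Std m (delT m T) := by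
  have S := h.slideSpec
  have hd : ∀ c, delT m T c ≠ 0 → delR m T c = delT m T c + 1 := by
    intro c hc
    unfold delT at *
    omega
  refine ⟨?_, ?_, ?_, ?_⟩
  · intro a b hab hne hb
    have hb' := hd b hb
    have hae : a ≠ delE m T := by
      rintro rfl
      have := S.last b hab (Ne.symm hne)
      omega
    have h1 := S.hole.mono a b hab hne hae (by omega)
    have h2 := h.delR_ge a h1.1
    unfold delT at *
    omega
  · intro a b hab ha
    have h1 := hd a ha
    have h2 := hd b (hab ▸ ha)
    exact S.hole.inj a b (by omega) (by omega)
  · intro a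
    by_cases ha : delR m T a = 0
    · simp [delT, ha]
    · have := h.delR_ge a ha
      unfold delT
      omega
  · intro x h1 h2
    obtain ⟨a, ha⟩ := h.surj (x + 1) (by omega) (by omega)
    have ha0 : a ≠ (0, 0) := by
      rintro rfl
      rw [h.origin] at ha; omega
    obtain ⟨b, hb⟩ := (S.vals (x + 1) (by omega)).2 ⟨a, by rw [Function.update_of_ne ha0, ha]⟩
    exact ⟨b, by unfold delT; omega⟩

theorem Std.del_desc {m : ℕ} {T : Tab} (h : Std (m + 1) T) {i : ℕ} (hi : 1 ≤ i) (him : i < m) :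
    i ∈ DsiSet m (delT m T) ↔ i + 1 ∈ DsiSet (m + 1) T := by
  have S := h.slideSpec
  have hD := h.del
  obtain ⟨a', ha'⟩ := hD.surj i (by omega) (by omega)
  obtain ⟨b', hb'⟩ := hD.surj (i + 1) (by omega) (by omega)
  obtain ⟨a, ha⟩ := h.surj (i + 1) (by omega) (by omega)
  obtain ⟨b, hb⟩ := h.surj (i + 2) (by omega) (by omega)
  have ha0 : a ≠ (0, 0) := by rintro rfl; rw [h.origin] at ha; omega
  have hb0 : b ≠ (0, 0) := by rintro rfl; rw [h.origin] at hb; omega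
  have e1 := hD.mem_Dsi (a := a') (b := b') (by omega) (by omega)
  have e2 := h.mem_Dsi (a := a) (b := b) (by omega) (by omega)
  rw [ha'] at e1
  rw [ha] at e2
  rw [e1, e2]
  unfold delT at ha' hb'
  refine (S.desc a b a' b' ?_ ?_ ?_ ?_).symm <;>
    (try rw [Function.update_of_ne ha0]) <;> (try rw [Function.update_of_ne hb0]) <;> omega

theorem Std.twoSlides {m : ℕ} {T : Tab} (h : Std (m + 1) T) :
    TwoSlides (Function.update T (0, 0) 0) (delR m T) (delE m T) := by
  have S := h.slideSpec
  set T₀ := Function.update T (0, 0) 0 with hT₀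
  have hend : delE m T = (nxt T₀)^[m + 1] (0, 0) := slide_end _ _ _
  have hzero : ∀ b, delE m T ≤ b → b ≠ delE m T → T₀ b = 0 := by
    intro b hb hne
    by_contra h0
    rcases (S.supp b).2 (Or.inl h0) with h1 | h1
    · exact h1 (S.last b hb hne)
    · exact hne h1
  have hlast : nxt T₀ (delE m T) = delE m T := by
    by_contra hn
    exact nxt_ne_zero T₀ _ hn (hzero _ (le_nxt _ _) hn)
  refine ⟨h.hole.1, ?_, ?_, hlast, ?_, ?_⟩
  · intro x hx
    apply slide_val_off
    intro t _ he
    apply hx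
    rw [he, path_sum]
  · intro t ht
    apply slide_val_on
    · by_contra hlt
      obtain ⟨u, hu⟩ := Nat.exists_eq_add_of_le (not_lt.1 hlt)
      apply ht
      rw [Function.iterate_succ_apply', hu, Nat.add_comm, Function.iterate_add_apply, ← hend,
        Function.iterate_fixed hlast, hlast]
    · exact ht
  · rw [hend, path_sum]
  · intro c hc hne
    rcases (S.supp c).2 (Or.inl hc) with h1 | h1
    · exact h1
    · exact absurd h1 hne

theorem Std.nxt_del {m : ℕ} {T : Tab} (h : Std (m + 1) T) :
    nxt (Function.update (delT m T) (0, 0) 0) = nxt (delR m T) := by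
  funext c
  unfold nxt
  have n1 : (c.1, c.2 + 1) ≠ (0, 0) := by simp
  have n2 : (c.1 + 1, c.2) ≠ (0, 0) := by simp
  rw [Function.update_of_ne n1, Function.update_of_ne n2]
  have h1 := h.delR_ge (c.1, c.2 + 1)
  have h2 := h.delR_ge (c.1 + 1, c.2)
  have e1 : delT m T (c.1, c.2 + 1) = 0 ↔ delR m T (c.1, c.2 + 1) = 0 := by
    unfold delT; omega
  have e2 : delT m T (c.1 + 1, c.2) = 0 ↔ delR m T (c.1 + 1, c.2) = 0 := by
    unfold delT; omega
  have e3 : (delR m T (c.1 + 1, c.2) = 0 ∨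
      (delR m T (c.1, c.2 + 1) ≠ 0 ∧ delT m T (c.1, c.2 + 1) < delT m T (c.1 + 1, c.2))) ↔
      (delR m T (c.1 + 1, c.2) = 0 ∨
      (delR m T (c.1, c.2 + 1) ≠ 0 ∧ delR m T (c.1, c.2 + 1) < delR m T (c.1 + 1, c.2))) := by
    unfold delT; omega
  simp only [e1, e2, ne_eq] at e3 ⊢
  simp only [e3]

theorem Std.top_desc {m : ℕ} {T : Tab} (h : Std (m + 2) T) :
    (delE m (delT (m + 1) T)).1 < (delE (m + 1) T).1 ↔ 1 ∈ DsiSet (m + 2) T := by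
  have A := h.twoSlides
  have B := h.del.twoSlides
  have hN := h.nxt_del
  have hf := B.isEnd
  have hl := B.last
  rw [hN] at hf hl
  obtain ⟨b, hb⟩ := h.surj 2 (by omega) (by omega)
  have hb0 : b ≠ (0, 0) := by rintro rfl; rw [h.origin] at hb; omega
  have e1 := h.mem_Dsi (a := (0, 0)) (b := b) (by rw [h.origin]; omega) (by rw [h.origin]; omega)
  rw [h.origin] at e1
  rw [e1]
  -- the first step goes to the position of 2
  have hbT : Function.update T (0, 0) 0 b = 2 := by rw [Function.update_of_ne hb0, hb]
  have hn : nxt (Function.update T (0, 0) 0) (0, 0) ≠ (0, 0) := by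
    intro hn
    have := A.hole.nxt_eq_self hn b ⟨by simp, by simp⟩ hb0
    omega
  have hnb : nxt (Function.update T (0, 0) 0) (0, 0) = b := by
    have h1 := A.hole.nxt_min b ⟨by simp, by simp⟩ hb0 (by omega)
    have h2 := h.hole.2 _ (nxt_ne_zero _ _ hn)
    exact A.hole.inj _ _ (by omega) (by omega)
  have hfe := (h.del_supp _).1 h.del.delE_ne
  rcases nxt_cases (Function.update T (0, 0) 0) (0, 0) with g | g | g
  · exact absurd g.1 hn
  · have := A.row_le g.1 hf hl
    rw [← hnb, g.1]
    simp only
    omega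
  · have hc := A.col_le g.1 hf hl
    rw [← hnb, g.1]
    simp only
    constructor
    · intro _; omega
    · intro _
      by_contra hcon
      exact hfe.1 (h.delE_max _ ⟨by omega, hc⟩ hfe.2)

theorem evac_spec (m : ℕ) : ∀ T : Tab, Std m T → Std m (evacAux m T) ∧
    (∀ a, evacAux m T a ≠ 0 ↔ T a ≠ 0) ∧
    (∀ i, 1 ≤ i → i < m → (i ∈ DsiSet m (evacAux m T) ↔ m - i ∈ DsiSet m T)) := by
  induction m with
  | zero =>
    intro T h
    have hT : T = fun _ => 0 := by
      funext a; have := h.le a; omega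
    subst hT
    exact ⟨h, fun a => Iff.rfl, fun i h1 h2 => by omega⟩
  | succ m ih =>
    intro T h
    rw [h.evacAux_succ]
    obtain ⟨i1, i2, i3⟩ := ih _ h.del
    have hv : evacAux m (delT m T) (delE m T) = 0 := by
      by_contra h0
      exact ((h.del_supp _).1 ((i2 _).1 h0)).2 rfl
    have hlow : ∀ a, a ≤ delE m T → a ≠ delE m T → evacAux m (delT m T) a ≠ 0 := by
      intro a ha hne
      rw [i2, h.del_supp]
      exact ⟨(h.mono a _ ha hne h.delE_ne).1, hne⟩
    refine ⟨i1.add hv hlow, ?_, ?_⟩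
    · intro a
      by_cases ha : a = delE m T
      · subst ha; simp [h.delE_ne]
      · rw [Function.update_of_ne ha, i2, h.del_supp]; simp [ha]
    · intro i h1 h2
      by_cases him : i < m
      · rw [Dsi_add_lt i1 hv hlow him, i3 i h1 him, h.del_desc (by omega) (by omega)]
        have : m - i + 1 = m + 1 - i := by omega
        rw [this]
      · have : i = m := by omega
        subst this
        rw [Dsi_add_eq i1 hv hlow (by omega)]
        obtain ⟨k, rfl⟩ : ∃ k, i = k + 1 := ⟨i - 1, by omega⟩
        rw [show k + 1 + 1 - (k + 1) = 1 by omega, ← h.top_desc]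
        have h3 := i1.row (a := delE k (delT (k + 1) T)) (by rw [i2]; exact h.del.delE_ne)
        have h4 : evacAux (k + 1) (delT (k + 1) T) (delE k (delT (k + 1) T)) = k + 1 := by
          rw [h.del.evacAux_succ, Function.update_self]
        rw [h4] at h3
        rw [h3]

theorem evac_inj (m : ℕ) : ∀ T₁ T₂ : Tab, Std m T₁ → Std m T₂ → evacAux m T₁ = evacAux m T₂ →
    T₁ = T₂ := by
  induction m with
  | zero =>
    intro T₁ T₂ h₁ h₂ _
    funext a
    have := h₁.le a
    have := h₂.le a
    omega
  | succ m ih =>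
    intro T₁ T₂ h₁ h₂ he
    have s1 := (evac_spec _ T₁ h₁).1
    rw [h₁.evacAux_succ] at s1
    rw [h₁.evacAux_succ, h₂.evacAux_succ] at he
    have hv1 : evacAux m (delT m T₁) (delE m T₁) = 0 := by
      by_contra h0
      exact ((h₁.del_supp _).1 (((evac_spec _ _ h₁.del).2.1 _).1 h0)).2 rfl
    have hv2 : evacAux m (delT m T₂) (delE m T₂) = 0 := by
      by_contra h0
      exact ((h₂.del_supp _).1 (((evac_spec _ _ h₂.del).2.1 _).1 h0)).2 rfl
    have hE : delE m T₁ = delE m T₂ := by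
      apply s1.inj
      · rw [Function.update_self, he, Function.update_self]
      · rw [Function.update_self]; omega
    have hA : evacAux m (delT m T₁) = evacAux m (delT m T₂) := by
      funext c
      by_cases hc : c = delE m T₁
      · rw [hc, hv1, hE, hv2]
      · have := congrFun he c
        rwa [Function.update_of_ne hc, Function.update_of_ne (hE ▸ hc)] at this
    have hD := ih _ _ h₁.del h₂.del hA
    have hR : delR m T₁ = delR m T₂ := by
      funext c
      have a1 := congrFun hD c
      have a2 := h₁.delR_ge c
      have a3 := h₂.delR_ge c
      unfold delT at a1
      omega
    have := (slide_inj (m + 1) _ _ _ _ h₁.hole.1 h₂.hole.1 rfl (Prod.ext hR hE)).1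
    funext c
    by_cases hc : c = (0, 0)
    · rw [hc, h₁.origin, h₂.origin]
    · have h3 := congrFun this c
      rwa [Function.update_of_ne hc, Function.update_of_ne hc] at h3

theorem evac_surj {n : ℕ} {μ : YoungDiagram} {Q : Tab} (hQ : Std n Q)
    (hs : ∀ a, Q a ≠ 0 ↔ a ∈ μ.cells) :
    ∃ S, Std n S ∧ (∀ a, S a ≠ 0 ↔ a ∈ μ.cells) ∧ evac n S = Q := by
  let X := {S : Tab // Std n S ∧ ∀ a, S a ≠ 0 ↔ a ∈ μ.cells}
  have hfin : Finite X := by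
    let f : X → (μ.cells → Fin (n + 1)) := fun S c => ⟨S.1 c.1, Nat.lt_succ_of_le (S.2.1.le _)⟩
    apply Finite.of_injective f
    intro S₁ S₂ he
    apply Subtype.ext
    funext c
    by_cases hc : c ∈ μ.cells
    · have := congrFun he ⟨c, hc⟩
      simpa [f] using this
    · have a1 := (S₁.2.2 c).not.2 hc
      have a2 := (S₂.2.2 c).not.2 hc
      omega
  let g : X → X := fun S => ⟨evacAux n S.1, (evac_spec n S.1 S.2.1).1, fun a => by
    rw [(evac_spec n S.1 S.2.1).2.1, S.2.2]⟩
  have hg : Function.Injective g := by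
    intro S₁ S₂ he
    apply Subtype.ext
    exact evac_inj n _ _ S₁.2.1 S₂.2.1 (congrArg Subtype.val he)
  obtain ⟨S, hS⟩ := (Finite.injective_iff_surjective.1 hg) ⟨Q, hQ, hs⟩
  exact ⟨S.1, S.2.1, S.2.2, congrArg Subtype.val hS⟩

theorem Dsic_eq {n : ℕ} {S : Tab} (h : Std n S) : Dsic n S = DsiSet n (evac n S) := by
  have hs := (evac_spec n S h).2.2
  ext i
  simp only [Dsic, Finset.mem_image]
  constructor
  · rintro ⟨j, hj, rfl⟩
    have hj' : 0 < j ∧ j < n := by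
      simpa using (Finset.mem_filter.1 hj).1
    refine (hs (n - j) (by omega) (by omega)).2 ?_
    rwa [show n - (n - j) = j by omega]
  · intro hi
    have hi' : 0 < i ∧ i < n := by
      simpa using (Finset.mem_filter.1 hi).1
    exact ⟨n - i, (hs i (by omega) (by omega)).1 hi, by omega⟩


/-! ### Robinson–Schensted -/

theorem rowInsert_spec (x : ℕ) (r : List ℕ) :
    (rowInsert x r = (r ++ [x], none) ∧ ∀ z ∈ r, z ≤ x) ∨
    ∃ l₁ y l₂, r = l₁ ++ y :: l₂ ∧ rowInsert x r = (l₁ ++ x :: l₂, some y) ∧ x < y ∧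
      ∀ z ∈ l₁, z ≤ x := by
  induction r with
  | nil => left; simp [rowInsert]
  | cons a r ih =>
    by_cases h : x < a
    · right
      exact ⟨[], a, r, by simp, by simp [rowInsert, h], h, by simp⟩
    · rcases ih with ⟨h1, h2⟩ | ⟨l₁, y, l₂, h1, h2, h3, h4⟩
      · left
        refine ⟨by simp [rowInsert, h, h1], ?_⟩
        intro z hz
        rcases List.mem_cons.1 hz with rfl | hz
        · omega
        · exact h2 z hz
      · right
        refine ⟨a :: l₁, y, l₂, by simp [h1], by simp [rowInsert, h, h2], h3, ?_⟩
        intro z hz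
        rcases List.mem_cons.1 hz with rfl | hz
        · omega
        · exact h4 z hz

theorem rowInsert_none {x : ℕ} {r : List ℕ} (h : ∀ z ∈ r, z ≤ x) :
    rowInsert x r = (r ++ [x], none) := by
  induction r with
  | nil => simp [rowInsert]
  | cons a r ih =>
    have := h a (by simp)
    rw [rowInsert, if_neg (by omega), ih (fun z hz => h z (by simp [hz]))]
    simp

theorem rowInsert_some {x y : ℕ} {l₁ l₂ : List ℕ} (h : ∀ z ∈ l₁, z ≤ x) (hxy : x < y) :
    rowInsert x (l₁ ++ y :: l₂) = (l₁ ++ x :: l₂, some y) := by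
  induction l₁ with
  | nil => simp [rowInsert, hxy]
  | cons a r ih =>
    have := h a (by simp)
    rw [List.cons_append, rowInsert, if_neg (by omega), ih (fun z hz => h z (by simp [hz]))]
    simp

theorem tabInsert_none {x : ℕ} {r r' : List ℕ} {rs : List (List ℕ)}
    (h : rowInsert x r = (r', none)) : tabInsert (r :: rs) x = r' :: rs := by
  rw [tabInsert, h]

theorem tabInsert_some {x y : ℕ} {r r' : List ℕ} {rs : List (List ℕ)}
    (h : rowInsert x r = (r', some y)) : tabInsert (r :: rs) x = r' :: tabInsert rs y := by
  rw [tabInsert, h]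

/-- The row in which the shape grows under insertion. -/
def newRow : List (List ℕ) → ℕ → ℕ
  | [], _ => 0
  | r :: rs, x =>
    match (rowInsert x r).2 with
    | none => 0
    | some y => newRow rs y + 1

theorem newRow_none {x : ℕ} {r r' : List ℕ} {rs : List (List ℕ)}
    (h : rowInsert x r = (r', none)) : newRow (r :: rs) x = 0 := by
  rw [newRow, h]

theorem newRow_some {x y : ℕ} {r r' : List ℕ} {rs : List (List ℕ)}
    (h : rowInsert x r = (r', some y)) : newRow (r :: rs) x = newRow rs y + 1 := by
  rw [newRow, h]

/-- Length of row `k`. -/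
def rl (t : List (List ℕ)) (k : ℕ) : ℕ := (t.getD k []).length

theorem rl_cons_zero (r : List ℕ) (rs : List (List ℕ)) : rl (r :: rs) 0 = r.length := by
  simp [rl]

theorem rl_cons_succ (r : List ℕ) (rs : List (List ℕ)) (k : ℕ) :
    rl (r :: rs) (k + 1) = rl rs k := by
  simp [rl]

theorem rl_nil (k : ℕ) : rl [] k = 0 := by simp [rl]

theorem rl_tabInsert (t : List (List ℕ)) : ∀ (x k : ℕ),
    rl (tabInsert t x) k = rl t k + if k = newRow t x then 1 else 0 := by
  induction t with
  | nil =>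
    intro x k
    cases k <;> simp [tabInsert, newRow, rl]
  | cons r rs ih =>
    intro x k
    rcases rowInsert_spec x r with ⟨h1, h2⟩ | ⟨l₁, y, l₂, h1, h2, h3, h4⟩
    · rw [tabInsert_none h1, newRow_none h1]
      cases k with
      | zero => simp [rl_cons_zero]
      | succ k => simp [rl_cons_succ]
    · rw [tabInsert_some h2, newRow_some h2]
      cases k with
      | zero => simp [rl_cons_zero, h1]
      | succ k => simp [rl_cons_succ, ih]

theorem flatten_tabInsert (t : List (List ℕ)) : ∀ x : ℕ,
    (tabInsert t x).flatten.Perm (x :: t.flatten) := by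
  induction t with
  | nil => intro x; simp [tabInsert]
  | cons r rs ih =>
    intro x
    rcases rowInsert_spec x r with ⟨h1, h2⟩ | ⟨l₁, y, l₂, h1, h2, h3, h4⟩
    · rw [tabInsert_none h1]
      rw [List.flatten_cons, List.flatten_cons, List.append_assoc]
      exact List.perm_middle
    · rw [tabInsert_some h2, List.flatten_cons, List.flatten_cons, h1]
      refine ((ih y).append_left _).trans ?_
      rw [List.append_assoc]
      refine List.perm_middle.trans (List.Perm.cons _ ?_)
      rw [List.append_assoc]
      refine List.Perm.append_left _ ?_
      rw [List.cons_append]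
      exact List.perm_middle

/-- Row `r` dominates row `s` placed below it. -/
def Dom (r s : List ℕ) : Prop := ∀ i < s.length, i < r.length ∧ r.getD i 0 < s.getD i 0

/-- Valid (list) tableaux. -/
inductive Valid : List (List ℕ) → Prop
  | nil : Valid []
  | cons (r : List ℕ) (rs : List (List ℕ)) : r ≠ [] → r.Pairwise (· < ·) →
      Dom r (rs.headD []) → Valid rs → Valid (r :: rs)

theorem getD_mid (l₁ l₂ : List ℕ) (y i : ℕ) : (l₁ ++ y :: l₂).getD i 0 =
    if i < l₁.length then l₁.getD i 0 else if i = l₁.length then y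
      else l₂.getD (i - l₁.length - 1) 0 := by
  split_ifs with h h'
  · rw [List.getD_append _ _ _ _ h]
  · subst h'; rw [List.getD_append_right _ _ _ _ (le_refl _)]; simp
  · rw [List.getD_append_right _ _ _ _ (by omega)]
    obtain ⟨j, hj⟩ : ∃ j, i - l₁.length = j + 1 := ⟨i - l₁.length - 1, by omega⟩
    rw [hj]; simp

theorem getD_mem' {l : List ℕ} {i : ℕ} (h : i < l.length) : l.getD i 0 ∈ l := by
  rw [List.getD_eq_getElem _ _ h]; exact List.getElem_mem h

theorem getD_lt {l : List ℕ} (hl : l.Pairwise (· < ·)) {i j : ℕ} (hij : i < j)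
    (hj : j < l.length) : l.getD i 0 < l.getD j 0 := by
  rw [List.getD_eq_getElem _ _ hj, List.getD_eq_getElem _ _ (hij.trans hj)]
  exact List.pairwise_iff_getElem.1 hl _ _ _ _ hij

theorem headD_tabInsert (rs : List (List ℕ)) (y : ℕ) :
    (tabInsert rs y).headD [] = (rowInsert y (rs.headD [])).1 := by
  cases rs with
  | nil => simp [tabInsert, rowInsert]
  | cons r rs =>
    rcases rowInsert_spec y r with ⟨h1, h2⟩ | ⟨l₁, z, l₂, h1, h2, h3, h4⟩
    · rw [tabInsert_none h1]; simp [h1]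
    · rw [tabInsert_some h2]; simp [h2]

theorem Valid.head {t : List (List ℕ)} (h : Valid t) : (t.headD []).Pairwise (· < ·) := by
  cases h with
  | nil => simp
  | cons r rs _ h _ _ => simpa using h

theorem dom_insert {l₁ l₂ s : List ℕ} {x y : ℕ} (hr : (l₁ ++ y :: l₂).Pairwise (· < ·))
    (hs : s.Pairwise (· < ·)) (hd : Dom (l₁ ++ y :: l₂) s) (hxy : x < y) :
    Dom (l₁ ++ x :: l₂) (rowInsert y s).1 := by
  have hl1 : ∀ i < l₁.length, l₁.getD i 0 < y := by
    intro i hi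
    have := (List.pairwise_append.1 hr).2.2 _ (getD_mem' hi) y (by simp)
    exact this
  have hlen : (l₁ ++ x :: l₂).length = (l₁ ++ y :: l₂).length := by simp
  have key : ∀ i, (l₁ ++ x :: l₂).getD i 0 ≤ (l₁ ++ y :: l₂).getD i 0 := by
    intro i
    rw [getD_mid, getD_mid]
    split_ifs <;> omega
  have hlow : ∀ i ≤ l₁.length, (l₁ ++ x :: l₂).getD i 0 < y := by
    intro i hi
    rw [getD_mid]
    split_ifs with h1 h2
    · exact hl1 i h1
    · exact hxy
    · omega
  have hp : l₁.length < s.length → y < s.getD l₁.length 0 := by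
    intro h
    have := (hd _ h).2
    rw [getD_mid] at this
    simpa using this
  rcases rowInsert_spec y s with ⟨h1, h2⟩ | ⟨m₁, z, m₂, h1, h2, h3, h4⟩
  · rw [h1]
    have hsl : s.length ≤ l₁.length := by
      by_contra hc
      have h3 := h2 _ (getD_mem' (show l₁.length < s.length by omega))
      have := hp (by omega)
      omega
    intro i hi
    simp only [List.length_append, List.length_cons, List.length_nil] at hi
    refine ⟨by simp; omega, ?_⟩
    by_cases hi' : i < s.length
    · simp only
      rw [List.getD_append _ _ _ _ hi']
      exact lt_of_le_of_lt (key i) (hd i hi').2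
    · obtain rfl : i = s.length := by omega
      simp only
      rw [List.getD_append_right _ _ _ _ (le_refl _)]
      simpa using hlow _ hsl
  · rw [h2]
    have hsl : m₁.length ≤ l₁.length := by
      by_contra hc
      have h5 : l₁.length < m₁.length := by omega
      have h6 := h4 _ (getD_mem' h5)
      have := hp (by rw [h1]; simp; omega)
      rw [h1, getD_mid, if_pos h5] at this
      omega
    intro i hi
    have hi2 : i < s.length := by rw [h1]; simpa using hi
    refine ⟨by rw [hlen]; exact (hd i hi2).1, ?_⟩
    by_cases him : i = m₁.length
    · subst him
      simp only
      rw [getD_mid m₁ m₂ y]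
      simpa using hlow _ hsl
    · refine lt_of_le_of_lt (key i) ((hd i hi2).2.trans_le ?_)
      rw [h1, getD_mid, getD_mid]
      simp [him]

theorem Valid.insert {t : List (List ℕ)} (h : Valid t) : ∀ x : ℕ, (x :: t.flatten).Nodup →
    Valid (tabInsert t x) := by
  induction h with
  | nil =>
    intro x _
    exact Valid.cons _ _ (by simp) (by simp) (by intro i hi; simp at hi) Valid.nil
  | cons r rs h0 hr hd hv ih =>
    intro x hx
    rw [List.flatten_cons] at hx
    have hxr : x ∉ r := fun h => (List.nodup_cons.1 hx).1 (List.mem_append_left _ h)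
    have hnd := (List.nodup_cons.1 hx).2
    rcases rowInsert_spec x r with ⟨h1, h2⟩ | ⟨l₁, y, l₂, h1, h2, h3, h4⟩
    · rw [tabInsert_none h1]
      refine Valid.cons _ _ (by simp) ?_ ?_ hv
      · rw [List.pairwise_append]
        refine ⟨hr, by simp, ?_⟩
        intro a ha b hb
        rw [List.mem_singleton] at hb
        subst hb
        exact lt_of_le_of_ne (h2 a ha) (fun h => hxr (h ▸ ha))
      · intro i hi
        have := hd i hi
        refine ⟨by simp; omega, ?_⟩
        rw [List.getD_append _ _ _ _ this.1]
        exact this.2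
    · rw [tabInsert_some h2]
      subst h1
      refine Valid.cons _ _ (by simp) ?_ ?_ ?_
      · rw [List.pairwise_append] at hr ⊢
        refine ⟨hr.1, ?_, ?_⟩
        · have := List.pairwise_cons.1 hr.2.1
          rw [List.pairwise_cons]
          exact ⟨fun a ha => h3.trans (this.1 a ha), this.2⟩
        · intro a ha b hb
          rcases List.mem_cons.1 hb with rfl | hb
          · exact lt_of_le_of_ne (h4 a ha) (fun h => hxr (h ▸ List.mem_append_left _ ha))
          · exact hr.2.2 a ha b (by simp [hb])
      · rw [headD_tabInsert]
        exact dom_insert hr hv.head hd h3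
      · apply ih
        rw [List.nodup_append] at hnd
        rw [List.nodup_cons]
        exact ⟨fun h => hnd.2.2 y (by simp) y h rfl, hnd.2.1⟩

theorem Valid.tail {r : List ℕ} {rs : List (List ℕ)} (h : Valid (r :: rs)) : Valid rs := by
  cases h; assumption

theorem bump_lt {t : List (List ℕ)} (h : Valid t) : ∀ x y : ℕ, x < y →
    newRow (tabInsert t x) y ≤ newRow t x := by
  induction h with
  | nil =>
    intro x y hxy
    rw [tabInsert, newRow_none (r' := [x, y])]
    · simp
    · rw [rowInsert_none (by simp; omega)]; simp
  | cons r rs h0 hr hd hv ih =>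
    intro x y hxy
    rcases rowInsert_spec x r with ⟨h1, h2⟩ | ⟨l₁, a, l₂, h1, h2, h3, h4⟩
    · rw [tabInsert_none h1, newRow_none (rowInsert_none _)]
      · simp
      · intro z hz
        rcases List.mem_append.1 hz with hz | hz
        · have := h2 z hz; omega
        · have := List.mem_singleton.1 hz; omega
    · rw [tabInsert_some h2, newRow_some h2]
      rcases rowInsert_spec y (l₁ ++ x :: l₂) with ⟨g1, g2⟩ | ⟨m₁, b, m₂, g1, g2, g3, g4⟩
      · rw [newRow_none g1]; omega
      · rw [newRow_some g2]
        have hb : b ∈ l₁ ++ x :: l₂ := by rw [g1]; simp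
        have hb2 : b ∈ l₂ := by
          rcases List.mem_append.1 hb with hb | hb
          · have := h4 b hb; omega
          · rcases List.mem_cons.1 hb with rfl | hb
            · omega
            · exact hb
        subst h1
        have := (List.pairwise_cons.1 (List.pairwise_append.1 hr).2.1).1 b hb2
        have := ih a b this
        omega

theorem bump_gt {t : List (List ℕ)} (h : Valid t) : ∀ x y : ℕ, (x :: t.flatten).Nodup → y < x →
    newRow t x < newRow (tabInsert t x) y := by
  induction h with
  | nil =>
    intro x y _ hxy
    rw [tabInsert, newRow_some (y := x) (r' := [y])]
    · simp [newRow]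
    · simp [rowInsert, hxy]
  | cons r rs h0 hr hd hv ih =>
    intro x y hx hxy
    have hv' := (Valid.cons r rs h0 hr hd hv).insert x hx
    rcases rowInsert_spec x r with ⟨h1, h2⟩ | ⟨l₁, a, l₂, h1, h2, h3, h4⟩
    · rw [tabInsert_none h1, newRow_none h1]
      rcases rowInsert_spec y (r ++ [x]) with ⟨g1, g2⟩ | ⟨m₁, b, m₂, g1, g2, g3, g4⟩
      · have := g2 x (by simp); omega
      · rw [newRow_some g2]; omega
    · rw [tabInsert_some h2] at hv' ⊢
      rw [newRow_some h2]
      rcases rowInsert_spec y (l₁ ++ x :: l₂) with ⟨g1, g2⟩ | ⟨m₁, b, m₂, g1, g2, g3, g4⟩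
      · have := g2 x (by simp); omega
      · rw [newRow_some g2]
        have hs : (l₁ ++ x :: l₂).Pairwise (· < ·) := by simpa using hv'.head
        have hxm : x ∈ m₁ ++ b :: m₂ := by rw [← g1]; simp
        have hbx : b ≤ x := by
          rw [g1] at hs
          rcases List.mem_append.1 hxm with hm | hm
          · have := g4 x hm; omega
          · rcases List.mem_cons.1 hm with rfl | hm
            · exact le_refl _
            · exact ((List.pairwise_cons.1 (List.pairwise_append.1 hs).2.1).1 x hm).le
        have hnd : (a :: rs.flatten).Nodup := by
          have hnd := (List.nodup_cons.1 hx).2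
          rw [List.flatten_cons, List.nodup_append] at hnd
          rw [List.nodup_cons]
          exact ⟨fun h => hnd.2.2 a (by rw [h1]; simp) a h rfl, hnd.2.1⟩
        have := ih a b hnd (by omega)
        omega


theorem Valid.rl_headD {rs : List (List ℕ)} : rl rs 0 = (rs.headD []).length := by
  cases rs <;> simp [rl]

theorem exists_last_lt {r : List ℕ} (hr : r.Pairwise (· < ·)) {y : ℕ} (hy : y ∉ r)
    (he : ∃ z ∈ r, z < y) : ∃ m₁ z m₂, r = m₁ ++ z :: m₂ ∧ z < y ∧ ∀ u ∈ m₂, y < u := by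
  induction r with
  | nil => simp at he
  | cons a r ih =>
    rw [List.pairwise_cons] at hr
    have hy2 : y ∉ r := fun h => hy (by simp [h])
    by_cases h : ∃ z ∈ r, z < y
    · obtain ⟨m₁, z, m₂, h1, h2, h3⟩ := ih hr.2 hy2 h
      exact ⟨a :: m₁, z, m₂, by simp [h1], h2, h3⟩
    · push Not at h
      refine ⟨[], a, r, by simp, ?_, ?_⟩
      · obtain ⟨z, hz, hzy⟩ := he
        rcases List.mem_cons.1 hz with rfl | hz
        · exact hzy
        · have := h z hz; omega
      · intro u hu
        exact lt_of_le_of_ne (h u hu) (fun e => hy2 (e ▸ hu))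

theorem Valid.reverse {t' : List (List ℕ)} (h : Valid t') : ∀ k : ℕ, t'.flatten.Nodup →
    rl t' (k + 1) < rl t' k →
    ∃ t x, Valid t ∧ tabInsert t x = t' ∧ newRow t x = k := by
  induction h with
  | nil => intro k _ hk; simp [rl_nil] at hk
  | cons r rs h0 hr hd hv ih =>
    intro k hnd hk
    rw [List.flatten_cons, List.nodup_append] at hnd
    cases k with
    | zero =>
      rw [rl_cons_zero, rl_cons_succ, Valid.rl_headD] at hk
      obtain ⟨r0, x, rfl⟩ : ∃ r0 x, r = r0 ++ [x] :=
        ⟨r.dropLast, r.getLast h0, (List.dropLast_append_getLast h0).symm⟩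
      rw [List.pairwise_append] at hr
      have hle : ∀ z ∈ r0, z ≤ x := fun z hz => (hr.2.2 z hz x (by simp)).le
      simp only [List.length_append, List.length_cons, List.length_nil] at hk
      by_cases hr0 : r0 = []
      · subst hr0
        cases hv with
        | nil => exact ⟨[], x, Valid.nil, by simp [tabInsert], by simp [newRow]⟩
        | cons s ss hs _ _ _ =>
          simp at hk
          exact absurd hk hs
      · refine ⟨r0 :: rs, x, Valid.cons _ _ hr0 hr.1 ?_ hv, ?_, ?_⟩
        · intro i hi
          refine ⟨by omega, ?_⟩
          have := (hd i hi).2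
          rwa [List.getD_append _ _ _ _ (by omega)] at this
        · exact tabInsert_none (rowInsert_none hle)
        · exact newRow_none (rowInsert_none hle)
    | succ k =>
      rw [rl_cons_succ, rl_cons_succ] at hk
      obtain ⟨s, y, hs, hsy, hsk⟩ := ih k hnd.2.1 hk
      have hyrs : y ∈ rs.flatten := by
        rw [← hsy]; exact (flatten_tabInsert s y).mem_iff.2 (by simp)
      have hyr : y ∉ r := fun h => hnd.2.2 y h y hyrs rfl
      have hhead : rs.headD [] = (rowInsert y (s.headD [])).1 := by
        rw [← hsy]; exact headD_tabInsert s y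
      -- position of `y` in the head of `rs`
      have hpos : ∃ i, i < (rs.headD []).length ∧ (rs.headD []).getD i 0 = y := by
        rw [hhead]
        rcases rowInsert_spec y (s.headD []) with ⟨h1, h2⟩ | ⟨l₁, a, l₂, h1, h2, h3, h4⟩
        · rw [h1]
          refine ⟨(s.headD []).length, by simp, ?_⟩
          simp only
          rw [List.getD_append_right _ _ _ _ (le_refl _)]; simp
        · rw [h2]
          refine ⟨l₁.length, by simp, ?_⟩
          simp only
          rw [getD_mid]; simp
      obtain ⟨i, hi, hiy⟩ := hpos
      obtain ⟨m₁, z, m₂, h1, h2, h3⟩ := exists_last_lt hr hyr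
        ⟨_, getD_mem' (hd i hi).1, hiy ▸ (hd i hi).2⟩
      have hbig : ∀ j, m₁.length < j → j < r.length → y < r.getD j 0 := by
        intro j hj hjr
        rw [h1, getD_mid, if_neg (by omega), if_neg (by omega)]
        apply h3
        apply getD_mem'
        rw [h1] at hjr
        simp at hjr
        omega
      subst h1
      have hr' := List.pairwise_append.1 hr
      have hr2 := List.pairwise_cons.1 hr'.2.1
      have hm : ∀ u ∈ m₁, u < z := fun u hu => hr'.2.2 u hu z (by simp)
      have hins : rowInsert z (m₁ ++ y :: m₂) = (m₁ ++ z :: m₂, some y) :=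
        rowInsert_some (fun u hu => (hm u hu).le) h2
      refine ⟨(m₁ ++ y :: m₂) :: s, z, Valid.cons _ _ (by simp) ?_ ?_ hs, ?_, ?_⟩
      · rw [List.pairwise_append, List.pairwise_cons]
        refine ⟨hr'.1, ⟨h3, hr2.2⟩, ?_⟩
        intro u hu b hb
        rcases List.mem_cons.1 hb with rfl | hb
        · exact (hm u hu).trans h2
        · exact hr'.2.2 u hu b (by simp [hb])
      · have hss := hs.head
        intro j hj
        rw [hhead] at hd
        have hlen : (m₁ ++ y :: m₂).length = (m₁ ++ z :: m₂).length := by simp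
        rcases rowInsert_spec y (s.headD []) with ⟨g1, g2⟩ | ⟨l₁, a, l₂, g1, g2, g3, g4⟩
        · rw [g1] at hd
          simp only at hd
          have hdj := hd j (by rw [List.length_append]; omega)
          refine ⟨by rw [hlen]; exact hdj.1, ?_⟩
          have hlast := hd (s.headD []).length (by simp)
          rw [List.getD_append_right _ _ _ _ (le_refl _)] at hlast
          simp only [Nat.sub_self, List.getD_cons_zero] at hlast
          have hsm : (s.headD []).length ≤ m₁.length := by
            by_contra hc
            have := hbig _ (not_le.1 hc) hlast.1
            omega
          have h5 := hdj.2
          rw [List.getD_append _ _ _ _ hj] at h5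
          rw [getD_mid, if_pos (by omega)] at h5 ⊢
          exact h5
        · rw [g2] at hd
          simp only at hd
          have hj2 : j < (l₁ ++ y :: l₂).length := by rw [g1] at hj; simpa using hj
          have hdj := hd j hj2
          refine ⟨by rw [hlen]; exact hdj.1, ?_⟩
          have hp := hd l₁.length (by simp)
          rw [getD_mid l₁, if_neg (lt_irrefl _), if_pos rfl] at hp
          have hlm : l₁.length ≤ m₁.length := by
            by_contra hc
            have := hbig _ (not_le.1 hc) hp.1
            omega
          by_cases hjm : j = m₁.length
          · subst hjm
            rw [getD_mid, if_neg (lt_irrefl _), if_pos rfl]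
            have ha : (s.headD []).getD l₁.length 0 = a := by rw [g1, getD_mid]; simp
            rcases Nat.lt_or_ge l₁.length m₁.length with hlt | hge
            · have := getD_lt hss hlt hj
              omega
            · rw [show m₁.length = l₁.length by omega]; omega
          · have h6 : (m₁ ++ y :: m₂).getD j 0 = (m₁ ++ z :: m₂).getD j 0 := by
              rw [getD_mid, getD_mid]; simp [hjm]
            rw [h6]
            refine hdj.2.trans_le ?_
            rw [g1, getD_mid, getD_mid]
            split_ifs <;> omega
      · rw [tabInsert_some hins, hsy]
      · rw [newRow_some hins, hsk]

/-! ### Functional form of list tableaux -/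

theorem listEntry_cons_zero (r : List ℕ) (rs : List (List ℕ)) (c : ℕ) :
    listEntry (r :: rs) (0, c) = r.getD c 0 := by simp [listEntry]

theorem listEntry_cons_succ (r : List ℕ) (rs : List (List ℕ)) (k c : ℕ) :
    listEntry (r :: rs) (k + 1, c) = listEntry rs (k, c) := by simp [listEntry]

theorem listEntry_mem {t : List (List ℕ)} : ∀ {a : ℕ × ℕ}, a.2 < rl t a.1 →
    listEntry t a ∈ t.flatten := by
  induction t with
  | nil => intro a ha; simp [rl_nil] at ha
  | cons r rs ih =>
    rintro ⟨k, c⟩ ha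
    rw [List.flatten_cons, List.mem_append]
    cases k with
    | zero =>
      left; rw [listEntry_cons_zero]; rw [rl_cons_zero] at ha; exact getD_mem' ha
    | succ k =>
      right; rw [listEntry_cons_succ]; rw [rl_cons_succ] at ha; exact ih (a := (k, c)) ha

theorem exists_listEntry {t : List (List ℕ)} {x : ℕ} (hx : x ∈ t.flatten) :
    ∃ a : ℕ × ℕ, a.2 < rl t a.1 ∧ listEntry t a = x := by
  induction t with
  | nil => simp at hx
  | cons r rs ih =>
    rw [List.flatten_cons, List.mem_append] at hx
    rcases hx with hx | hx
    · obtain ⟨i, hi, rfl⟩ := List.mem_iff_getElem.1 hx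
      refine ⟨(0, i), ?_, ?_⟩
      · rw [rl_cons_zero]; exact hi
      · rw [listEntry_cons_zero, List.getD_eq_getElem _ _ hi]
    · obtain ⟨⟨k, c⟩, h1, h2⟩ := ih hx
      refine ⟨(k + 1, c), ?_, ?_⟩
      · rw [rl_cons_succ]; exact h1
      · rw [listEntry_cons_succ]; exact h2

theorem listEntry_out {t : List (List ℕ)} {a : ℕ × ℕ} (h : ¬ a.2 < rl t a.1) :
    listEntry t a = 0 := by
  unfold listEntry
  rw [List.getD_eq_default]
  unfold rl at h
  omega

theorem listEntry_ne {t : List (List ℕ)} (h0 : 0 ∉ t.flatten) (a : ℕ × ℕ) :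
    listEntry t a ≠ 0 ↔ a.2 < rl t a.1 := by
  constructor
  · intro h; by_contra hc; exact h (listEntry_out hc)
  · intro h e
    exact h0 (e ▸ listEntry_mem h)

theorem listEntry_inj {t : List (List ℕ)} (hnd : t.flatten.Nodup) : ∀ {a b : ℕ × ℕ},
    a.2 < rl t a.1 → b.2 < rl t b.1 → listEntry t a = listEntry t b → a = b := by
  induction t with
  | nil => intro a b ha; simp [rl_nil] at ha
  | cons r rs ih =>
    rw [List.flatten_cons, List.nodup_append] at hnd
    rintro ⟨k, c⟩ ⟨k', c'⟩ ha hb hab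
    cases k with
    | zero =>
      rw [rl_cons_zero] at ha
      rw [listEntry_cons_zero] at hab
      cases k' with
      | zero =>
        rw [rl_cons_zero] at hb
        rw [listEntry_cons_zero] at hab
        simp only at ha hb
        rw [List.getD_eq_getElem _ _ ha, List.getD_eq_getElem _ _ hb] at hab
        have := (List.Nodup.getElem_inj_iff hnd.1).1 hab
        rw [this]
      | succ k' =>
        rw [rl_cons_succ] at hb
        rw [listEntry_cons_succ] at hab
        exact absurd hab (hnd.2.2 _ (getD_mem' ha) _ (listEntry_mem (a := (k', c')) hb))
    | succ k =>
      rw [rl_cons_succ] at ha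
      rw [listEntry_cons_succ] at hab
      cases k' with
      | zero =>
        rw [rl_cons_zero] at hb
        rw [listEntry_cons_zero] at hab
        exact absurd hab.symm (hnd.2.2 _ (getD_mem' hb) _ (listEntry_mem (a := (k, c)) ha))
      | succ k' =>
        rw [rl_cons_succ] at hb
        rw [listEntry_cons_succ] at hab
        have := ih hnd.2.1 (a := (k, c)) (b := (k', c')) ha hb hab
        simp only [Prod.mk.injEq] at this ⊢
        omega

theorem Valid.col {t : List (List ℕ)} (h : Valid t) : ∀ k c, c < rl t (k + 1) →
    c < rl t k ∧ listEntry t (k, c) < listEntry t (k + 1, c) := by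
  induction h with
  | nil => intro k c h; simp [rl_nil] at h
  | cons r rs h0 hr hd hv ih =>
    intro k c hc
    cases k with
    | zero =>
      rw [rl_cons_succ, Valid.rl_headD] at hc
      have := hd c hc
      rw [rl_cons_zero, listEntry_cons_zero, listEntry_cons_succ]
      refine ⟨this.1, this.2.trans_le ?_⟩
      cases rs <;> simp [listEntry]
    | succ k =>
      rw [rl_cons_succ] at hc
      rw [rl_cons_succ, listEntry_cons_succ, listEntry_cons_succ]
      exact ih k c hc

theorem Valid.row {t : List (List ℕ)} (h : Valid t) : ∀ k c c', c < c' → c' < rl t k →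
    listEntry t (k, c) < listEntry t (k, c') := by
  induction h with
  | nil => intro k c c' _ h; simp [rl_nil] at h
  | cons r rs h0 hr hd hv ih =>
    intro k c c' hcc hc
    cases k with
    | zero =>
      rw [rl_cons_zero] at hc
      rw [listEntry_cons_zero, listEntry_cons_zero]
      exact getD_lt hr hcc hc
    | succ k =>
      rw [rl_cons_succ] at hc
      rw [listEntry_cons_succ, listEntry_cons_succ]
      exact ih k c c' hcc hc

theorem Valid.col_le {t : List (List ℕ)} (h : Valid t) (k j c : ℕ) (hc : c < rl t (k + j)) :
    c < rl t k ∧ listEntry t (k, c) ≤ listEntry t (k + j, c) := by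
  induction j with
  | zero => exact ⟨hc, le_refl _⟩
  | succ j ih =>
    have h1 := h.col (k + j) c hc
    have h2 := ih h1.1
    exact ⟨h2.1, h2.2.trans h1.2.le⟩

theorem Valid.mono {t : List (List ℕ)} (h : Valid t) {a b : ℕ × ℕ} (hab : a ≤ b)
    (hb : b.2 < rl t b.1) : a.2 < rl t a.1 ∧ (a ≠ b → listEntry t a < listEntry t b) := by
  obtain ⟨k, c⟩ := a
  obtain ⟨k', c'⟩ := b
  obtain ⟨h1, h2⟩ := hab
  simp only at h1 h2 hb ⊢
  obtain ⟨j, rfl⟩ := Nat.exists_eq_add_of_le h1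
  have hc1 := h.col_le k j c' hb
  refine ⟨by omega, fun hne => ?_⟩
  rcases Nat.lt_or_ge c c' with hlt | hge
  · exact (h.row k c c' hlt hc1.1).trans_le hc1.2
  · obtain rfl : c = c' := by omega
    cases j with
    | zero => exact absurd rfl hne
    | succ j =>
      have h3 := h.col (k + j) c hb
      exact (h.col_le k j c h3.1).2.trans_lt h3.2

/-- A valid list tableau with entries `1, …, N` is standard. -/
theorem Valid.std {t : List (List ℕ)} {N : ℕ} (h : Valid t)
    (hp : t.flatten.Perm ((List.range N).map (· + 1))) :
    Std N (fun c => listEntry t c) ∧ ∀ a, listEntry t a ≠ 0 ↔ a.2 < rl t a.1 := by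
  have hmem : ∀ x, x ∈ t.flatten ↔ 1 ≤ x ∧ x ≤ N := by
    intro x
    rw [hp.mem_iff]
    simp only [List.mem_map, List.mem_range]
    constructor
    · rintro ⟨a, ha, rfl⟩; omega
    · intro hx; exact ⟨x - 1, by omega, by omega⟩
  have hnd : t.flatten.Nodup := by
    rw [hp.nodup_iff]
    exact List.nodup_range.map (fun a b h => by simpa using h)
  have h0 : 0 ∉ t.flatten := by rw [hmem]; omega
  have hne := listEntry_ne h0
  refine ⟨⟨?_, ?_, ?_, ?_⟩, hne⟩
  · intro a b hab hn hb
    have := h.mono hab ((hne b).1 hb)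
    exact ⟨(hne a).2 this.1, this.2 hn⟩
  · intro a b hab ha
    exact listEntry_inj hnd ((hne a).1 ha) ((hne b).1 (by rw [← hab]; exact ha)) hab
  · intro a
    by_cases ha : a.2 < rl t a.1
    · exact ((hmem _).1 (listEntry_mem ha)).2
    · simp [listEntry_out ha]
  · intro m h1 h2
    obtain ⟨a, _, ha⟩ := exists_listEntry ((hmem m).2 ⟨h1, h2⟩)
    exact ⟨a, ha⟩


/-- Insertion tableau of a word. -/
def tm (l : List ℕ) : List (List ℕ) := l.foldl tabInsert []

theorem tm_append (l : List ℕ) (x : ℕ) : tm (l ++ [x]) = tabInsert (tm l) x := by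
  simp [tm, List.foldl_append]

theorem tm_valid (l : List ℕ) : l.Nodup → Valid (tm l) ∧ (tm l).flatten.Perm l := by
  induction l using List.reverseRecOn with
  | nil => intro _; exact ⟨Valid.nil, by simp [tm]⟩
  | append_singleton l x ih =>
    intro hnd
    have hp : (l ++ [x]).Perm (x :: l) := List.perm_append_comm
    have hnd' := hp.nodup_iff.1 hnd
    obtain ⟨h1, h2⟩ := ih (List.nodup_cons.1 hnd').2
    rw [tm_append]
    refine ⟨h1.insert x ?_, ?_⟩
    · rw [(h2.cons x).nodup_iff]; exact hnd'
    · exact ((flatten_tabInsert _ x).trans (h2.cons x)).trans hp.symm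

theorem flatten_tm (l : List ℕ) : (tm l).flatten.Perm l := by
  induction l using List.reverseRecOn with
  | nil => simp [tm]
  | append_singleton l x ih =>
    rw [tm_append]
    exact ((flatten_tabInsert _ x).trans (ih.cons x)).trans
      (List.perm_append_comm (l₁ := l) (l₂ := [x])).symm

theorem Std.zero : Std 0 (fun _ => 0) :=
  ⟨fun _ _ _ _ h => absurd rfl h, fun _ _ _ h => absurd rfl h, fun _ => le_refl _,
    fun m h1 h2 => by omega⟩

theorem RS_Q (l : List ℕ) : l.Nodup → ∃ Q, Std l.length Q ∧
    ∀ m ≤ l.length, ∀ c : ℕ × ℕ, c.2 < rl (tm (l.take m)) c.1 ↔ Q c ≠ 0 ∧ Q c ≤ m := by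
  induction l using List.reverseRecOn with
  | nil =>
    intro _
    refine ⟨_, Std.zero, ?_⟩
    intro m hm c
    simp [tm, rl_nil]
  | append_singleton l x ih =>
    intro hnd
    obtain ⟨Q, hQ, hQm⟩ := ih (List.nodup_append.1 hnd).1
    have hv := (tm_valid _ hnd).1
    rw [tm_append] at hv
    have hfull := hQm l.length (le_refl _)
    rw [List.take_length] at hfull
    set v : ℕ × ℕ := (newRow (tm l) x, rl (tm l) (newRow (tm l) x)) with hvdef
    have hQv : Q v = 0 := by
      by_contra hc
      have := (hfull v).2 ⟨hc, hQ.le v⟩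
      simp [hvdef] at this
    have hlen : (l ++ [x]).length = l.length + 1 := by simp
    refine ⟨Function.update Q v (l.length + 1), ?_, ?_⟩
    · rw [hlen]
      apply hQ.add hQv
      intro a hav hne
      have h1 := (hv.mono hav (by rw [rl_tabInsert]; simp [hvdef])).1
      rw [rl_tabInsert] at h1
      refine ((hfull a).1 ?_).1
      split_ifs at h1 with h2
      · have h3 := hav.2
        have h4 : a.2 ≠ v.2 := fun h => hne (Prod.ext h2 h)
        rw [h2]
        simp only [hvdef] at h3 h4
        omega
      · exact h1
    · intro m hm c
      rw [hlen] at hm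
      rcases Nat.lt_or_ge l.length m with hlt | hge
      · obtain rfl : m = l.length + 1 := by omega
        rw [← hlen, List.take_length, tm_append, rl_tabInsert, hlen]
        by_cases hcv : c = v
        · subst hcv
          simp [hvdef]
        · rw [Function.update_of_ne hcv]
          have h1 := hfull c
          have h2 := hQ.le c
          by_cases hcr : c.1 = newRow (tm l) x
          · rw [if_pos hcr]
            have : c.2 ≠ rl (tm l) c.1 := fun h => hcv (Prod.ext hcr (by rw [h, hcr]))
            constructor
            · intro h; have := h1.1 (by omega); exact ⟨this.1, by omega⟩
            · intro h; have := h1.2 ⟨h.1, h2⟩; omega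
          · rw [if_neg hcr, Nat.add_zero, h1]
            constructor
            · intro h; exact ⟨h.1, by omega⟩
            · intro h; exact ⟨h.1, h2⟩
      · rw [List.take_append_of_le_length hge, hQm m hge c]
        by_cases hcv : c = v
        · subst hcv
          rw [Function.update_self, hQv]; simp; omega
        · rw [Function.update_of_ne hcv]

theorem RS_Q_desc {l : List ℕ} (hnd : l.Nodup) {Q : Tab} (hQ : Std l.length Q)
    (hQm : ∀ m ≤ l.length, ∀ c : ℕ × ℕ, c.2 < rl (tm (l.take m)) c.1 ↔ Q c ≠ 0 ∧ Q c ≤ m)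
    (i : ℕ) (hi : i + 1 < l.length) :
    i + 1 ∈ DsiSet l.length Q ↔ l[i + 1] < l[i] := by
  have hstep : ∀ m (h : m < l.length), tm (l.take (m + 1)) = tabInsert (tm (l.take m)) l[m] := by
    intro m h
    rw [← tm_append, List.take_append_getElem]
  have hpos : ∀ m (h : m < l.length),
      Q (newRow (tm (l.take m)) l[m], rl (tm (l.take m)) (newRow (tm (l.take m)) l[m])) = m + 1 := by
    intro m h
    set c : ℕ × ℕ := (newRow (tm (l.take m)) l[m],
      rl (tm (l.take m)) (newRow (tm (l.take m)) l[m])) with hc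
    have h1 := (hQm (m + 1) (by omega) c).1 (by rw [hstep m h, rl_tabInsert]; simp [hc])
    have h2 := mt (hQm m (by omega) c).2 (by simp [hc])
    by_contra h3
    exact h2 ⟨h1.1, by omega⟩
  have ha := hpos i (by omega)
  have hb := hpos (i + 1) hi
  set a : ℕ × ℕ := (newRow (tm (l.take i)) l[i],
      rl (tm (l.take i)) (newRow (tm (l.take i)) l[i])) with had
  set b : ℕ × ℕ := (newRow (tm (l.take (i + 1))) l[i + 1],
      rl (tm (l.take (i + 1))) (newRow (tm (l.take (i + 1))) l[i + 1])) with hbd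
  have hmd := hQ.mem_Dsi (a := a) (b := b) (by omega) (by omega)
  rw [ha] at hmd
  rw [hmd]
  have hnd1 : (l.take (i + 1)).Nodup := hnd.sublist (List.take_sublist _ _)
  have hval := (tm_valid _ (hnd.sublist (List.take_sublist i l)))
  have hb1 : b.1 = newRow (tabInsert (tm (l.take i)) l[i]) l[i + 1] := by
    rw [hbd]; simp only; rw [hstep i (by omega)]
  have ha1 : a.1 = newRow (tm (l.take i)) l[i] := rfl
  rw [ha1, hb1]
  have hndx : (l[i] :: (tm (l.take i)).flatten).Nodup := by
    rw [(hval.2.cons _).nodup_iff]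
    have : (l.take i ++ [l[i]]).Perm (l[i] :: l.take i) := List.perm_append_comm
    rw [← this.nodup_iff, List.take_append_getElem]
    exact hnd1
  constructor
  · intro h
    by_contra hc
    have hne : l[i] ≠ l[i + 1] := by
      intro e
      have := (List.Nodup.getElem_inj_iff hnd).1 e
      omega
    have := bump_lt hval.1 l[i] l[i + 1] (by omega)
    omega
  · intro h
    exact bump_gt hval.1 _ _ hndx h

theorem RS_surj : ∀ (N : ℕ) (t : List (List ℕ)) (Q : Tab), Valid t → t.flatten.Nodup → Std N Q →
    (∀ c : ℕ × ℕ, c.2 < rl t c.1 ↔ Q c ≠ 0) →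
    ∃ l : List ℕ, l.length = N ∧ tm l = t ∧
      ∀ m ≤ N, ∀ c : ℕ × ℕ, c.2 < rl (tm (l.take m)) c.1 ↔ Q c ≠ 0 ∧ Q c ≤ m := by
  intro N
  induction N with
  | zero =>
    intro t Q hv hnd hQ hs
    have ht : t = [] := by
      cases hv with
      | nil => rfl
      | cons r rs h0 _ _ _ =>
        exfalso
        have h1 := hQ.le (0, 0)
        have := (hs (0, 0)).1 (by
          rw [rl_cons_zero]; exact List.length_pos_iff.2 h0)
        omega
    subst ht
    refine ⟨[], rfl, rfl, ?_⟩
    intro m hm c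
    have := hQ.le c
    simp [tm, rl_nil]; omega
  | succ N ih =>
    intro t Q hv hnd hQ hs
    obtain ⟨v, hQv⟩ := hQ.surj (N + 1) (by omega) (le_refl _)
    have hmax : ∀ b, v ≤ b → v ≠ b → Q b = 0 := by
      intro b hb hne
      by_contra hc
      have := hQ.mono v b hb hne hc
      have := hQ.le b
      omega
    have hr : rl t v.1 = v.2 + 1 := by
      have h1 := (hs v).2 (by omega)
      have h2 := mt (hs (v.1, v.2 + 1)).1 (by
        rw [not_not]; apply hmax
        · exact ⟨le_refl _, by simp⟩
        · intro h; have := congrArg Prod.snd h; simp at this)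
      simp only at h2
      omega
    have hd : rl t (v.1 + 1) < rl t v.1 := by
      have h2 := mt (hs (v.1 + 1, v.2)).1 (by
        rw [not_not]; apply hmax
        · exact ⟨by simp, le_refl _⟩
        · intro h; have := congrArg Prod.fst h; simp at this)
      simp only at h2
      omega
    obtain ⟨t0, x, hv0, rfl, hk⟩ := hv.reverse v.1 hnd hd
    have hnd0 : t0.flatten.Nodup :=
      (List.nodup_cons.1 ((flatten_tabInsert t0 x).nodup_iff.1 hnd)).2
    obtain ⟨hQ0, hQs⟩ := hQ.remove hQv
    have hrl : ∀ k, rl (tabInsert t0 x) k = rl t0 k + if k = v.1 then 1 else 0 := by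
      intro k; rw [rl_tabInsert, hk]
    obtain ⟨l, hl, rfl, hlm⟩ := ih t0 _ hv0 hnd0 hQ0 (by
      intro c
      rw [hQs, ← hs, hrl]
      rw [hrl, if_pos rfl] at hr
      by_cases hc : c.1 = v.1
      · rw [if_pos hc, hc]
        have : c ≠ v ↔ c.2 ≠ v.2 := by
          rw [not_iff_not]
          exact ⟨fun h => by rw [h], fun h => Prod.ext hc h⟩
        rw [this]
        omega
      · rw [if_neg hc]
        have : c ≠ v := fun h => hc (by rw [h])
        simp [this])
    refine ⟨l ++ [x], by simp [hl], tm_append l x, ?_⟩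
    intro m hm c
    rcases Nat.lt_or_ge N m with hlt | hge
    · obtain rfl : m = N + 1 := by omega
      rw [List.take_of_length_le (by simp [hl]), tm_append, hs]
      have := hQ.le c
      tauto
    · rw [List.take_append_of_le_length (by omega), hlm m hge]
      by_cases hc : c = v
      · subst hc
        simp [hQv]; omega
      · rw [Function.update_of_ne hc]

theorem valid_rows (P : Tab) (len : ℕ → ℕ)
    (hcol : ∀ k c, c < len (k + 1) → c < len k ∧ P (k, c) < P (k + 1, c))
    (hrow : ∀ k c c', c < c' → c' < len k → P (k, c) < P (k, c')) :
    ∀ (j s : ℕ), (∀ k, s ≤ k → k < s + j → 0 < len k) →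
      Valid ((List.range' s j).map fun k => (List.range (len k)).map fun c => P (k, c)) := by
  intro j
  induction j with
  | zero => intro s _; exact Valid.nil
  | succ j ih =>
    intro s hs
    rw [List.range'_succ, List.map_cons]
    refine Valid.cons _ _ ?_ ?_ ?_ (ih (s + 1) (fun k h1 h2 => hs k (by omega) (by omega)))
    · have := hs s (le_refl _) (by omega)
      simp; omega
    · rw [List.pairwise_map]
      have := List.pairwise_lt_range (n := len s)
      refine List.Pairwise.imp_of_mem ?_ this
      intro a b _ hb hab
      exact hrow s a b hab (List.mem_range.1 hb)
    · cases j with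
      | zero => intro i hi; simp at hi
      | succ j =>
        rw [List.range'_succ, List.map_cons, List.headD_cons]
        intro i hi
        simp only [List.length_map, List.length_range] at hi ⊢
        have := hcol s i hi
        refine ⟨this.1, ?_⟩
        rw [List.getD_eq_getElem _ _ (by simpa using this.1),
          List.getD_eq_getElem _ _ (by simpa using hi)]
        simpa using this.2

theorem exists_list {N : ℕ} {P : Tab} {μ : YoungDiagram} (hP : Std N P)
    (hs : ∀ a, P a ≠ 0 ↔ a ∈ μ.cells) :
    ∃ t, Valid t ∧ (∀ c, listEntry t c = P c) ∧ (∀ c : ℕ × ℕ, c.2 < rl t c.1 ↔ P c ≠ 0) := by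
  have hmem : ∀ k c, P (k, c) ≠ 0 ↔ c < μ.rowLen k := by
    intro k c
    rw [hs, YoungDiagram.mem_cells, YoungDiagram.mem_iff_lt_rowLen]
  have hcolmem : ∀ k, k < μ.colLen 0 ↔ 0 < μ.rowLen k := by
    intro k
    rw [← YoungDiagram.mem_iff_lt_rowLen, ← YoungDiagram.mem_iff_lt_colLen]
  have hv := valid_rows P μ.rowLen (by
      intro k c hc
      have := hP.mono (k, c) (k + 1, c) ⟨by simp, le_refl _⟩ (by simp) ((hmem _ _).2 hc)
      exact ⟨(hmem _ _).1 this.1, this.2⟩) (by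
      intro k c c' hcc hc
      exact (hP.mono (k, c) (k, c') ⟨le_refl _, hcc.le⟩ (by simp; omega) ((hmem _ _).2 hc)).2)
    (μ.colLen 0) 0 (by intro k _ hk; exact (hcolmem k).1 (by omega))
  rw [← List.range_eq_range'] at hv
  set t := (List.range (μ.colLen 0)).map fun k => (List.range (μ.rowLen k)).map fun c => P (k, c)
    with ht
  have hget : ∀ k, t.getD k [] = (List.range (μ.rowLen k)).map fun c => P (k, c) := by
    intro k
    by_cases hk : k < μ.colLen 0
    · rw [List.getD_eq_getElem _ _ (by simpa [ht] using hk)]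
      simp [ht]
    · have : μ.rowLen k = 0 := by have := hcolmem k; omega
      rw [List.getD_eq_default _ _ (by simpa [ht] using hk), this]
      simp
  have hrl : ∀ k, rl t k = μ.rowLen k := by intro k; rw [rl, hget]; simp
  refine ⟨t, hv, ?_, ?_⟩
  · rintro ⟨k, c⟩
    rw [listEntry, hget]
    by_cases hc : c < μ.rowLen k
    · rw [List.getD_eq_getElem _ _ (by simpa using hc)]; simp
    · rw [List.getD_eq_default _ _ (by simpa using hc)]
      have := (hmem k c)
      by_contra h
      exact hc (this.1 (Ne.symm h))
  · rintro ⟨k, c⟩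
    rw [hrl, hmem]

theorem oneLine_perm {N : ℕ} {w : Equiv.Perm ℕ} (hw : SuppIn N w) :
    (oneLine N w).Perm ((List.range N).map (· + 1)) := by
  have hnd : (oneLine N w).Nodup :=
    List.nodup_range.map (fun a b h => by simpa using h)
  have hnd2 : ((List.range N).map (· + 1)).Nodup :=
    List.nodup_range.map (fun a b h => by simpa using h)
  rw [List.perm_ext_iff_of_nodup hnd hnd2]
  intro x
  simp only [oneLine, List.mem_map, List.mem_range]
  have hin : ∀ i, 1 ≤ i ∧ i ≤ N → 1 ≤ w i ∧ w i ≤ N := by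
    intro i hi
    by_contra hc
    have h1 := hw (w i) (by omega)
    have := w.injective h1
    omega
  constructor
  · rintro ⟨a, ha, rfl⟩
    have := hin (a + 1) (by omega)
    exact ⟨w (a + 1) - 1, by omega, by omega⟩
  · rintro ⟨a, ha, rfl⟩
    have hb : 1 ≤ w.symm (a + 1) ∧ w.symm (a + 1) ≤ N := by
      by_contra hc
      have h1 := hw (w.symm (a + 1)) (by omega)
      rw [Equiv.apply_symm_apply] at h1
      omega
    refine ⟨w.symm (a + 1) - 1, by omega, ?_⟩
    rw [Nat.sub_add_cancel hb.1, Equiv.apply_symm_apply]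

theorem Qtab_eq {N : ℕ} {w : Equiv.Perm ℕ} (hw : SuppIn N w) {Q : Tab} (hQ : Std N Q)
    (hQm : ∀ m ≤ N, ∀ c : ℕ × ℕ,
      c.2 < rl (tm ((oneLine N w).take m)) c.1 ↔ Q c ≠ 0 ∧ Q c ≤ m) : Qtab N w = Q := by
  have hp := oneLine_perm hw
  have hlen : (oneLine N w).length = N := by simp [oneLine]
  have hnd : (oneLine N w).Nodup := by
    rw [hp.nodup_iff]
    exact List.nodup_range.map (fun a b h => by simpa using h)
  have h0 : 0 ∉ oneLine N w := by rw [hp.mem_iff]; simp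
  have htake : (oneLine N w).take N = oneLine N w := List.take_of_length_le (by omega)
  have hpe : ∀ m c, listEntry (PtabListPart N w m) c ≠ 0 ↔
      c.2 < rl (tm ((oneLine N w).take m)) c.1 := by
    intro m c
    apply listEntry_ne
    change 0 ∉ (tm ((oneLine N w).take m)).flatten
    rw [(tm_valid _ (hnd.sublist (List.take_sublist m _))).2.mem_iff]
    exact fun h => h0 (List.mem_of_mem_take h)
  funext c
  rw [Qtab]
  have hset : ∀ m, listEntry (PtabListPart N w m) c ≠ 0 ↔ Q c ≠ 0 ∧ Q c ≤ m := by
    intro m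
    rw [hpe]
    rcases Nat.le_total m N with h | h
    · exact hQm m h c
    · rw [List.take_of_length_le (by omega), ← htake, hQm N (le_refl _) c]
      have := hQ.le c
      constructor
      · rintro ⟨a, _⟩; exact ⟨a, by omega⟩
      · rintro ⟨a, _⟩; exact ⟨a, by omega⟩
  by_cases hc : Q c = 0
  · rw [hc]
    apply Nat.sInf_eq_zero.2
    right
    ext m
    change listEntry (PtabListPart N w m) c ≠ 0 ↔ False
    rw [hset]
    simp [hc]
  · apply le_antisymm
    · exact Nat.sInf_le ((hset (Q c)).2 ⟨hc, le_refl _⟩)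
    · have : sInf {m | listEntry (PtabListPart N w m) c ≠ 0} ∈
          {m | listEntry (PtabListPart N w m) c ≠ 0} :=
        Nat.sInf_mem ⟨Q c, (hset (Q c)).2 ⟨hc, le_refl _⟩⟩
      exact ((hset _).1 this).2

/-- First half of Robinson–Schensted. -/
theorem RS_forward {N : ℕ} {w : Equiv.Perm ℕ} (hw : SuppIn N w) :
    ∃ μ : YoungDiagram, Std N (Ptab N w) ∧ Std N (Qtab N w) ∧
      (∀ a, Ptab N w a ≠ 0 ↔ a ∈ μ.cells) ∧ (∀ a, Qtab N w a ≠ 0 ↔ a ∈ μ.cells) ∧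
      DslSet N w = DsiSet N (Qtab N w) := by
  have hp := oneLine_perm hw
  have hlen : (oneLine N w).length = N := by simp [oneLine]
  have hnd : (oneLine N w).Nodup := by
    rw [hp.nodup_iff]
    exact List.nodup_range.map (fun a b h => by simpa using h)
  have h0 : 0 ∉ oneLine N w := by rw [hp.mem_iff]; simp
  obtain ⟨hv, hf⟩ := tm_valid _ hnd
  have htake : (oneLine N w).take N = oneLine N w := List.take_of_length_le (by omega)
  have hpart : PtabListPart N w N = tm (oneLine N w) := by
    rw [PtabListPart, htake]; rfl
  obtain ⟨hP, hPs⟩ := hv.std (hf.trans hp)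
  obtain ⟨Q, hQ, hQm⟩ := RS_Q _ hnd
  have hQeq : Qtab N w = Q := Qtab_eq hw (by rwa [hlen] at hQ) (by rwa [hlen] at hQm)
  rw [hlen] at hQ
  have hPt : Ptab N w = fun c => listEntry (tm (oneLine N w)) c := by
    funext c; rw [Ptab, hpart]
  have hsame : ∀ a, Ptab N w a ≠ 0 ↔ Q a ≠ 0 := by
    intro a
    have h1 := hQm N (by omega) a
    rw [htake] at h1
    rw [hPt]
    refine (hPs a).trans (h1.trans ?_)
    have := hQ.le a
    tauto
  rw [hQeq]
  obtain ⟨μ, hμ⟩ := hQ.exists_diagram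
  refine ⟨μ, by rw [hPt]; exact hP, hQ, fun a => (hsame a).trans (hμ a), hμ, ?_⟩
  ext i
  by_cases hi : 0 < i ∧ i < N
  · obtain ⟨j, rfl⟩ : ∃ j, i = j + 1 := ⟨i - 1, by omega⟩
    have h1 := RS_Q_desc hnd (hlen.symm ▸ hQ) hQm j (by omega)
    have h2 : j + 1 ∈ DsiSet (oneLine N w).length Q ↔ j + 1 ∈ DsiSet N Q := by rw [hlen]
    rw [← h2, h1]
    simp [DslSet, oneLine, hi]
  · simp only [DslSet, DsiSet, Finset.mem_filter, Finset.mem_Ioo, hi, false_and]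

/-- A word that is a permutation of `1, …, N` comes from a permutation. -/
theorem exists_perm_of_word {N : ℕ} {l : List ℕ}
    (hp : l.Perm ((List.range N).map (· + 1))) :
    ∃ w : Equiv.Perm ℕ, SuppIn N w ∧ oneLine N w = l := by
  have hlen : l.length = N := by rw [hp.length_eq]; simp
  have hnd : l.Nodup := by
    rw [hp.nodup_iff]
    exact List.nodup_range.map (fun a b h => by simpa using h)
  have hmem : ∀ x, x ∈ l ↔ 1 ≤ x ∧ x ≤ N := by
    intro x
    rw [hp.mem_iff]
    simp only [List.mem_map, List.mem_range]
    constructor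
    · rintro ⟨a, ha, rfl⟩; omega
    · intro hx; exact ⟨x - 1, by omega, by omega⟩
  let f : ℕ → ℕ := fun i => if 1 ≤ i ∧ i ≤ N then l.getD (i - 1) 0 else i
  have hfin : ∀ i, 1 ≤ i ∧ i ≤ N → 1 ≤ f i ∧ f i ≤ N := by
    intro i hi
    simp only [f, if_pos hi]
    exact (hmem _).1 (getD_mem' (by omega))
  have hfout : ∀ i, ¬ (1 ≤ i ∧ i ≤ N) → f i = i := fun i hi => by simp only [f, if_neg hi]
  have hbij : Function.Bijective f := by
    constructor
    · intro i j hij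
      by_cases hi : 1 ≤ i ∧ i ≤ N
      · by_cases hj : 1 ≤ j ∧ j ≤ N
        · simp only [f, if_pos hi, if_pos hj] at hij
          rw [List.getD_eq_getElem _ _ (by omega), List.getD_eq_getElem _ _ (by omega)] at hij
          have := (List.Nodup.getElem_inj_iff hnd).1 hij
          omega
        · have := hfin i hi
          rw [hij, hfout j hj] at this
          exact absurd this hj
      · by_cases hj : 1 ≤ j ∧ j ≤ N
        · have := hfin j hj
          rw [← hij, hfout i hi] at this
          exact absurd this hi
        · rwa [hfout i hi, hfout j hj] at hij
    · intro x
      by_cases hx : 1 ≤ x ∧ x ≤ N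
      · obtain ⟨i, hi, rfl⟩ := List.mem_iff_getElem.1 ((hmem x).2 hx)
        refine ⟨i + 1, ?_⟩
        simp only [f, if_pos (show 1 ≤ i + 1 ∧ i + 1 ≤ N by omega), Nat.add_sub_cancel]
        exact List.getD_eq_getElem _ _ hi
      · exact ⟨x, hfout x hx⟩
  refine ⟨Equiv.ofBijective f hbij, ?_, ?_⟩
  · intro i hi
    exact hfout i (by omega)
  · apply List.ext_getElem
    · simp [oneLine, hlen]
    · intro i h1 h2
      simp only [oneLine, List.getElem_map, List.getElem_range, Equiv.ofBijective_apply, f]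
      rw [if_pos (by omega), Nat.add_sub_cancel]
      exact List.getD_eq_getElem _ _ h2

theorem nodup_of_inj {t : List (List ℕ)} (h : ∀ a b : ℕ × ℕ, a.2 < rl t a.1 → b.2 < rl t b.1 →
    listEntry t a = listEntry t b → a = b) : t.flatten.Nodup := by
  induction t with
  | nil => simp
  | cons r rs ih =>
    rw [List.flatten_cons, List.nodup_append]
    refine ⟨?_, ?_, ?_⟩
    · rw [List.nodup_iff_injective_getElem]
      intro i j hij
      have := h (0, i) (0, j) (by rw [rl_cons_zero]; exact i.2) (by rw [rl_cons_zero]; exact j.2) (by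
        rw [listEntry_cons_zero, listEntry_cons_zero, List.getD_eq_getElem _ _ i.2,
          List.getD_eq_getElem _ _ j.2]; exact hij)
      exact Fin.ext (congrArg Prod.snd this)
    · apply ih
      rintro ⟨k, c⟩ ⟨k', c'⟩ ha hb hab
      have := h (k + 1, c) (k' + 1, c') (by rw [rl_cons_succ]; exact ha)
        (by rw [rl_cons_succ]; exact hb) (by rw [listEntry_cons_succ, listEntry_cons_succ, hab])
      simpa using this
    · intro x hx y hy hxy
      obtain ⟨i, hi, rfl⟩ := List.mem_iff_getElem.1 hx
      obtain ⟨⟨k, c⟩, h1, h2⟩ := exists_listEntry hy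
      have := h (0, i) (k + 1, c) (by rw [rl_cons_zero]; exact hi)
        (by rw [rl_cons_succ]; exact h1) (by
          rw [listEntry_cons_succ, listEntry_cons_zero, h2, List.getD_eq_getElem _ _ hi, hxy])
      simp at this

/-- Second half of Robinson–Schensted. -/
theorem RS_backward {N : ℕ} {P Q : Tab} {μ : YoungDiagram} (hP : Std N P) (hQ : Std N Q)
    (hPs : ∀ a, P a ≠ 0 ↔ a ∈ μ.cells) (hQs : ∀ a, Q a ≠ 0 ↔ a ∈ μ.cells) :
    ∃ w, SuppIn N w ∧ Ptab N w = P ∧ Qtab N w = Q := by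
  obtain ⟨t, hv, ht, hts⟩ := exists_list hP hPs
  have hnd : t.flatten.Nodup := by
    apply nodup_of_inj
    intro a b ha hb hab
    rw [ht, ht] at hab
    exact hP.inj a b hab ((hts a).1 ha)
  have hperm : t.flatten.Perm ((List.range N).map (· + 1)) := by
    rw [List.perm_ext_iff_of_nodup hnd (List.nodup_range.map (fun a b h => by simpa using h))]
    intro x
    simp only [List.mem_map, List.mem_range]
    constructor
    · intro hx
      obtain ⟨a, ha, rfl⟩ := exists_listEntry hx
      have h1 := (hts a).1 ha
      have h2 := hP.le a
      rw [ht]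
      exact ⟨P a - 1, by omega, by omega⟩
    · rintro ⟨i, hi, rfl⟩
      obtain ⟨a, ha⟩ := hP.surj (i + 1) (by omega) (by omega)
      rw [← ha, ← ht]
      exact listEntry_mem ((hts a).2 (by omega))
  obtain ⟨l, hl, hlt, hlm⟩ := RS_surj N t Q hv hnd hQ
    (fun c => (hts c).trans ((hPs c).trans (hQs c).symm))
  have hlp : l.Perm ((List.range N).map (· + 1)) := by
    refine List.Perm.trans ?_ hperm
    rw [← hlt]
    exact (flatten_tm l).symm
  obtain ⟨w, hw, hwl⟩ := exists_perm_of_word hlp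
  refine ⟨w, hw, ?_, ?_⟩
  · funext c
    rw [Ptab, ← ht, ← hlt, ← hwl, PtabListPart,
      List.take_of_length_le (show (oneLine N w).length ≤ N by simp [oneLine])]
    rfl
  · exact Qtab_eq hw hQ (by rw [hwl]; exact hlm)


/-! ### Straightening -/

section Straight

variable {N : ℕ} {M : Type*} [AddCommGroup M] [Module ℚ M]

/-- Row sums. -/
def fRow (m : (Fin N → ℕ × ℕ) → M) (b : Fin N → ℕ × ℕ) : M :=
  ∑ τ : Equiv.Perm (Fin N), if ∀ i, (b (τ i)).1 = (b i).1 then m (b ∘ τ) else 0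

/-- Column-antisymmetrized row sums. -/
def EE (m : (Fin N → ℕ × ℕ) → M) (b : Fin N → ℕ × ℕ) : M :=
  ∑ σ : Equiv.Perm (Fin N),
    if ∀ i, (b (σ i)).2 = (b i).2 then (Equiv.Perm.sign σ : ℤ) • fRow m (b ∘ σ) else 0

theorem fRow_comp (m : (Fin N → ℕ × ℕ) → M) (b : Fin N → ℕ × ℕ) (t : Equiv.Perm (Fin N))
    (ht : ∀ i, (b (t i)).1 = (b i).1) : fRow m (b ∘ t) = fRow m b := by
  unfold fRow
  refine Fintype.sum_equiv (Equiv.mulLeft t) _ _ ?_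
  intro τ
  have : (∀ i, ((b ∘ t) (τ i)).1 = ((b ∘ t) i).1) ↔ ∀ i, (b ((Equiv.mulLeft t) τ i)).1 = (b i).1 := by
    simp only [Function.comp, Equiv.coe_mulLeft, Equiv.Perm.mul_apply, ht]
  simp only [this]
  rfl

theorem EE_comp (m : (Fin N → ℕ × ℕ) → M) (b : Fin N → ℕ × ℕ) (p : Equiv.Perm (Fin N)) :
    EE m (b ∘ p) = ∑ σ : Equiv.Perm (Fin N),
      if ∀ i, (b (σ i)).2 = (b i).2 then (Equiv.Perm.sign σ : ℤ) • fRow m (b ∘ (σ * p : Equiv.Perm (Fin N))) else 0 := by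
  unfold EE
  refine Fintype.sum_equiv (MulAut.conj p).toEquiv _ _ ?_
  intro σ
  have h1 : (∀ i, ((b ∘ p) (σ i)).2 = ((b ∘ p) i).2) ↔
      ∀ i, (b ((MulAut.conj p).toEquiv σ i)).2 = (b i).2 := by
    simp only [Function.comp, MulEquiv.toEquiv_eq_coe, MulEquiv.coe_toEquiv, MulAut.conj_apply,
      Equiv.Perm.mul_apply]
    constructor
    · intro h i
      have := h (p⁻¹ i)
      simpa using this
    · intro h i
      have := h (p i)
      simpa using this
  have h2 : Equiv.Perm.sign ((MulAut.conj p).toEquiv σ) = Equiv.Perm.sign σ := by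
    simp [MulAut.conj_apply, mul_right_comm]
  have h3 : (b ∘ p) ∘ σ = b ∘ ((MulAut.conj p).toEquiv σ * p : Equiv.Perm (Fin N)) := by
    funext i
    simp [MulAut.conj_apply]
  simp only [h1, h2, h3]

theorem EE_col (m : (Fin N → ℕ × ℕ) → M) (b : Fin N → ℕ × ℕ) (p : Equiv.Perm (Fin N))
    (hp : ∀ i, (b (p i)).2 = (b i).2) :
    EE m (b ∘ p) = (Equiv.Perm.sign p : ℤ) • EE m b := by
  rw [EE_comp, EE, Finset.smul_sum]
  refine Fintype.sum_equiv (Equiv.mulRight p) _ _ ?_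
  intro σ
  have hp' : ∀ i, (b (p⁻¹ i)).2 = (b i).2 := by
    intro i
    have := hp (p⁻¹ i)
    simpa using this.symm
  have h1 : (∀ i, (b (σ i)).2 = (b i).2) ↔ ∀ i, (b (Equiv.mulRight p σ i)).2 = (b i).2 := by
    simp only [Equiv.coe_mulRight, Equiv.Perm.mul_apply]
    constructor
    · intro h i; rw [h, hp]
    · intro h i
      have := h (p⁻¹ i)
      rw [hp'] at this
      simpa using this
  simp only [h1]
  split_ifs
  · rw [Equiv.coe_mulRight, Equiv.Perm.sign_mul, smul_smul]
    congr 1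
    push_cast
    rcases Int.units_eq_one_or (Equiv.Perm.sign p) with h | h <;> simp [h]
  · simp

theorem sum_sign_zero (m : (Fin N → ℕ × ℕ) → M) (c : Fin N → ℕ × ℕ) (X : Fin N → Prop)
    {x y : Fin N} (hx : X x) (hy : X y) (hxy : x ≠ y) (hr : (c x).1 = (c y).1) :
    ∑ p : Equiv.Perm (Fin N), (if ∀ i, ¬ X i → p i = i then
      (Equiv.Perm.sign p : ℤ) • fRow m (c ∘ p) else 0) = 0 := by
  refine Finset.sum_involution (fun p _ => Equiv.swap x y * p) ?_ ?_ ?_ ?_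
  · intro p _
    have h1 : (∀ i, ¬ X i → (Equiv.swap x y * p) i = i) ↔ ∀ i, ¬ X i → p i = i := by
      have aux : ∀ i, ¬ X i → Equiv.swap x y i = i := by
        intro i hi
        apply Equiv.swap_apply_of_ne_of_ne
        · rintro rfl; exact hi hx
        · rintro rfl; exact hi hy
      constructor
      · intro h i hi
        have := h i hi
        rw [Equiv.Perm.mul_apply] at this
        have h2 := congrArg (Equiv.swap x y) this
        rw [Equiv.swap_apply_self, aux i hi] at h2
        exact h2
      · intro h i hi
        rw [Equiv.Perm.mul_apply, h i hi, aux i hi]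
    have h2 : fRow m (c ∘ (Equiv.swap x y * p : Equiv.Perm (Fin N))) = fRow m (c ∘ p) := by
      have e : c ∘ (Equiv.swap x y * p : Equiv.Perm (Fin N)) =
          (c ∘ p) ∘ (p⁻¹ * Equiv.swap x y * p : Equiv.Perm (Fin N)) := by
        funext i; simp
      rw [e]
      apply fRow_comp
      intro i
      have aux : ∀ i, (c (Equiv.swap x y i)).1 = (c i).1 := by
        intro i
        by_cases h : i = x
        · subst h; rw [Equiv.swap_apply_left, hr]
        · by_cases h' : i = y
          · subst h'; rw [Equiv.swap_apply_right, hr]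
          · rw [Equiv.swap_apply_of_ne_of_ne h h']
      simp [aux]
    simp only [h1, h2]
    split_ifs
    · rw [Equiv.Perm.sign_mul, Equiv.Perm.sign_swap hxy]
      simp
    · simp
  · intro p _ _ h
    have := congrArg (fun q => q (p⁻¹ x)) h
    simp at this
    exact hxy this.symm
  · intro p _; simp
  · intro p _; simp [← mul_assoc]

/-- The Garnir relation. -/
theorem garnir (m : (Fin N → ℕ × ℕ) → M) (b : Fin N → ℕ × ℕ) (X : Fin N → Prop)
    (hpig : ∀ σ : Equiv.Perm (Fin N), (∀ i, (b (σ i)).2 = (b i).2) →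
      ∃ x y, X x ∧ X y ∧ x ≠ y ∧ (b (σ x)).1 = (b (σ y)).1) :
    ∑ p : Equiv.Perm (Fin N), (if ∀ i, ¬ X i → p i = i then
      (Equiv.Perm.sign p : ℤ) • EE m (b ∘ p) else 0) = 0 := by
  have h1 : ∀ p : Equiv.Perm (Fin N), (if ∀ i, ¬ X i → p i = i then
      (Equiv.Perm.sign p : ℤ) • EE m (b ∘ p) else 0) =
      ∑ σ : Equiv.Perm (Fin N), if ∀ i, (b (σ i)).2 = (b i).2 then
        (Equiv.Perm.sign σ : ℤ) • (if ∀ i, ¬ X i → p i = i then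
          (Equiv.Perm.sign p : ℤ) • fRow m ((b ∘ σ) ∘ p) else 0) else 0 := by
    intro p
    rw [EE_comp]
    split_ifs with h
    · rw [Finset.smul_sum]
      refine Finset.sum_congr rfl fun σ _ => ?_
      split_ifs
      · rw [smul_comm]; rfl
      · simp
    · simp
  rw [Finset.sum_congr rfl fun p _ => h1 p, Finset.sum_comm]
  refine Finset.sum_eq_zero fun σ _ => ?_
  split_ifs with h
  · rw [← Finset.smul_sum]
    obtain ⟨x, y, hx, hy, hxy, hr⟩ := hpig σ h
    rw [sum_sign_zero m (b ∘ σ) X hx hy hxy hr, smul_zero]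
  · simp

theorem garnir_mem (m : (Fin N → ℕ × ℕ) → M) (b : Fin N → ℕ × ℕ) (X : Fin N → Prop)
    (hpig : ∀ σ : Equiv.Perm (Fin N), (∀ i, (b (σ i)).2 = (b i).2) →
      ∃ x y, X x ∧ X y ∧ x ≠ y ∧ (b (σ x)).1 = (b (σ y)).1) (W : Submodule ℚ M)
    (hW : ∀ p : Equiv.Perm (Fin N), (∀ i, ¬ X i → p i = i) → ¬ (∀ i, (b (p i)).2 = (b i).2) →
      EE m (b ∘ p) ∈ W) : EE m b ∈ W := by
  have hg := garnir m b X hpig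
  have hsplit : ∀ p : Equiv.Perm (Fin N), (if ∀ i, ¬ X i → p i = i then
      (Equiv.Perm.sign p : ℤ) • EE m (b ∘ p) else 0) =
      (if (∀ i, ¬ X i → p i = i) ∧ ∀ i, (b (p i)).2 = (b i).2 then EE m b else 0) +
      (if (∀ i, ¬ X i → p i = i) ∧ ¬ ∀ i, (b (p i)).2 = (b i).2 then
        (Equiv.Perm.sign p : ℤ) • EE m (b ∘ p) else 0) := by
    intro p
    by_cases h1 : ∀ i, ¬ X i → p i = i
    · by_cases h2 : ∀ i, (b (p i)).2 = (b i).2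
      · rw [if_pos h1, if_pos ⟨h1, h2⟩, if_neg (fun h => h.2 h2), EE_col m b p h2, smul_smul, add_zero]
        rcases Int.units_eq_one_or (Equiv.Perm.sign p) with h | h <;> simp [h]
      · rw [if_pos h1, if_neg (fun h => h2 h.2), if_pos ⟨h1, h2⟩, zero_add]
    · rw [if_neg h1, if_neg (fun h => h1 h.1), if_neg (fun h => h1 h.1), add_zero]
  rw [Finset.sum_congr rfl fun p _ => hsplit p, Finset.sum_add_distrib, ← Finset.sum_filter,
    Finset.sum_const] at hg
  set K := (Finset.univ.filter fun p : Equiv.Perm (Fin N) =>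
    (∀ i, ¬ X i → p i = i) ∧ ∀ i, (b (p i)).2 = (b i).2) with hK
  have hKpos : (K.card : ℚ) ≠ 0 := by
    rw [Nat.cast_ne_zero]
    apply Finset.card_ne_zero_of_mem (a := (1 : Equiv.Perm (Fin N)))
    simp [hK]
  have hmem : K.card • EE m b ∈ W := by
    rw [eq_neg_of_add_eq_zero_left hg]
    apply W.neg_mem
    apply W.sum_mem
    intro p _
    split_ifs with h
    · exact W.toAddSubgroup.zsmul_mem (hW p h.1 h.2) _
    · exact W.zero_mem
  have := W.smul_mem ((K.card : ℚ)⁻¹) hmem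
  rwa [← Nat.cast_smul_eq_nsmul ℚ, smul_smul, inv_mul_cancel₀ hKpos, one_smul] at this

end Straight


theorem vert_mem {N : ℕ} {M : Type*} [AddCommGroup M] [Module ℚ M] (m : (Fin N → ℕ × ℕ) → M)
    (b : Fin N → ℕ × ℕ) (W : Submodule ℚ M) {i j : Fin N} (hij : i ≠ j)
    (hc : (b i).2 = (b j).2) (h : EE m (b ∘ Equiv.swap i j) ∈ W) : EE m b ∈ W := by
  have hcol : ∀ k, (b (Equiv.swap i j k)).2 = (b k).2 := by
    intro k
    by_cases h1 : k = i
    · subst h1; rw [Equiv.swap_apply_left, hc]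
    · by_cases h2 : k = j
      · subst h2; rw [Equiv.swap_apply_right, hc]
      · rw [Equiv.swap_apply_of_ne_of_ne h1 h2]
  rw [EE_col m b _ hcol, Equiv.Perm.sign_swap hij] at h
  simpa using h

/-- Pigeonhole for the Garnir relation. -/
theorem garnir_pig {N : ℕ} (μ : YoungDiagram) (b : Fin N → ℕ × ℕ)
    (hr : ∀ c, c ∈ μ.cells ↔ ∃ i, b i = c) (r j : ℕ) (hrj : (r, j + 1) ∈ μ.cells)
    (σ : Equiv.Perm (Fin N)) (hσ : ∀ i, (b (σ i)).2 = (b i).2) :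
    ∃ x y, (((b x).2 = j ∧ r ≤ (b x).1) ∨ ((b x).2 = j + 1 ∧ (b x).1 ≤ r)) ∧
      (((b y).2 = j ∧ r ≤ (b y).1) ∨ ((b y).2 = j + 1 ∧ (b y).1 ≤ r)) ∧ x ≠ y ∧
      (b (σ x)).1 = (b (σ y)).1 := by
  set L := μ.colLen j with hL
  let cell : ℕ → ℕ × ℕ := fun k => if k ≤ r then (k, j + 1) else (k - 1, j)
  have hcell : ∀ k, k < L + 1 → cell k ∈ μ.cells := by
    intro k hk
    by_cases h : k ≤ r
    · simp only [cell, if_pos h]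
      exact μ.isLowerSet (show (k, j + 1) ≤ (r, j + 1) from ⟨h, le_refl _⟩) hrj
    · simp only [cell, if_neg h]
      rw [YoungDiagram.mem_cells, YoungDiagram.mem_iff_lt_colLen]
      omega
  have hex : ∀ k, ∃ i, k < L + 1 → b i = cell k := by
    intro k
    by_cases hk : k < L + 1
    · obtain ⟨i, hi⟩ := (hr _).1 (hcell k hk)
      exact ⟨i, fun _ => hi⟩
    · obtain ⟨i, hi⟩ := (hr _).1 hrj
      exact ⟨i, fun h => absurd h hk⟩
  choose x hx using hex
  have hxc : ∀ k, k < L + 1 → (b (x k)).2 = j ∧ r ≤ (b (x k)).1 ∨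
      (b (x k)).2 = j + 1 ∧ (b (x k)).1 ≤ r := by
    intro k hk
    rw [hx k hk]
    by_cases h : k ≤ r
    · right; simp [cell, h]
    · left; simp [cell, h]; omega
  have hmaps : ∀ k ∈ Finset.range (L + 1), (b (σ (x k))).1 ∈ Finset.range L := by
    intro k hk
    rw [Finset.mem_range] at hk ⊢
    have h1 : b (σ (x k)) ∈ μ.cells := (hr _).2 ⟨_, rfl⟩
    have h2 := hσ (x k)
    have h3 : ((b (σ (x k))).1, j) ∈ μ.cells := by
      refine μ.isLowerSet ?_ h1
      refine ⟨le_refl _, ?_⟩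
      change j ≤ (b (σ (x k))).2
      rcases hxc k hk with h | h <;> omega
    rwa [YoungDiagram.mem_cells, YoungDiagram.mem_iff_lt_colLen] at h3
  obtain ⟨k, hk, k', hk', hne, he⟩ :=
    Finset.exists_ne_map_eq_of_card_lt_of_maps_to (by simp) hmaps
  rw [Finset.mem_range] at hk hk'
  refine ⟨x k, x k', hxc k hk, hxc k' hk', ?_, he⟩
  intro h
  have h1 := hx k hk
  rw [h, hx k' hk'] at h1
  simp only [cell] at h1
  split_ifs at h1 <;> simp only [Prod.mk.injEq] at h1 <;> omega

theorem garnir_measure {N : ℕ} (b : Fin N → ℕ × ℕ) (r j : ℕ) (t : Fin N)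
    (hA : ∀ i, (b i).2 = j → r ≤ (b i).1 → t < i)
    (hB : ∀ i, (b i).2 = j + 1 → (b i).1 ≤ r → i ≤ t)
    (p : Equiv.Perm (Fin N))
    (hp : ∀ i, ¬ (((b i).2 = j ∧ r ≤ (b i).1) ∨ ((b i).2 = j + 1 ∧ (b i).1 ≤ r)) → p i = i)
    (hn : ¬ ∀ i, (b (p i)).2 = (b i).2) :
    ∑ i : Fin N, (i : ℤ) * ((b i).2 : ℤ) < ∑ i : Fin N, (i : ℤ) * ((b (p i)).2 : ℤ) := by
  have hstab : ∀ i, (((b i).2 = j ∧ r ≤ (b i).1) ∨ ((b i).2 = j + 1 ∧ (b i).1 ≤ r)) →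
      (b (p i)).2 = j ∨ (b (p i)).2 = j + 1 := by
    intro i hi
    by_contra hc
    have h1 := hp (p i) (by tauto)
    have h2 := p.injective h1
    rw [h2] at hc
    tauto
  have hsum : ∑ i : Fin N, ((b (p i)).2 : ℤ) = ∑ i : Fin N, ((b i).2 : ℤ) :=
    Equiv.sum_comp p fun i => ((b i).2 : ℤ)
  have hpos : 0 < ∑ i : Fin N, (2 * (i : ℤ) - 2 * (t : ℤ) - 1) * ((b (p i)).2 - (b i).2 : ℤ) := by
    apply Finset.sum_pos'
    · intro i _
      by_cases hX : ((b i).2 = j ∧ r ≤ (b i).1) ∨ ((b i).2 = j + 1 ∧ (b i).1 ≤ r)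
      · have hs := hstab i hX
        rcases hX with h | h
        · have := hA i h.1 h.2
          apply mul_nonneg <;> omega
        · have := hB i h.1 h.2
          apply mul_nonneg_of_nonpos_of_nonpos <;> omega
      · rw [hp i hX]; simp
    · push Not at hn
      obtain ⟨i, hi⟩ := hn
      refine ⟨i, Finset.mem_univ _, ?_⟩
      by_cases hX : ((b i).2 = j ∧ r ≤ (b i).1) ∨ ((b i).2 = j + 1 ∧ (b i).1 ≤ r)
      · have hs := hstab i hX
        rcases hX with h | h
        · have := hA i h.1 h.2
          apply mul_pos <;> omega
        · have := hB i h.1 h.2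
          apply mul_pos_of_neg_of_neg <;> omega
      · rw [hp i hX] at hi; exact absurd rfl hi
  have hexp : ∑ i : Fin N, (2 * (i : ℤ) - 2 * (t : ℤ) - 1) * ((b (p i)).2 - (b i).2 : ℤ) =
      2 * (∑ i : Fin N, (i : ℤ) * ((b (p i)).2 : ℤ)) - 2 * (∑ i : Fin N, (i : ℤ) * ((b i).2 : ℤ))
      - (2 * (t : ℤ) + 1) * ((∑ i : Fin N, ((b (p i)).2 : ℤ)) - ∑ i : Fin N, ((b i).2 : ℤ)) := by
    simp only [Finset.mul_sum, ← Finset.sum_sub_distrib]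
    refine Finset.sum_congr rfl fun i _ => ?_
    ring
  rw [hexp, hsum] at hpos
  linarith

theorem straighten {N : ℕ} {M : Type*} [AddCommGroup M] [Module ℚ M] (m : (Fin N → ℕ × ℕ) → M)
    (μ : YoungDiagram) (b₀ : Fin N → ℕ × ℕ) (hinj₀ : Function.Injective b₀)
    (hr₀ : ∀ c, c ∈ μ.cells ↔ ∃ i, b₀ i = c) (W : Submodule ℚ M)
    (hstd : ∀ b : Fin N → ℕ × ℕ, Function.Injective b → (∀ c, c ∈ μ.cells ↔ ∃ i, b i = c) →
      (∀ i j, b i ≤ b j → b i ≠ b j → i < j) → EE m b ∈ W) : EE m b₀ ∈ W := by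
  by_contra hbad
  let f : Equiv.Perm (Fin N) → ℤ ×ₗ ℤ := fun p =>
    toLex (∑ i : Fin N, (i : ℤ) * ((b₀ (p i)).2 : ℤ), ∑ i : Fin N, (i : ℤ) * ((b₀ (p i)).1 : ℤ))
  obtain ⟨p, hp, hmax⟩ := Finset.exists_max_image
    (Finset.univ.filter fun p : Equiv.Perm (Fin N) => EE m (b₀ ∘ p) ∉ W) f
    ⟨1, by simpa using hbad⟩
  rw [Finset.mem_filter] at hp
  have hgood : ∀ q : Equiv.Perm (Fin N), f p < f (p * q) → EE m ((b₀ ∘ p) ∘ q) ∈ W := by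
    intro q hq
    by_contra hc
    exact absurd (hmax (p * q) (by rw [Finset.mem_filter]; exact ⟨Finset.mem_univ _, hc⟩))
      (not_le.2 hq)
  set b := b₀ ∘ p with hb
  have hinj : Function.Injective b := hinj₀.comp p.injective
  have hr : ∀ c, c ∈ μ.cells ↔ ∃ i, b i = c := by
    intro c
    rw [hr₀]
    constructor
    · rintro ⟨i, rfl⟩; exact ⟨p⁻¹ i, by simp [hb]⟩
    · rintro ⟨i, rfl⟩; exact ⟨p i, rfl⟩
  apply hp.2
  -- vertical inversions
  by_cases hV : ∃ i j : Fin N, (b j).1 = (b i).1 + 1 ∧ (b i).2 = (b j).2 ∧ j < i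
  · obtain ⟨i, j, h1, h2, h3⟩ := hV
    have hij : i ≠ j := h3.ne'
    apply vert_mem m b W hij h2
    apply hgood
    rw [Prod.Lex.toLex_lt_toLex]
    right
    have hcol : ∀ k, (b₀ ((p * Equiv.swap i j) k)).2 = (b₀ (p k)).2 := by
      intro k
      change (b (Equiv.swap i j k)).2 = (b k).2
      by_cases h1 : k = i
      · subst h1; rw [Equiv.swap_apply_left, h2]
      · by_cases h2' : k = j
        · subst h2'; rw [Equiv.swap_apply_right, h2]
        · rw [Equiv.swap_apply_of_ne_of_ne h1 h2']
    refine ⟨by simp only [hcol], ?_⟩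
    change ∑ k : Fin N, (k : ℤ) * ((b k).1 : ℤ) <
      ∑ k : Fin N, (k : ℤ) * ((b (Equiv.swap i j k)).1 : ℤ)
    rw [← sub_pos, ← Finset.sum_sub_distrib]
    rw [← Finset.sum_subset (Finset.subset_univ {i, j}), Finset.sum_pair hij]
    · rw [Equiv.swap_apply_left, Equiv.swap_apply_right, h1]
      have : (j : ℤ) < (i : ℤ) := by exact_mod_cast h3
      push_cast
      nlinarith
    · intro k _ hk
      simp only [Finset.mem_insert, Finset.mem_singleton, not_or] at hk
      rw [Equiv.swap_apply_of_ne_of_ne hk.1 hk.2, sub_self]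
  · push Not at hV
    have hcolinc : ∀ d : ℕ, ∀ i j : Fin N, (b i).2 = (b j).2 → (b j).1 = (b i).1 + d → i ≤ j := by
      intro d
      induction d with
      | zero =>
        intro i j h1 h2
        exact (hinj (Prod.ext h2.symm h1)).le
      | succ d ih =>
        intro i j h1 h2
        obtain ⟨k, hk⟩ := (hr ((b i).1 + d, (b i).2)).1
          (μ.isLowerSet (show ((b i).1 + d, (b i).2) ≤ b j from ⟨by change (b i).1 + d ≤ (b j).1; omega, by change (b i).2 ≤ (b j).2; omega⟩)
            ((hr _).2 ⟨j, rfl⟩))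
        have h3 := ih i k (by rw [hk]) (by rw [hk])
        have h4 := hV k j (by rw [hk, h2]; rfl) (by rw [hk, ← h1])
        exact h3.trans h4
    have hcolinc' : ∀ i j : Fin N, (b i).2 = (b j).2 → (b i).1 ≤ (b j).1 → i ≤ j := by
      intro i j h1 h2
      exact hcolinc ((b j).1 - (b i).1) i j h1 (by omega)
    by_cases hH : ∃ i j : Fin N, (b j).2 = (b i).2 + 1 ∧ (b i).1 = (b j).1 ∧ j < i
    · obtain ⟨i, j, h1, h2, h3⟩ := hH
      apply garnir_mem m b (fun x => ((b x).2 = (b i).2 ∧ (b i).1 ≤ (b x).1) ∨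
        ((b x).2 = (b i).2 + 1 ∧ (b x).1 ≤ (b i).1)) _ W
      · intro q hq1 hq2
        apply hgood
        rw [Prod.Lex.toLex_lt_toLex]
        left
        refine garnir_measure b (b i).1 (b i).2 j ?_ ?_ q hq1 hq2
        · intro k hk1 hk2
          exact h3.trans_le (hcolinc' i k hk1.symm hk2)
        · intro k hk1 hk2
          exact hcolinc' k j (by omega) (by omega)
      · intro σ hσ
        refine garnir_pig μ b hr (b i).1 (b i).2 ?_ σ hσ
        rw [h2, ← h1]
        exact (hr _).2 ⟨j, rfl⟩
    · push Not at hH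
      have hrowinc : ∀ d : ℕ, ∀ i j : Fin N, (b i).1 = (b j).1 → (b j).2 = (b i).2 + d → i ≤ j := by
        intro d
        induction d with
        | zero =>
          intro i j h1 h2
          exact (hinj (Prod.ext h1 h2.symm)).le
        | succ d ih =>
          intro i j h1 h2
          obtain ⟨k, hk⟩ := (hr ((b i).1, (b i).2 + d)).1
            (μ.isLowerSet (show ((b i).1, (b i).2 + d) ≤ b j from ⟨by change (b i).1 ≤ (b j).1; omega, by change (b i).2 + d ≤ (b j).2; omega⟩)
              ((hr _).2 ⟨j, rfl⟩))
          have h3 := ih i k (by rw [hk]) (by rw [hk])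
          have h4 := hH k j (by rw [hk, h2]; rfl) (by rw [hk, ← h1])
          exact h3.trans h4
      apply hstd b hinj hr
      intro i j hle hne
      have h1 : (b i).1 ≤ (b j).1 := hle.1
      have h2 : (b i).2 ≤ (b j).2 := hle.2
      obtain ⟨k, hk⟩ := (hr ((b i).1, (b j).2)).1
          (μ.isLowerSet (show ((b i).1, (b j).2) ≤ b j from ⟨h1, le_refl _⟩) ((hr _).2 ⟨j, rfl⟩))
      have h3 := hrowinc ((b j).2 - (b i).2) i k (by rw [hk]) (by rw [hk]; change (b j).2 = _; omega)
      have h4 := hcolinc' k j (by rw [hk]) (by rw [hk]; exact h1)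
      exact lt_of_le_of_ne (h3.trans h4) (fun h => hne (by rw [h]))


/-! ### Comparing the Young symmetrizer with the formal version -/

theorem fRow_comp_conj {N : ℕ} {M : Type*} [AddCommGroup M] [Module ℚ M]
    (m : (Fin N → ℕ × ℕ) → M) (b : Fin N → ℕ × ℕ) (p : Equiv.Perm (Fin N)) :
    fRow m (b ∘ p) = ∑ τ : Equiv.Perm (Fin N),
      if ∀ i, (b (τ i)).1 = (b i).1 then m (b ∘ (τ * p : Equiv.Perm (Fin N))) else 0 := by
  unfold fRow
  refine Fintype.sum_equiv (MulAut.conj p).toEquiv _ _ ?_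
  intro σ
  have h1 : (∀ i, ((b ∘ p) (σ i)).1 = ((b ∘ p) i).1) ↔
      ∀ i, (b ((MulAut.conj p).toEquiv σ i)).1 = (b i).1 := by
    simp only [Function.comp, MulEquiv.toEquiv_eq_coe, MulEquiv.coe_toEquiv, MulAut.conj_apply,
      Equiv.Perm.mul_apply]
    constructor
    · intro h i
      have := h (p⁻¹ i)
      simpa using this
    · intro h i
      have := h (p i)
      simpa using this
  have h3 : (b ∘ p) ∘ σ = b ∘ ((MulAut.conj p).toEquiv σ * p : Equiv.Perm (Fin N)) := by
    funext i
    simp [MulAut.conj_apply]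
  simp only [h1, h3]

theorem embedPerm_apply (N : ℕ) (σ : Equiv.Perm (Fin N)) (i : Fin N) :
    embedPerm N σ ((i : ℕ) + 1) = (σ i : ℕ) + 1 := by
  have := Equiv.Perm.extendDomain_apply_image σ (finShift N) i
  exact this

theorem prod_Icc_fin {M : Type*} [CommMonoid M] (N : ℕ) (f : ℕ → M) :
    ∏ i ∈ Finset.Icc 1 N, f i = ∏ i : Fin N, f ((i : ℕ) + 1) := by
  rw [Fin.prod_univ_eq_prod_range (fun i => f (i + 1)) N]
  induction N with
  | zero => simp
  | succ k ih =>
    rw [Finset.prod_Icc_succ_top (by omega), Finset.prod_range_succ, ih]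

theorem forall_Icc_fin (N : ℕ) (p : ℕ → Prop) :
    (∀ i ∈ Finset.Icc 1 N, p i) ↔ ∀ i : Fin N, p ((i : ℕ) + 1) := by
  constructor
  · intro h i
    exact h _ (by simp)
  · intro h i hi
    rw [Finset.mem_Icc] at hi
    have := h ⟨i - 1, by omega⟩
    simpa [Nat.sub_add_cancel hi.1] using this

/-- The monomial attached to a placement of the indices in boxes. -/
def monB (N : ℕ) (g : ℕ × ℕ → ℕ) (b : Fin N → ℕ × ℕ) : MvPolynomial ℕ ℚ :=
  ∏ i : Fin N, X ((i : ℕ) + 1) ^ g (b i)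

theorem rename_monB (N : ℕ) (g : ℕ × ℕ → ℕ) (b : Fin N → ℕ × ℕ) (σ τ : Equiv.Perm (Fin N)) :
    rename (⇑(embedPerm N σ * embedPerm N τ)) (monB N g b) =
      monB N g (b ∘ (τ⁻¹ * σ⁻¹ : Equiv.Perm (Fin N))) := by
  unfold monB
  rw [map_prod]
  refine Fintype.prod_equiv (σ * τ) _ _ ?_
  intro i
  simp [embedPerm_apply]

theorem pTS_eq (N : ℕ) (T S : Tab) :
    pTS N T S = monB N (ctEntry S (DsiSet N S)) (fun i => posOf T ((i : ℕ) + 1)) := by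
  unfold pTS monB
  rw [prod_Icc_fin]

theorem epsAct_eq (N : ℕ) (T : Tab) (g : ℕ × ℕ → ℕ) :
    epsAct N T (monB N g (fun i => posOf T ((i : ℕ) + 1))) =
      EE (monB N g) (fun i => posOf T ((i : ℕ) + 1)) := by
  set b : Fin N → ℕ × ℕ := fun i => posOf T ((i : ℕ) + 1) with hb
  have hr : ∀ τ : Equiv.Perm (Fin N),
      (∀ i ∈ Finset.Icc 1 N, rowIdx T (embedPerm N τ i) = rowIdx T i) ↔
        ∀ i, (b (τ i)).1 = (b i).1 := by
    intro τ
    rw [forall_Icc_fin N (fun i => rowIdx T (embedPerm N τ i) = rowIdx T i)]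
    simp only [embedPerm_apply]
    rfl
  have hc : ∀ τ : Equiv.Perm (Fin N),
      (∀ i ∈ Finset.Icc 1 N, colIdx T (embedPerm N τ i) = colIdx T i) ↔
        ∀ i, (b (τ i)).2 = (b i).2 := by
    intro τ
    rw [forall_Icc_fin N (fun i => colIdx T (embedPerm N τ i) = colIdx T i)]
    simp only [embedPerm_apply]
    rfl
  have inv1 : ∀ τ : Equiv.Perm (Fin N),
      (∀ i, (b (τ i)).1 = (b i).1) ↔ (∀ i, (b (τ⁻¹ i)).1 = (b i).1) := by
    intro τ
    constructor
    · intro h i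
      have := h (τ⁻¹ i)
      simpa using this.symm
    · intro h i
      have := h (τ i)
      simpa using this.symm
  have inv2 : ∀ τ : Equiv.Perm (Fin N),
      (∀ i, (b (τ i)).2 = (b i).2) ↔ (∀ i, (b (τ⁻¹ i)).2 = (b i).2) := by
    intro τ
    constructor
    · intro h i
      have := h (τ⁻¹ i)
      simpa using this.symm
    · intro h i
      have := h (τ i)
      simpa using this.symm
  unfold epsAct colFinset rowFinset EE
  simp only [hr, hc]
  rw [Finset.sum_filter]
  refine Fintype.sum_equiv (Equiv.inv _) _ _ ?_
  intro σ
  rw [Equiv.inv_apply]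
  by_cases h : ∀ i, (b (σ i)).2 = (b i).2
  · rw [if_pos h, if_pos ((inv2 σ).1 h), Equiv.Perm.sign_inv, fRow_comp_conj, Finset.smul_sum,
      Finset.sum_filter]
    refine Fintype.sum_equiv (Equiv.inv _) _ _ ?_
    intro τ
    rw [Equiv.inv_apply]
    by_cases h' : ∀ i, (b (τ i)).1 = (b i).1
    · rw [if_pos h', if_pos ((inv1 τ).1 h'), rename_monB]
    · rw [if_neg h', if_neg (fun h2 => h' ((inv1 τ).2 h2)), smul_zero]
  · rw [if_neg h, if_neg (fun h2 => h ((inv2 σ).2 h2))]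

theorem sTS_ne (N : ℕ) (T S : Tab) : (sTS N T S : ℚ) ≠ 0 := by
  have h1 : embedPerm N 1 = 1 := by
    unfold embedPerm
    exact Equiv.Perm.extendDomain_one _
  have : 0 < sTS N T S := by
    unfold sTS
    rw [Finset.card_pos]
    refine ⟨1, ?_⟩
    simp [rowFinset, h1]
  exact_mod_cast this.ne'

theorem FTS_eq (N : ℕ) (T S : Tab) :
    FTS N T S = (sTS N T S : ℚ)⁻¹ •
      EE (monB N (ctEntry S (DsiSet N S))) (fun i => posOf T ((i : ℕ) + 1)) := by
  rw [FTS, pTS_eq, epsAct_eq]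

/-- The space `V^S` is spanned by the polynomials of the standard tableaux. -/
theorem VS_le (N : ℕ) (μ : YoungDiagram) (hμ : μ.cells.card = N) (S : Tab)
    (W : Submodule ℚ (MvPolynomial ℕ ℚ))
    (hW : ∀ T, Std N T → (∀ a, T a ≠ 0 ↔ a ∈ μ.cells) → FTS N T S ∈ W) :
    VS N μ.cells S ≤ W := by
  rw [VS, Submodule.span_le]
  rintro p ⟨T, ⟨hT0, hT⟩, rfl⟩
  rw [hμ] at hT
  rw [SetLike.mem_coe, FTS_eq]
  apply W.smul_mem
  have hinjT : ∀ a b, T a = T b → T a ≠ 0 → a = b := by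
    intro a b hab ha
    have ha' : a ∈ μ.cells := by
      by_contra hh
      exact ha (hT0 a hh)
    have hb' : b ∈ μ.cells := by
      by_contra hh
      exact ha (hab.trans (hT0 b hh))
    exact hT.injOn ha' hb' hab
  have hcell : ∀ i : Fin N, ∃ c ∈ μ.cells, T c = (i : ℕ) + 1 ∧ posOf T ((i : ℕ) + 1) = c := by
    intro i
    obtain ⟨c, hc, hci⟩ := hT.surjOn (show (i : ℕ) + 1 ∈ Set.Icc 1 N by simp)
    refine ⟨c, hc, hci, ?_⟩
    have := posOf_eq (T := T) (a := c) hinjT (by rw [hci]; omega)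
    rwa [hci] at this
  apply straighten _ μ
  · intro i j hij
    obtain ⟨c, hc, h1, h2⟩ := hcell i
    obtain ⟨d, hd, h3, h4⟩ := hcell j
    simp only [h2, h4] at hij
    subst hij
    apply Fin.ext
    omega
  · intro c
    constructor
    · intro hc
      have h1 := hT.mapsTo hc
      rw [Set.mem_Icc] at h1
      refine ⟨⟨T c - 1, by omega⟩, ?_⟩
      have h2 : T c - 1 + 1 = T c := by omega
      simp only [h2]
      exact posOf_eq hinjT (by omega)
    · rintro ⟨i, rfl⟩
      obtain ⟨c, hc, h1, h2⟩ := hcell i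
      simp only [h2]
      exact hc
  · intro b hb hbr hbs
    let U : Tab := fun c => if h : ∃ i, b i = c then (h.choose : ℕ) + 1 else 0
    have hU : ∀ i, U (b i) = (i : ℕ) + 1 := by
      intro i
      have h : ∃ j, b j = b i := ⟨i, rfl⟩
      have h2 := hb h.choose_spec
      simp only [U, dif_pos h]
      rw [h2]
    have hU0 : ∀ c, U c ≠ 0 ↔ c ∈ μ.cells := by
      intro c
      rw [hbr]
      constructor
      · intro h
        by_contra hh
        exact h (dif_neg hh)
      · rintro ⟨i, rfl⟩
        rw [hU]; omega
    have hex : ∀ c, U c ≠ 0 → ∃ i, b i = c := fun c hc => (hbr c).1 ((hU0 c).1 hc)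
    have hstd : Std N U := by
      refine ⟨?_, ?_, ?_, ?_⟩
      · intro a c hac hne hc
        have hcm := (hU0 c).1 hc
        have ham : a ∈ μ.cells := μ.isLowerSet hac hcm
        obtain ⟨i, rfl⟩ := (hbr a).1 ham
        obtain ⟨j, rfl⟩ := (hbr c).1 hcm
        refine ⟨(hU0 _).2 ham, ?_⟩
        rw [hU, hU]
        have := hbs i j hac hne
        have : (i : ℕ) < j := this
        omega
      · intro a c hac ha
        obtain ⟨i, rfl⟩ := hex a ha
        obtain ⟨j, rfl⟩ := hex c (hac ▸ ha)
        rw [hU, hU] at hac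
        have : i = j := Fin.ext (by omega)
        rw [this]
      · intro a
        by_cases ha : U a = 0
        · omega
        · obtain ⟨i, rfl⟩ := hex a ha
          rw [hU]; omega
      · intro k hk hkN
        exact ⟨b ⟨k - 1, by omega⟩, by rw [hU]; simp; omega⟩
    have hpos : (fun i : Fin N => posOf U ((i : ℕ) + 1)) = b := by
      funext i
      rw [← hU]
      exact posOf_eq hstd.inj (by rw [hU]; omega)
    have h1 := hW U hstd hU0
    rw [FTS_eq, hpos] at h1
    have h2 := W.smul_mem (sTS N U S : ℚ) h1
    rwa [smul_smul, mul_inv_cancel₀ (sTS_ne N U S), one_smul] at h2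


/-! ### Assembly -/

theorem DsiSet_subset (n : ℕ) (T : Tab) : DsiSet n T ⊆ Finset.Ioo 0 n := Finset.filter_subset _ _

theorem Dsi_add_same {m : ℕ} {Q : Tab} (h : Std m Q) {v : ℕ × ℕ} (hv : Q v = 0)
    (hlow : ∀ a, a ≤ v → a ≠ v → Q a ≠ 0) (hd : ¬ rowIdx Q m < v.1) :
    DsiSet (m + 1) (Function.update Q v (m + 1)) = DsiSet m Q := by
  ext i
  by_cases hi : i < m
  · exact Dsi_add_lt h hv hlow hi
  · have h1 : i ∉ DsiSet m Q := fun h' => hi (Finset.mem_Ioo.1 (DsiSet_subset _ _ h')).2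
    have h2 : i ∉ DsiSet (m + 1) (Function.update Q v (m + 1)) := by
      intro h'
      have h3 := Finset.mem_Ioo.1 (DsiSet_subset _ _ h')
      have h4 : i = m := by omega
      subst h4
      exact hd ((Dsi_add_eq h hv hlow (by omega)).1 h')
    simp [h1, h2]

theorem delta_of_not_mem {m : ℕ} {Q : Tab} (h : Std m Q) {v : ℕ × ℕ} (hv : Q v = 0)
    (hlow : ∀ a, a ≤ v → a ≠ v → Q a ≠ 0)
    (hm : m ∉ DsiSet (m + 1) (Function.update Q v (m + 1))) : ¬ rowIdx Q m < v.1 := by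
  by_cases h0 : m = 0
  · subst h0
    have hv0 : v = (0, 0) := by
      by_contra hne
      have := hlow (0, 0) ⟨by simp, by simp⟩ (fun h => hne h.symm)
      have := h.le (0, 0)
      omega
    rw [hv0]
    simp
  · rwa [← Dsi_add_eq h hv hlow h0]

theorem ext_main (n : ℕ) (I : Finset ℕ) (hI : I ⊆ Finset.Ioo 0 n)
    (K : Finset ℕ → MvPolynomial ℕ ℚ) (h : Tab → ℕ → ℕ)
    (hK : ∀ S, eProd (n + 1) (h S) = K (Dsic n S)) :
    Submodule.span ℚ {p | ∃ w : Equiv.Perm ℕ, SuppIn (n + 1) w ∧ DslSet (n + 1) w ⊆ I ∧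
      p = Fw (n + 1) w * K (DslSet (n + 1) w)} =
    ⨆ q : SIdx n I, ExtVSh n q.1.1 q.1.2 (h q.1.2) := by
  apply le_antisymm
  · rw [Submodule.span_le]
    rintro p ⟨w, hw, hwI, rfl⟩
    obtain ⟨ν, hP, hQ, hPs, hQs, hD⟩ := RS_forward hw
    obtain ⟨v, hv⟩ := hQ.surj (n + 1) (by omega) le_rfl
    obtain ⟨hR, hRs⟩ := hQ.remove hv
    set Q := Function.update (Qtab (n + 1) w) v 0 with hQdef
    have hQv : Q v = 0 := by simp [hQdef]
    have hlow : ∀ a, a ≤ v → a ≠ v → Q a ≠ 0 := by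
      intro a hav hne
      rw [hRs]
      exact ⟨(hQ.mono a v hav hne (by omega)).1, hne⟩
    have hback : Function.update Q v (n + 1) = Qtab (n + 1) w := by
      rw [hQdef, Function.update_idem]
      exact Function.update_eq_self_iff.2 hv.symm
    have hvν : v ∈ ν.cells := (hQs v).1 (by omega)
    have hmaxv : ∀ b, v ≤ b → b ≠ v → b ∉ ν.cells := by
      intro b hvb hne hb
      have h1 := (hQ.mono v b hvb (fun h => hne h.symm) ((hQs b).2 hb)).2
      have h2 := hQ.le b
      omega
    let μ : YoungDiagram := ⟨ν.cells.erase v, by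
      intro a b hba ha
      rw [Finset.mem_coe, Finset.mem_erase] at ha ⊢
      refine ⟨?_, ν.isLowerSet hba ha.2⟩
      rintro rfl
      exact hmaxv a hba ha.1 ha.2⟩
    have hQμ : ∀ a, Q a ≠ 0 ↔ a ∈ μ.cells := by
      intro a
      rw [hRs, hQs]
      show _ ↔ a ∈ ν.cells.erase v
      rw [Finset.mem_erase]
      tauto
    have hins : insert v μ.cells = ν.cells := Finset.insert_erase hvν
    obtain ⟨S, hS, hSs, hSe⟩ := evac_surj hR hQμ
    have hn : n ∉ DsiSet (n + 1) (Function.update Q v (n + 1)) := by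
      rw [hback, ← hD]
      intro h'
      have := Finset.mem_Ioo.1 (hI (hwI h'))
      omega
    have hdel := delta_of_not_mem hR hQv hlow hn
    have hDS : Dsic n S = DslSet (n + 1) w := by
      rw [Dsic_eq hS, hSe, hD, ← hback, Dsi_add_same hR hQv hlow hdel]
    let q : SIdx n I := ⟨(μ, S), hR.card _ hQμ, hS.isStandard hSs, by rw [hDS]; exact hwI⟩
    refine Submodule.mem_iSup_of_mem q ?_
    show _ ∈ ExtVSh n μ S (h S)
    refine Submodule.mem_iSup_of_mem v ?_
    refine Submodule.mem_iSup_of_mem ⟨⟨?_, ν, hins.symm⟩, ?_⟩ ?_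
    · show v ∉ ν.cells.erase v
      simp
    · rw [deltaSV, hSe, if_neg hdel]
    · rw [hins, VSh, polyMul, hK, hDS]
      refine ⟨Fw (n + 1) w, ?_, ?_⟩
      · apply Submodule.subset_span
        refine ⟨Ptab (n + 1) w, (hP.isStandard hPs).1, ?_⟩
        rw [Fw, Sadd, hSe, hback, Qt]
      · rw [LinearMap.mulLeft_apply, mul_comm]
  · refine iSup_le ?_
    rintro ⟨⟨μ, S⟩, hcard, hst, hDI⟩
    dsimp only at hcard hst hDI ⊢
    refine iSup_le fun v => iSup_le ?_
    rintro ⟨⟨hvμ, ν, hν⟩, hdelta⟩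
    obtain ⟨hS, hSs⟩ := Std.of_isStandard hst hcard
    obtain ⟨hE, hEs, -⟩ := evac_spec n S hS
    change Std n (evac n S) at hE
    change ∀ a, evac n S a ≠ 0 ↔ S a ≠ 0 at hEs
    have hEμ : ∀ a, evac n S a ≠ 0 ↔ a ∈ μ.cells := fun a => (hEs a).trans (hSs a)
    have hv0 : evac n S v = 0 := by
      by_contra hh
      exact hvμ ((hEμ v).1 hh)
    have hlow : ∀ a, a ≤ v → a ≠ v → evac n S a ≠ 0 := by
      intro a hav hne
      rw [hEμ]
      have hvν : v ∈ ν.cells := by rw [hν]; exact Finset.mem_insert_self _ _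
      have haν : a ∈ ν.cells := ν.isLowerSet hav hvν
      rw [hν, Finset.mem_insert] at haν
      exact haν.resolve_left hne
    have hdel : ¬ rowIdx (evac n S) n < v.1 := by
      intro hh
      rw [deltaSV, if_pos hh] at hdelta
      omega
    have hA := hE.add hv0 hlow
    have hAs : ∀ a, Function.update (evac n S) v (n + 1) a ≠ 0 ↔ a ∈ ν.cells := by
      intro a
      rw [hν, Finset.mem_insert]
      by_cases ha : a = v
      · subst ha; simp
      · rw [Function.update_of_ne ha, hEμ]; simp [ha]
    have hsame := Dsi_add_same hE hv0 hlow hdel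
    rw [← Dsic_eq hS] at hsame
    have hνcard : ν.cells.card = n + 1 := hA.card _ hAs
    rw [← hν, VSh, polyMul, hK, Submodule.map_le_iff_le_comap]
    apply VS_le _ _ hνcard
    intro T hT hTs
    obtain ⟨w, hw, hPw, hQw⟩ := RS_backward hT hA hTs hAs
    obtain ⟨-, -, -, -, -, hD⟩ := RS_forward hw
    rw [hQw, hsame] at hD
    rw [Submodule.mem_comap, LinearMap.mulLeft_apply]
    apply Submodule.subset_span
    refine ⟨w, hw, by rw [hD]; exact hDI, ?_⟩
    rw [hD, Fw, hPw, Qt, hQw, mul_comm]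
    rfl

theorem rIdxI_succ (n : ℕ) (I : Finset ℕ) {i : ℕ} (hi : i < n) :
    rIdxI (n + 1) I i = rIdxI n I i := by
  unfold rIdxI
  congr 1
  ext j
  simp only [Finset.mem_filter, Finset.mem_sdiff, Finset.mem_Ioo]
  constructor
  · rintro ⟨⟨⟨h1, h2⟩, h3⟩, h4⟩
    exact ⟨⟨⟨h1, by omega⟩, h3⟩, h4⟩
  · rintro ⟨⟨⟨h1, h2⟩, h3⟩, h4⟩
    exact ⟨⟨⟨h1, by omega⟩, h3⟩, h4⟩

theorem rIdxI_le (n : ℕ) (I : Finset ℕ) (i : ℕ) : rIdxI n I i ≤ n := by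
  unfold rIdxI
  refine (Finset.card_filter_le _ _).trans ((Finset.card_le_card Finset.sdiff_subset).trans ?_)
  simp

theorem esym_zero (n : ℕ) : esym n 0 = 1 := by
  simp [esym]

theorem eProd_hSI (n : ℕ) (I : Finset ℕ) (hI : I ⊆ Finset.Ioo 0 n) (S : Tab) :
    eProd (n + 1) (hSI n I S) = ∏ i ∈ I \ Dsic n S, esym (n + 1) (rIdxI (n + 1) I i) := by
  have h1 : ∏ i ∈ I \ Dsic n S, esym (n + 1) (rIdxI (n + 1) I i) =
      ∏ i ∈ I \ Dsic n S, esym (n + 1) (rIdxI n I i) := by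
    refine Finset.prod_congr rfl fun i hi => ?_
    rw [rIdxI_succ n I (Finset.mem_Ioo.1 (hI (Finset.mem_sdiff.1 hi).1)).2]
  have h2 : ∀ i ∈ I \ Dsic n S, rIdxI n I i ∈ Finset.Icc 0 (n + 1) := by
    intro i _
    have := rIdxI_le n I i
    rw [Finset.mem_Icc]
    omega
  rw [h1, ← Finset.prod_fiberwise_of_maps_to' h2 (fun r => esym (n + 1) r), eProd]
  refine Finset.prod_subset_one_on_sdiff ?_ ?_ ?_
  · intro r hr
    rw [Finset.mem_Icc] at hr ⊢
    omega
  · intro r hr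
    have : r = 0 := by
      simp only [Finset.mem_sdiff, Finset.mem_Icc] at hr
      omega
    subst this
    simp [esym_zero]
  · intro r hr
    rw [Finset.prod_const, hSI, if_pos (Finset.mem_Icc.1 hr).1]

theorem eProd_hInd (n : ℕ) (I : Finset ℕ) (hI : I ⊆ Finset.Ioo 0 n) (S : Tab) :
    eProd (n + 1) (hInd n I S) = ∏ i ∈ I \ Dsic n S, esym (n + 1) i := by
  rw [eProd]
  symm
  refine Finset.prod_subset_one_on_sdiff ?_ ?_ ?_
  · intro r hr
    have := Finset.mem_Ioo.1 (hI (Finset.mem_sdiff.1 hr).1)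
    rw [Finset.mem_Icc]
    omega
  · intro r hr
    rw [hInd, if_neg (Finset.mem_sdiff.1 hr).2, pow_zero]
  · intro r hr
    rw [hInd, if_pos hr, pow_one]



/-- For `I ⊆ {1,…,n-1}`, also regarded inside `{1,…,n}`, applying `Ext`
summand-by-summand to the decompositions of `R_{n,I}` and `R^hom_{n,I}` gives
`R_{n+1,I} = Ext R_{n,I}` and `R^hom_{n+1,I} = Ext R^hom_{n,I}`. -/
theorem statement_4 (n : ℕ) (I : Finset ℕ) (hI : I ⊆ Finset.Ioo 0 n) :
    RnI (n + 1) I = ExtR n I ∧ RnIhom (n + 1) I = ExtRhom n I := by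
  constructor
  · exact ext_main n I hI (fun D => ∏ i ∈ I \ D, esym (n + 1) (rIdxI (n + 1) I i)) (hSI n I)
      (eProd_hSI n I hI)
  · exact ext_main n I hI (fun D => ∏ i ∈ I \ D, esym (n + 1) i) (hInd n I) (eProd_hInd n I hI)

end HigherSpecht
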